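/- Let τ ∈ ℂ be a proper root of unity. Then the set Neg of negligible morphisms is a nonzero proper ideal of TL(τ), and every nonzero proper ideal of TL(τ) equals Neg; that is, Neg is the unique nonzero proper ideal of TL(τ). -/

import Mathlib

/-!
Common definitions: the Temperley–Lieb category over a field `K` with loop
parameter `d`.

An `(m,n)`-Temperley–Lieb diagram is a noncrossing perfect matching of `m`
marked points on the top edge and `n` marked points on the bottom edge of a
rectangle.  We encode it as a fixed-point-free involution of
`Fin m ⊕ Fin n` (`Sum.inl i` is the `i`-th top point, `Sum.inr j` the `j`-th
bottom point) which is noncrossing with respect to the boundary order of the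
points (top points from left to right, then bottom points from right to left).
-/

open scoped Classical

namespace TL

/-- The position of a marked point in the linear boundary order of the
rectangle: top points `0, …, m-1` from left to right, then bottom points
from right to left. -/
def bIdx (m n : ℕ) : Fin m ⊕ Fin n → ℕ
  | Sum.inl i => (i : ℕ)
  | Sum.inr j => m + (n - 1 - (j : ℕ))

/-- An `(m,n)`-Temperley–Lieb diagram: a noncrossing perfect matching
(= fixed-point-free involution) of the `m` top points and `n` bottom points. -/
structure Diagram (m n : ℕ) where
  pair : Fin m ⊕ Fin n → Fin m ⊕ Fin n
  involutive : Function.Involutive pair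
  fixedPointFree : ∀ x, pair x ≠ x
  noncrossing : ∀ x y, ¬ (bIdx m n x < bIdx m n y ∧ bIdx m n y < bIdx m n (pair x) ∧
      bIdx m n (pair x) < bIdx m n (pair y))

noncomputable instance (m n : ℕ) : Fintype (Diagram m n) :=
  Fintype.ofInjective (fun D => D.pair)
    (fun a b h => by cases a; cases b; simpa using h)

/-- `Hom K m n` is the `K`-vector space of morphisms from `m` to `n`:
the free vector space on the set of `(m,n)`-TL diagrams, realized as the
space of `K`-valued functions on the (finite) set of diagrams. -/
abbrev Hom (K : Type) [Field K] (m n : ℕ) : Type := Diagram m n → K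

variable {K : Type} [Field K]

/-- The basis vector of `Hom K m n` corresponding to a single diagram. -/
noncomputable def single {m n : ℕ} (p : Diagram m n) : Hom K m n :=
  fun c => if c = p then 1 else 0

/-! ### Composition -/

/-- The marked points of the picture obtained by stacking an `(l,m)`-diagram
on top of an `(m,n)`-diagram: `l` top points, `m` middle points, `n` bottom
points. -/
abbrev Pt (l m n : ℕ) := Fin l ⊕ (Fin m ⊕ Fin n)

/-- One strand of the stacked picture: either a strand of the top diagram `a`
(on the `l` top and `m` middle points) or a strand of the bottom diagram `b`
(on the `m` middle and `n` bottom points). -/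
def Step {l m n : ℕ} (a : Diagram l m) (b : Diagram m n) : Pt l m n → Pt l m n → Prop :=
  fun x y =>
    (∃ u : Fin l ⊕ Fin m, Sum.map id Sum.inl u = x ∧ Sum.map id Sum.inl (a.pair u) = y) ∨
    (∃ u : Fin m ⊕ Fin n, Sum.inr u = x ∧ Sum.inr (b.pair u) = y)

/-- Connectivity in the stacked picture: two marked points are connected if
they are joined by a path of strands. -/
def Conn {l m n : ℕ} (a : Diagram l m) (b : Diagram m n) : Pt l m n → Pt l m n → Prop :=
  Relation.EqvGen (Step a b)

/-- The points of the middle layer whose connected component stays entirely in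
the middle layer; these components are exactly the closed loops produced when
stacking. -/
def ClosedMid {l m n : ℕ} (a : Diagram l m) (b : Diagram m n) : Set (Pt l m n) :=
  {x | (∃ j : Fin m, x = Sum.inr (Sum.inl j)) ∧
    ∀ y, Conn a b x y → ∃ j : Fin m, y = Sum.inr (Sum.inl j)}

/-- The number of closed loops produced when stacking `a` on top of `b`:
the number of connected components consisting entirely of middle points. -/
noncomputable def numLoops {l m n : ℕ} (a : Diagram l m) (b : Diagram m n) : ℕ :=
  Nat.card (Quotient (⟨fun x y : ClosedMid a b => Conn a b x.1 y.1,
    ⟨fun _ => Relation.EqvGen.refl _, fun h => Relation.EqvGen.symm _ _ h,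
      fun h h' => Relation.EqvGen.trans _ _ _ h h'⟩⟩ : Setoid (ClosedMid a b)))

/-- Composition of two diagrams `b ∘ a` (stack `a` on top of `b`, delete the
`r` closed loops, multiply by `d ^ r`), expressed as an element of
`Hom K l n`: the result is `d ^ r` times the unique `(l,n)`-diagram inducing
the same pairing of the outer points as the connectivity of the stacked
picture. -/
noncomputable def compD (d : K) {l m n : ℕ} (b : Diagram m n) (a : Diagram l m) :
    Hom K l n :=
  fun c =>
    if ∀ x : Fin l ⊕ Fin n,
        Conn a b (Sum.map id Sum.inr x) (Sum.map id Sum.inr (c.pair x))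
    then d ^ numLoops a b else 0

/-- Composition `b ∘ a : Hom K l n` of `b : Hom K m n` with `a : Hom K l m`
(bilinear extension of composition of diagrams). -/
noncomputable def comp (d : K) {l m n : ℕ} (b : Hom K m n) (a : Hom K l m) :
    Hom K l n :=
  fun c => ∑ p : Diagram m n, ∑ q : Diagram l m, b p * a q * compD d p q c

/-! ### Tensor product -/

/-- Relabelling of the marked points of a horizontal juxtaposition of an
`(m,n)`-diagram (placed on the left) and an `(m',n')`-diagram (on the right). -/
def tEquiv (m n m' n' : ℕ) :
    (Fin (m + m') ⊕ Fin (n + n')) ≃ ((Fin m ⊕ Fin n) ⊕ (Fin m' ⊕ Fin n')) :=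
  (Equiv.sumCongr finSumFinEquiv.symm finSumFinEquiv.symm).trans
    (Equiv.sumSumSumComm _ _ _ _)

/-- The pairing of the horizontal juxtaposition of two diagrams. -/
def tensorPair {m n m' n' : ℕ} (a : Diagram m n) (b : Diagram m' n') :
    Fin (m + m') ⊕ Fin (n + n') → Fin (m + m') ⊕ Fin (n + n') :=
  fun x => (tEquiv m n m' n').symm (Sum.map a.pair b.pair (tEquiv m n m' n' x))

/-- The tensor product (horizontal juxtaposition) of two diagrams, as an
element of `Hom K (m+m') (n+n')`: the basis vector of the unique diagram whose
pairing is the juxtaposed pairing. -/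
noncomputable def tensorD {m n m' n' : ℕ} (a : Diagram m n) (b : Diagram m' n') :
    Hom K (m + m') (n + n') :=
  fun c => if c.pair = tensorPair a b then 1 else 0

/-- The tensor product of morphisms (bilinear extension of horizontal
juxtaposition of diagrams). -/
noncomputable def tensor {m n m' n' : ℕ} (x : Hom K m n) (y : Hom K m' n') :
    Hom K (m + m') (n + n') :=
  fun c => ∑ p : Diagram m n, ∑ q : Diagram m' n', x p * y q * tensorD p q c

/-! ### Identity, cup and cap -/

/-- The identity diagram `1_n`: `n` vertical strands. -/
def idD (n : ℕ) : Diagram n n where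
  pair := Sum.elim Sum.inr Sum.inl
  involutive := by rintro (i | i) <;> rfl
  fixedPointFree := by rintro (i | i) <;> simp
  noncrossing := by
    rintro (i | i) (j | j) <;>
      · simp only [Sum.elim_inl, Sum.elim_inr, bIdx]
        have hi := i.isLt; have hj := j.isLt; omega

/-- The identity morphism `1_n ∈ T_n`. -/
noncomputable def idHom (K : Type) [Field K] (n : ℕ) : Hom K n n :=
  fun c => if c = idD n then 1 else 0

/-- The cap `∩`: the unique `(0,2)`-TL diagram. -/
def capD : Diagram 0 2 where
  pair := fun x => match x with
    | Sum.inl i => i.elim0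
    | Sum.inr j => Sum.inr ⟨1 - (j : ℕ), by omega⟩
  involutive := by intro x; revert x; decide
  fixedPointFree := by decide
  noncrossing := by decide

/-- The cup `∪`: the unique `(2,0)`-TL diagram. -/
def cupD : Diagram 2 0 where
  pair := fun x => match x with
    | Sum.inl j => Sum.inl ⟨1 - (j : ℕ), by omega⟩
    | Sum.inr i => i.elim0
  involutive := by intro x; revert x; decide
  fixedPointFree := by decide
  noncrossing := by decide

/-- The cap `∩` as a morphism in `Hom K 0 2`. -/
noncomputable def capHom (K : Type) [Field K] : Hom K 0 2 :=
  fun c => if c = capD then 1 else 0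

/-- The cup `∪` as a morphism in `Hom K 2 0`. -/
noncomputable def cupHom (K : Type) [Field K] : Hom K 2 0 :=
  fun c => if c = cupD then 1 else 0

/-! ### The Markov trace -/

/-- The strands of the picture obtained from an `(n,n)`-diagram `p` by closing
it up: joining, for each `i`, the `i`-th top point to the `i`-th bottom point
(by nested arcs passing to the right of the rectangle). -/
def closeStep {n : ℕ} (p : Diagram n n) : (Fin n ⊕ Fin n) → (Fin n ⊕ Fin n) → Prop :=
  fun x y => p.pair x = y ∨ Sum.elim Sum.inr Sum.inl x = y

/-- The number `c(p)` of closed loops of the closure of an `(n,n)`-diagram. -/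
noncomputable def trLoops {n : ℕ} (p : Diagram n n) : ℕ :=
  Nat.card (Quotient (Relation.EqvGen.setoid (closeStep p)))

/-- The Markov trace `Tr_n : T_n → K`, sending a diagram `p` to
`d ^ c(p)`. -/
noncomputable def Tr (d : K) {n : ℕ} (x : Hom K n n) : K :=
  ∑ p : Diagram n n, x p * d ^ trLoops p

/-! ### Conditional expectations -/

/-- The conditional expectation `ε_n : T_{n+1} → T_n`,
`a ↦ (1_n ⊗ ∪) ∘ (a ⊗ 1_1) ∘ (1_n ⊗ ∩)` (closing up the last strand). -/
noncomputable def eps (d : K) (n : ℕ) (a : Hom K (n + 1) (n + 1)) : Hom K n n :=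
  let u : Hom K n (n + 2) := tensor (idHom K n) (capHom K)
  let v : Hom K (n + 2) (n + 2) := @tensor K _ (n + 1) (n + 1) 1 1 a (idHom K 1)
  let w : Hom K (n + 2) n := tensor (idHom K n) (cupHom K)
  comp d w (comp d v u)

/-- The iterated conditional expectation `ε_{n,n+m} = ε_n ∘ ε_{n+1} ∘ ⋯ ∘ ε_{n+m-1} :
T_{n+m} → T_n`. -/
noncomputable def epsIter (d : K) (n : ℕ) : (m : ℕ) → Hom K (n + m) (n + m) → Hom K n n
  | 0, a => a
  | m + 1, a => epsIter d n m (eps d (n + m) a)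

/-! ### Tensor powers of cup and cap -/

/-- `∩^{⊗k} ∈ Hom(0, 2k)`. -/
noncomputable def capPow (K : Type) [Field K] : (k : ℕ) → Hom K 0 (2 * k)
  | 0 => idHom K 0
  | k + 1 => tensor (capPow K k) (capHom K)

/-- `∪^{⊗k} ∈ Hom(2k, 0)`. -/
noncomputable def cupPow (K : Type) [Field K] : (k : ℕ) → Hom K (2 * k) 0
  | 0 => idHom K 0
  | k + 1 => tensor (cupPow K k) (cupHom K)

/-! ### Ideals -/

/-- An ideal of the Temperley–Lieb category over `(K, d)`: a family of vector
subspaces `J m n ⊆ Hom K m n` closed under composition with arbitrary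
morphisms on either side and under tensor product with arbitrary morphisms on
either side. -/
structure IsIdeal (d : K) (J : ∀ m n : ℕ, Set (Hom K m n)) : Prop where
  zero_mem : ∀ m n : ℕ, (0 : Hom K m n) ∈ J m n
  add_mem : ∀ (m n : ℕ), ∀ x ∈ J m n, ∀ y ∈ J m n, x + y ∈ J m n
  smul_mem : ∀ (m n : ℕ) (c : K), ∀ x ∈ J m n, c • x ∈ J m n
  comp_mem_left : ∀ {l m n : ℕ} (b : Hom K m n) (a : Hom K l m),
    a ∈ J l m → comp d b a ∈ J l n
  comp_mem_right : ∀ {l m n : ℕ} (b : Hom K m n) (a : Hom K l m),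
    b ∈ J m n → comp d b a ∈ J l n
  tensor_mem_left : ∀ {m n m' n' : ℕ} (x : Hom K m n) (y : Hom K m' n'),
    x ∈ J m n → tensor x y ∈ J (m + m') (n + n')
  tensor_mem_right : ∀ {m n m' n' : ℕ} (x : Hom K m n) (y : Hom K m' n'),
    y ∈ J m' n' → tensor x y ∈ J (m + m') (n + n')

/-- An ideal is nonzero if some `J m n` contains a nonzero morphism. -/
def IdealNonzero (J : ∀ m n : ℕ, Set (Hom K m n)) : Prop :=
  ∃ (m n : ℕ) (x : Hom K m n), x ∈ J m n ∧ x ≠ 0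

/-- An ideal is proper if it does not contain all morphisms. -/
def IdealProper (J : ∀ m n : ℕ, Set (Hom K m n)) : Prop :=
  ∃ m n : ℕ, J m n ≠ Set.univ

/-- The negligible morphisms: `a ∈ Hom(m,n)` with `Tr_m (b ∘ a) = 0` for all
`b ∈ Hom(n,m)`. -/
def Negl (d : K) (m n : ℕ) : Set (Hom K m n) :=
  {a | ∀ b : Hom K n m, Tr d (comp d b a) = 0}

/-- The ideal generated by a morphism `x ∈ Hom K a b`: the smallest ideal
containing `x`, i.e. the intersection of all ideals containing `x`. -/
def genIdeal (d : K) {a b : ℕ} (x : Hom K a b) (m n : ℕ) : Set (Hom K m n) :=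
  {y | ∀ J : ∀ m' n' : ℕ, Set (Hom K m' n'), IsIdeal d J → x ∈ J a b → y ∈ J m n}

/-! ### Jones–Wenzl idempotents -/

/-- The diagram `E_i ∈ T_n` (here `i` is 0-indexed, `i + 1 < n`): it joins the
`i`-th and `(i+1)`-st top points, the `i`-th and `(i+1)`-st bottom points, and
joins the `j`-th top point vertically to the `j`-th bottom point for all other
`j`; encoded as a pairing function. -/
def eiPair (n i : ℕ) : Fin n ⊕ Fin n → Fin n ⊕ Fin n
  | Sum.inl j =>
      if (j : ℕ) = i then
        Sum.inl ⟨((j : ℕ) + 1) % n, Nat.mod_lt _ (Nat.lt_of_le_of_lt (Nat.zero_le _) j.isLt)⟩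
      else if (j : ℕ) = i + 1 then
        Sum.inl ⟨(j : ℕ) - 1, Nat.lt_of_le_of_lt (Nat.sub_le _ _) j.isLt⟩
      else Sum.inr j
  | Sum.inr j =>
      if (j : ℕ) = i then
        Sum.inr ⟨((j : ℕ) + 1) % n, Nat.mod_lt _ (Nat.lt_of_le_of_lt (Nat.zero_le _) j.isLt)⟩
      else if (j : ℕ) = i + 1 then
        Sum.inr ⟨(j : ℕ) - 1, Nat.lt_of_le_of_lt (Nat.sub_le _ _) j.isLt⟩
      else Sum.inl j

/-- The morphism `E_i ∈ T_n` (0-indexed `i`). -/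
noncomputable def EHom (K : Type) [Field K] (n i : ℕ) : Hom K n n :=
  fun c => if c.pair = eiPair n i then 1 else 0

/-- A Jones–Wenzl idempotent in `T_n`: a nonzero idempotent `p` with
`E_i ∘ p = p ∘ E_i = 0` for all `i` (1-indexed `1 ≤ i ≤ n-1`; here `i` is
0-indexed, so `i + 2 ≤ n`). -/
def IsJonesWenzl (d : K) (n : ℕ) (p : Hom K n n) : Prop :=
  p ≠ 0 ∧ comp d p p = p ∧
    ∀ i : ℕ, i + 2 ≤ n → comp d (EHom K n i) p = 0 ∧ comp d p (EHom K n i) = 0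

/-- The quantum integers `[k] ∈ K`: `[0] = 0`, `[1] = 1`,
`[k+1] = d·[k] − [k−1]`. -/
def qInt (d : K) : ℕ → K
  | 0 => 0
  | 1 => 1
  | k + 2 => d * qInt d (k + 1) - qInt d k

/-! ### Colourings of diagrams -/

/-- The colouring `(s, t)` of the marked points is constant along the strands of `p`. -/
def Respects {m n : ℕ} (p : Diagram m n) (s : Fin m → Bool) (t : Fin n → Bool) : Prop :=
  ∀ x, Sum.elim s t (p.pair x) = Sum.elim s t x

/-- The indicator of `Respects`. -/
noncomputable def colorCount {m n : ℕ} (p : Diagram m n) (s : Fin m → Bool) (t : Fin n → Bool) : ℕ :=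
  if Respects p s t then 1 else 0

theorem Diagram.ext_pair {m n : ℕ} {p q : Diagram m n} (h : ∀ x, p.pair x = q.pair x) : p = q := by
  cases p; cases q
  congr
  exact funext h

theorem exists_coloring {m n : ℕ} (p : Diagram m n) (x : Fin m ⊕ Fin n) :
    ∃ s t, Respects p s t ∧ ∀ y, Sum.elim s t y = true ↔ y = x ∨ y = p.pair x := by
  refine ⟨fun i => decide (Sum.inl i = x ∨ Sum.inl i = p.pair x),
    fun i => decide (Sum.inr i = x ∨ Sum.inr i = p.pair x), ?_, ?_⟩
  · have key : ∀ y, Sum.elim (fun i => decide (Sum.inl i = x ∨ Sum.inl i = p.pair x))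
      (fun i => decide (Sum.inr i = x ∨ Sum.inr i = p.pair x)) y
        = decide (y = x ∨ y = p.pair x) := by
      rintro (y | y) <;> rfl
    intro y
    rw [key, key]
    have h1 : p.pair y = x ↔ y = p.pair x :=
      ⟨fun h => by rw [← h, p.involutive], fun h => by rw [h, p.involutive]⟩
    have h2 : p.pair y = p.pair x ↔ y = x := p.involutive.injective.eq_iff
    simp only [h1, h2, or_comm]
  · rintro (y | y) <;> simp

theorem Diagram.ext_respects {m n : ℕ} {p q : Diagram m n}
    (h : ∀ s t, Respects p s t → Respects q s t) : p = q := by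
  refine Diagram.ext_pair fun x => ?_
  obtain ⟨s, t, hr, hc⟩ := exists_coloring p x
  have h1 := h s t hr x
  have h2 : Sum.elim s t x = true := (hc x).2 (Or.inl rfl)
  rw [h2, hc] at h1
  rcases h1 with h1 | h1
  · exact absurd h1 (q.fixedPointFree x)
  · exact h1.symm

/-- Stacking `q` on top of `p` produces `k` loops and the diagram `c`, expressed by counting
colourings of the middle points with two colours. -/
def IsComp {l m n : ℕ} (p : Diagram m n) (q : Diagram l m) (k : ℕ) (c : Diagram l n) : Prop :=
  ∀ s u, ∑ t, colorCount q s t * colorCount p t u = 2 ^ k * colorCount c s u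

section Conn

variable {l m n : ℕ} (a : Diagram l m) (b : Diagram m n)

theorem conn_of_coloring {x y : Pt l m n}
    (h : ∀ s t u, Respects a s t → Respects b t u →
      Sum.elim s (Sum.elim t u) x = true → Sum.elim s (Sum.elim t u) y = true) : Conn a b x y := by
  let f : Pt l m n → Bool := fun z => decide (Conn a b x z)
  have hf : ∀ z, Sum.elim (f ∘ Sum.inl) (Sum.elim (f ∘ Sum.inr ∘ Sum.inl) (f ∘ Sum.inr ∘ Sum.inr)) z
      = f z := by rintro (z | z | z) <;> rfl
  have hstep : ∀ z w, Step a b z w → f w = f z := by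
    intro z w hzw
    simp only [f, decide_eq_decide]
    exact ⟨fun h => h.trans _ _ _ (.symm _ _ (.rel _ _ hzw)), fun h => h.trans _ _ _ (.rel _ _ hzw)⟩
  have := h (f ∘ Sum.inl) (f ∘ Sum.inr ∘ Sum.inl) (f ∘ Sum.inr ∘ Sum.inr)
    (fun z => by
      have e : ∀ w, Sum.elim (f ∘ Sum.inl) (f ∘ Sum.inr ∘ Sum.inl) w = f (Sum.map id Sum.inl w) := by
        rintro (w | w) <;> rfl
      rw [e, e]
      exact hstep _ _ (Or.inl ⟨z, rfl, rfl⟩))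
    (fun z => by
      have e : ∀ w, Sum.elim (f ∘ Sum.inr ∘ Sum.inl) (f ∘ Sum.inr ∘ Sum.inr) w = f (Sum.inr w) := by
        rintro (w | w) <;> rfl
      rw [e, e]
      exact hstep _ _ (Or.inr ⟨z, rfl, rfl⟩))
  rw [hf, hf] at this
  exact of_decide_eq_true (this (decide_eq_true (Relation.EqvGen.refl x)))

variable {a b}

theorem Conn.coloring_eq {s t u} (ha : Respects a s t) (hb : Respects b t u) {x y : Pt l m n}
    (h : Conn a b x y) : Sum.elim s (Sum.elim t u) x = Sum.elim s (Sum.elim t u) y := by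
  induction h with
  | rel x y h =>
    rcases h with ⟨v, rfl, rfl⟩ | ⟨v, rfl, rfl⟩
    · have e : ∀ w, Sum.elim s (Sum.elim t u) (Sum.map id Sum.inl w) = Sum.elim s t w := by
        rintro (w | w) <;> rfl
      rw [e, e, ha]
    · exact (hb v).symm
  | refl x => rfl
  | symm x y _ ih => exact ih.symm
  | trans x y z _ _ h1 h2 => exact h1.trans h2

theorem IsComp.respects {k : ℕ} {c : Diagram l n} (h : IsComp b a k c) {s t u}
    (ha : Respects a s t) (hb : Respects b t u) : Respects c s u := by
  by_contra hc
  have h1 := h s u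
  simp only [colorCount, if_neg hc, mul_zero, Finset.sum_eq_zero_iff] at h1
  simpa [ha, hb] using h1 t

theorem IsComp.exists_respects {k : ℕ} {c : Diagram l n} (h : IsComp b a k c) {s u}
    (hc : Respects c s u) : ∃ t, Respects a s t ∧ Respects b t u := by
  by_contra! hn
  have h1 := h s u
  rw [Finset.sum_eq_zero] at h1
  · rw [colorCount, if_pos hc, mul_one] at h1
    exact absurd h1 (by positivity)
  · intro t _
    by_cases ha : Respects a s t
    · simp [colorCount, hn t ha]
    · simp [colorCount, ha]

theorem elim_outer {s : Fin l → Bool} {t : Fin m → Bool} {u : Fin n → Bool} (x : Fin l ⊕ Fin n) :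
    Sum.elim s (Sum.elim t u) (Sum.map id Sum.inr x) = Sum.elim s u x := by
  rcases x with x | x <;> rfl

theorem IsComp.conn {k : ℕ} {c : Diagram l n} (h : IsComp b a k c) (x : Fin l ⊕ Fin n) :
    Conn a b (Sum.map id Sum.inr x) (Sum.map id Sum.inr (c.pair x)) := by
  refine conn_of_coloring a b fun s t u ha hb => ?_
  rw [elim_outer, elim_outer, h.respects ha hb]
  exact id

theorem IsComp.eq_of_conn {k : ℕ} {c c' : Diagram l n} (h : IsComp b a k c)
    (h' : ∀ x : Fin l ⊕ Fin n,
      Conn a b (Sum.map id Sum.inr x) (Sum.map id Sum.inr (c'.pair x))) : c' = c := by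
  refine (Diagram.ext_respects fun s u hc x => ?_).symm
  obtain ⟨t, ha, hb⟩ := h.exists_respects hc
  have := (h' x).coloring_eq ha hb
  rw [elim_outer, elim_outer] at this
  exact this.symm

variable (a b)

theorem sum_colorCount_false : ∑ t, colorCount a (fun _ => false) t * colorCount b t (fun _ => false)
    = 2 ^ numLoops a b := by
  have h1 : ∑ t, colorCount a (fun _ => false) t * colorCount b t (fun _ => false)
      = Nat.card {t // Respects a (fun _ => false) t ∧ Respects b t (fun _ => false)} := by
    rw [Nat.card_eq_fintype_card, Fintype.card_subtype, Finset.card_filter]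
    refine Finset.sum_congr rfl fun t _ => ?_
    by_cases h : Respects a (fun _ => false) t <;>
      by_cases h' : Respects b t (fun _ => false) <;> simp [colorCount, h, h']
  rw [h1, numLoops]
  set S : Setoid (ClosedMid a b) := _
  have : Finite (ClosedMid a b) := Subtype.finite
  have : Finite (Quotient S) := Quotient.finite _
  have e : Nat.card (Quotient S → Bool) = 2 ^ Nat.card (Quotient S) := by
    rw [Nat.card_fun]; simp
  rw [← e]
  let φ : {t // Respects a (fun _ => false) t ∧ Respects b t (fun _ => false)} → (Quotient S → Bool) :=
    fun t => Quotient.lift (fun x : ClosedMid a b =>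
      Sum.elim (fun _ => false) (Sum.elim t.1 (fun _ => false)) x.1)
      (fun x y h => Conn.coloring_eq t.2.1 t.2.2 h)
  refine Nat.card_eq_of_bijective φ ⟨?_, ?_⟩
  · rintro ⟨t, ha, hb⟩ ⟨t', ha', hb'⟩ h
    ext j
    by_cases hj : (Sum.inr (Sum.inl j) : Pt l m n) ∈ ClosedMid a b
    · exact congrFun h (Quotient.mk _ ⟨_, hj⟩)
    · simp only [ClosedMid, Set.mem_ofPred_eq, not_and, not_forall] at hj
      obtain ⟨y, hy, hy'⟩ := hj ⟨j, rfl⟩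
      have e1 := hy.coloring_eq ha hb
      have e2 := hy.coloring_eq ha' hb'
      rcases y with y | y | y
      · simp at e1 e2; simp [e1, e2]
      · exact absurd ⟨y, rfl⟩ hy'
      · simp at e1 e2; simp [e1, e2]
  · intro g
    let f : Pt l m n → Bool := fun x => if h : x ∈ ClosedMid a b then g (Quotient.mk _ ⟨x, h⟩) else false
    have hf : ∀ x y, Step a b x y → f y = f x := by
      intro x y hxy
      have hc : Conn a b x y := .rel _ _ hxy
      by_cases hx : x ∈ ClosedMid a b
      · have hy : y ∈ ClosedMid a b :=
          ⟨hx.2 y hc, fun z hz => hx.2 z (.trans _ _ _ hc hz)⟩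
        simp only [f, dif_pos hx, dif_pos hy]
        exact congrArg g (Quotient.sound (.symm _ _ hc))
      · have hy : y ∉ ClosedMid a b := fun hy => hx
          ⟨hy.2 x (.symm _ _ hc), fun z hz => hy.2 z (.trans _ _ _ (.symm _ _ hc) hz)⟩
        simp only [f, dif_neg hx, dif_neg hy]
    have hl : ∀ i, f (Sum.inl i) = false := fun i => by
      refine dif_neg fun h => ?_
      obtain ⟨j, hj⟩ := h.1
      exact Sum.inl_ne_inr hj
    have hr : ∀ i, f (Sum.inr (Sum.inr i)) = false := fun i => by
      refine dif_neg fun h => ?_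
      obtain ⟨j, hj⟩ := h.1
      exact Sum.inr_ne_inl (Sum.inr_injective hj)
    refine ⟨⟨fun j => f (Sum.inr (Sum.inl j)), ?_, ?_⟩, ?_⟩
    · intro x
      have e : ∀ w, Sum.elim (fun _ => false) (fun j => f (Sum.inr (Sum.inl j))) w
          = f (Sum.map id Sum.inl w) := by
        rintro (w | w)
        · exact (hl w).symm
        · rfl
      rw [e, e]
      exact hf _ _ (Or.inl ⟨x, rfl, rfl⟩)
    · intro x
      have e : ∀ w, Sum.elim (fun j => f (Sum.inr (Sum.inl j))) (fun _ => false) w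
          = f (Sum.inr w) := by
        rintro (w | w)
        · rfl
        · exact (hr w).symm
      rw [e, e]
      exact hf _ _ (Or.inr ⟨x, rfl, rfl⟩)
    · funext z
      induction z using Quotient.inductionOn with
      | h x =>
        obtain ⟨x, hx⟩ := x
        obtain ⟨j, rfl⟩ := hx.1
        exact dif_pos hx

variable {a b}

theorem respects_false {m n : ℕ} (p : Diagram m n) : Respects p (fun _ => false) (fun _ => false) := by
  intro x
  rcases p.pair x with y | y <;> rcases x with x | x <;> rfl

theorem IsComp.numLoops_eq {k : ℕ} {c : Diagram l n} (h : IsComp b a k c) : numLoops a b = k := by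
  have h1 := h (fun _ => false) (fun _ => false)
  rw [sum_colorCount_false, colorCount, if_pos (respects_false c), mul_one] at h1
  exact Nat.pow_right_injective le_rfl h1

theorem IsComp.compD_eq {k : ℕ} {c : Diagram l n} (h : IsComp b a k c) (d : K) :
    compD d b a = d ^ k • single c := by
  funext c'
  simp only [compD, h.numLoops_eq, single, Pi.smul_apply, smul_eq_mul, mul_ite, mul_one, mul_zero]
  congr 1
  rw [eq_iff_iff]
  exact ⟨h.eq_of_conn, fun e => e ▸ h.conn⟩

end Conn

theorem sum_colorCount_diag {n : ℕ} (p : Diagram n n) : ∑ t, colorCount p t t = 2 ^ trLoops p := by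
  have h1 : ∑ t, colorCount p t t = Nat.card {t // Respects p t t} := by
    rw [Nat.card_eq_fintype_card, Fintype.card_subtype, Finset.card_filter]
    rfl
  rw [h1, trLoops]
  set S := Relation.EqvGen.setoid (closeStep p)
  have : Finite (Quotient S) := Quotient.finite _
  have e : Nat.card (Quotient S → Bool) = 2 ^ Nat.card (Quotient S) := by
    rw [Nat.card_fun]; simp
  rw [← e]
  let φ : {t // Respects p t t} → (Quotient S → Bool) := fun t =>
    Quotient.lift (Sum.elim t.1 t.1) (fun x y h => by
      induction h with
      | rel x y h =>
        rcases h with rfl | rfl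
        · exact (t.2 x).symm
        · rcases x with x | x <;> rfl
      | refl x => rfl
      | symm x y _ ih => exact ih.symm
      | trans x y z _ _ h1 h2 => exact h1.trans h2)
  refine Nat.card_eq_of_bijective φ ⟨?_, ?_⟩
  · rintro ⟨t, ht⟩ ⟨t', ht'⟩ h
    ext j
    exact congrFun h (Quotient.mk _ (Sum.inl j))
  · intro g
    have hg : ∀ x, Sum.elim (fun j => g (Quotient.mk S (Sum.inl j)))
        (fun j => g (Quotient.mk S (Sum.inl j))) x = g (Quotient.mk S x) := by
      rintro (x | x)
      · rfl
      · exact congrArg g (Quotient.sound (.rel _ _ (Or.inr rfl)))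
    refine ⟨⟨fun j => g (Quotient.mk _ (Sum.inl j)), fun x => ?_⟩, ?_⟩
    · rw [hg, hg]
      exact congrArg g (Quotient.sound (.symm _ _ (.rel _ _ (Or.inl rfl))))
    · funext z
      induction z using Quotient.inductionOn with
      | h x => exact hg x

/-! ### Insertion and contraction of adjacent points -/

theorem bIdx_injective (m n : ℕ) : Function.Injective (bIdx m n) := by
  rintro (x | x) (y | y) h <;> simp only [bIdx] at h <;> have hx := x.isLt <;> have hy := y.isLt
  · congr 1; omega
  · omega
  · omega
  · congr 1; omega

theorem Diagram.between {m n : ℕ} (p : Diagram m n) {x y : Fin m ⊕ Fin n}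
    (h1 : bIdx m n x < bIdx m n y) (h2 : bIdx m n y < bIdx m n (p.pair x)) :
    bIdx m n x < bIdx m n (p.pair y) ∧ bIdx m n (p.pair y) < bIdx m n (p.pair x) := by
  have n1 := p.noncrossing x y
  have n2 := p.noncrossing (p.pair y) x
  rw [p.involutive y] at n2
  have e1 : bIdx m n (p.pair y) ≠ bIdx m n x := fun h => by
    have h := bIdx_injective _ _ h
    rw [← h, p.involutive] at h2
    omega
  have e2 : bIdx m n (p.pair y) ≠ bIdx m n (p.pair x) := fun h => by
    have h := p.involutive.injective (bIdx_injective _ _ h)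
    rw [h] at h1
    omega
  omega

/-- The order embedding `Fin m → Fin (m + 2)` that avoids `i` and `i + 1`. -/
def skip {m : ℕ} (i : Fin (m + 1)) (j : Fin m) : Fin (m + 2) :=
  ⟨if (j : ℕ) < i then j else j + 2, by have := j.isLt; split <;> omega⟩

theorem skip_val {m : ℕ} (i : Fin (m + 1)) (j : Fin m) :
    (skip i j : ℕ) = if (j : ℕ) < i then (j : ℕ) else j + 2 := rfl

theorem skip_cases {m : ℕ} (i : Fin (m + 1)) (x : Fin (m + 2)) :
    x = i.castSucc ∨ x = i.succ ∨ ∃ j, x = skip i j := by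
  have hx := x.isLt
  have hi := i.isLt
  by_cases h1 : (x : ℕ) < i
  · exact Or.inr (Or.inr ⟨⟨x, by omega⟩, Fin.ext (by simp [skip, h1])⟩)
  by_cases h2 : (x : ℕ) = i
  · exact Or.inl (Fin.ext h2)
  by_cases h3 : (x : ℕ) = i + 1
  · exact Or.inr (Or.inl (Fin.ext h3))
  · refine Or.inr (Or.inr ⟨⟨x - 2, by omega⟩, Fin.ext ?_⟩)
    rw [skip_val, if_neg (by simp; omega)]
    simp
    omega

theorem skip_injective {m : ℕ} (i : Fin (m + 1)) : Function.Injective (skip i) := by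
  intro x y h
  have h := congrArg Fin.val h
  simp only [skip_val] at h
  ext
  split at h <;> split at h <;> omega

theorem skip_ne_castSucc {m : ℕ} (i : Fin (m + 1)) (j : Fin m) : skip i j ≠ i.castSucc := by
  intro h
  have h := congrArg Fin.val h
  simp only [skip_val, Fin.val_castSucc] at h
  split at h <;> omega

theorem skip_ne_succ {m : ℕ} (i : Fin (m + 1)) (j : Fin m) : skip i j ≠ i.succ := by
  intro h
  have h := congrArg Fin.val h
  simp only [skip_val, Fin.val_succ] at h
  split at h <;> omega

/-- `skip i` on the bottom points. -/
def skipS {l m : ℕ} (i : Fin (m + 1)) : Fin l ⊕ Fin m → Fin l ⊕ Fin (m + 2) :=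
  Sum.map id (skip i)

theorem skipS_cases {l m : ℕ} (i : Fin (m + 1)) (x : Fin l ⊕ Fin (m + 2)) :
    x = Sum.inr i.castSucc ∨ x = Sum.inr i.succ ∨ ∃ j, x = skipS i j := by
  rcases x with x | x
  · exact Or.inr (Or.inr ⟨Sum.inl x, rfl⟩)
  · rcases skip_cases i x with rfl | rfl | ⟨j, rfl⟩
    · exact Or.inl rfl
    · exact Or.inr (Or.inl rfl)
    · exact Or.inr (Or.inr ⟨Sum.inr j, rfl⟩)

theorem skipS_injective {l m : ℕ} (i : Fin (m + 1)) : Function.Injective (skipS (l := l) i) :=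
  Function.injective_id.sumMap (skip_injective i)

theorem skipS_ne_castSucc {l m : ℕ} (i : Fin (m + 1)) (j : Fin l ⊕ Fin m) :
    skipS i j ≠ Sum.inr i.castSucc := by
  rcases j with j | j
  · exact Sum.inl_ne_inr
  · exact fun h => skip_ne_castSucc i j (Sum.inr_injective h)

theorem skipS_ne_succ {l m : ℕ} (i : Fin (m + 1)) (j : Fin l ⊕ Fin m) :
    skipS i j ≠ Sum.inr i.succ := by
  rcases j with j | j
  · exact Sum.inl_ne_inr
  · exact fun h => skip_ne_succ i j (Sum.inr_injective h)

theorem inr_castSucc_ne_succ {l m : ℕ} (i : Fin (m + 1)) :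
    (Sum.inr i.castSucc : Fin l ⊕ Fin (m + 2)) ≠ Sum.inr i.succ := fun h => by
  have h := congrArg Fin.val (Sum.inr_injective h)
  simp at h

theorem bIdx_skipS {l m : ℕ} (i : Fin (m + 1)) (x : Fin l ⊕ Fin m) :
    bIdx l (m + 2) (skipS i x) = if bIdx l m x < l + (m - i) then bIdx l m x else bIdx l m x + 2 := by
  by_cases h : bIdx l m x < l + (m - i)
  · rw [if_pos h]
    rcases x with x | x <;> have hx := x.isLt <;> have hi := i.isLt
    · rfl
    · simp only [skipS, bIdx, Sum.map_inr, skip_val] at h ⊢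
      split_ifs <;> omega
  · rw [if_neg h]
    rcases x with x | x <;> have hx := x.isLt <;> have hi := i.isLt
    · simp only [bIdx] at h; omega
    · simp only [skipS, bIdx, Sum.map_inr, skip_val] at h ⊢
      split_ifs <;> omega

theorem bIdx_castSucc {l m : ℕ} (i : Fin (m + 1)) :
    bIdx l (m + 2) (Sum.inr i.castSucc) = l + (m - i) + 1 := by
  have hi := i.isLt
  simp only [bIdx, Fin.val_castSucc]
  omega

theorem bIdx_succ {l m : ℕ} (i : Fin (m + 1)) :
    bIdx l (m + 2) (Sum.inr i.succ) = l + (m - i) := by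
  have hi := i.isLt
  simp only [bIdx, Fin.val_succ]
  omega

theorem exists_insertBot {l m : ℕ} (q : Diagram l m) (i : Fin (m + 1)) :
    ∃ c : Diagram l (m + 2), c.pair (Sum.inr i.castSucc) = Sum.inr i.succ ∧
      c.pair (Sum.inr i.succ) = Sum.inr i.castSucc ∧
      ∀ x, c.pair (skipS i x) = skipS i (q.pair x) := by
  let f : Fin l ⊕ Fin (m + 2) → Fin l ⊕ Fin (m + 2) := fun y =>
    if y = Sum.inr i.castSucc then Sum.inr i.succ else
    if y = Sum.inr i.succ then Sum.inr i.castSucc else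
    if h : ∃ x, y = skipS i x then skipS i (q.pair h.choose) else y
  have f1 : f (Sum.inr i.castSucc) = Sum.inr i.succ := if_pos rfl
  have f2 : f (Sum.inr i.succ) = Sum.inr i.castSucc := by
    simp only [f, if_neg (inr_castSucc_ne_succ i).symm, if_true]
  have f3 : ∀ x, f (skipS i x) = skipS i (q.pair x) := fun x => by
    have h : ∃ y, skipS i x = skipS i y := ⟨x, rfl⟩
    simp only [f, if_neg (skipS_ne_castSucc i x), if_neg (skipS_ne_succ i x), dif_pos h]
    rw [← skipS_injective i h.choose_spec]
  refine ⟨⟨f, fun x => ?_, fun x => ?_, fun x y => ?_⟩, f1, f2, f3⟩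
  · rcases skipS_cases i x with rfl | rfl | ⟨j, rfl⟩
    · rw [f1, f2]
    · rw [f2, f1]
    · rw [f3, f3, q.involutive]
  · rcases skipS_cases i x with rfl | rfl | ⟨j, rfl⟩
    · rw [f1]; exact (inr_castSucc_ne_succ i).symm
    · rw [f2]; exact inr_castSucc_ne_succ i
    · rw [f3]; exact fun h => q.fixedPointFree j (skipS_injective i h)
  · rcases skipS_cases i x with rfl | rfl | ⟨j, rfl⟩ <;>
      rcases skipS_cases i y with rfl | rfl | ⟨k, rfl⟩ <;>
      simp only [f1, f2, f3, bIdx_castSucc, bIdx_succ, bIdx_skipS]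
    · omega
    · omega
    · omega
    · omega
    · omega
    · omega
    · split_ifs <;> omega
    · split_ifs <;> omega
    · have := q.noncrossing j k
      split_ifs <;> omega

/-- Insertion of an arc joining the new bottom points `i` and `i + 1`. -/
noncomputable def insertBot {l m : ℕ} (q : Diagram l m) (i : Fin (m + 1)) : Diagram l (m + 2) :=
  (exists_insertBot q i).choose

theorem insertBot_castSucc {l m : ℕ} (q : Diagram l m) (i : Fin (m + 1)) :
    (insertBot q i).pair (Sum.inr i.castSucc) = Sum.inr i.succ :=
  (exists_insertBot q i).choose_spec.1

theorem insertBot_succ {l m : ℕ} (q : Diagram l m) (i : Fin (m + 1)) :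
    (insertBot q i).pair (Sum.inr i.succ) = Sum.inr i.castSucc :=
  (exists_insertBot q i).choose_spec.2.1

theorem insertBot_skipS {l m : ℕ} (q : Diagram l m) (i : Fin (m + 1)) (x : Fin l ⊕ Fin m) :
    (insertBot q i).pair (skipS i x) = skipS i (q.pair x) :=
  (exists_insertBot q i).choose_spec.2.2 x

theorem elim_skipS {l m : ℕ} (i : Fin (m + 1)) (s : Fin l → Bool) (t : Fin (m + 2) → Bool)
    (x : Fin l ⊕ Fin m) : Sum.elim s t (skipS i x) = Sum.elim s (t ∘ skip i) x := by
  rcases x with x | x <;> rfl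

theorem respects_insertBot {l m : ℕ} (q : Diagram l m) (i : Fin (m + 1)) (s : Fin l → Bool)
    (t : Fin (m + 2) → Bool) :
    Respects (insertBot q i) s t ↔ t i.castSucc = t i.succ ∧ Respects q s (t ∘ skip i) := by
  constructor
  · refine fun h => ⟨?_, fun x => ?_⟩
    · have := h (Sum.inr i.succ)
      rwa [insertBot_succ] at this
    · have := h (skipS i x)
      rwa [insertBot_skipS, elim_skipS, elim_skipS] at this
  · rintro ⟨h1, h2⟩ x
    rcases skipS_cases i x with rfl | rfl | ⟨j, rfl⟩
    · rw [insertBot_castSucc]; exact h1.symm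
    · rw [insertBot_succ]; exact h1
    · rw [insertBot_skipS, elim_skipS, elim_skipS]; exact h2 j

/-- Contraction of the bottom points `i` and `i + 1`. -/
theorem exists_contract {l m : ℕ} (q : Diagram l (m + 2)) (i : Fin (m + 1)) :
    ∃ c : Diagram l m, ∀ x, skipS i (c.pair x) =
      if q.pair (skipS i x) = Sum.inr i.castSucc then q.pair (Sum.inr i.succ) else
      if q.pair (skipS i x) = Sum.inr i.succ then q.pair (Sum.inr i.castSucc) else
      q.pair (skipS i x) := by
  set u : Fin l ⊕ Fin (m + 2) := Sum.inr i.castSucc with hu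
  set v : Fin l ⊕ Fin (m + 2) := Sum.inr i.succ with hv
  have huv : u ≠ v := inr_castSucc_ne_succ i
  have hsu : ∀ x, skipS i x ≠ u := skipS_ne_castSucc i
  have hsv : ∀ x, skipS i x ≠ v := skipS_ne_succ i
  have qq := q.involutive
  have qf := q.fixedPointFree
  have hinv : ∀ x y, q.pair x = y ↔ q.pair y = x := fun x y =>
    ⟨fun h => by rw [← h, qq], fun h => by rw [← h, qq]⟩
  let g : Fin l ⊕ Fin m → Fin l ⊕ Fin (m + 2) := fun x =>
      if q.pair (skipS i x) = u then q.pair v else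
      if q.pair (skipS i x) = v then q.pair u else q.pair (skipS i x)
  have hg : ∀ x, ∃ y, skipS i y = g x := by
    intro x
    have h1 : g x ≠ u := by
      simp only [g]
      split_ifs with h1 h2
      · intro h; rw [hinv] at h h1; exact hsv x (h1.symm.trans h)
      · exact qf u
      · exact h1
    have h2 : g x ≠ v := by
      simp only [g]
      split_ifs with h1 h2
      · exact qf v
      · intro h; rw [hinv] at h h2; exact hsu x (h2.symm.trans h)
      · exact h2
    rcases skipS_cases i (g x) with h | h | ⟨j, h⟩
    · exact absurd h h1
    · exact absurd h h2
    · exact ⟨j, h.symm⟩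
  choose f hf using hg
  have hcase : ∀ x, (q.pair (skipS i x) = u ∧ q.pair v = skipS i (f x)) ∨
      (q.pair (skipS i x) = v ∧ q.pair u = skipS i (f x)) ∨
      q.pair (skipS i x) = skipS i (f x) := by
    intro x
    rw [hf]
    simp only [g]
    split_ifs with h1 h2
    · exact Or.inl ⟨h1, rfl⟩
    · exact Or.inr (Or.inl ⟨h2, rfl⟩)
    · exact Or.inr (Or.inr rfl)
  refine ⟨⟨f, fun x => ?_, fun x hx => ?_, fun x y => ?_⟩, hf⟩
  · apply skipS_injective i
    rcases hcase x with ⟨h1, h2⟩ | ⟨h1, h2⟩ | h1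
    · rw [hinv] at h2 h1
      rw [hf]
      simp only [g, h2]
      rw [if_neg huv.symm, if_pos trivial, h1]
    · rw [hinv] at h2 h1
      rw [hf]
      simp only [g, h2]
      rw [if_pos trivial, h1]
    · rw [hinv] at h1
      rw [hf]
      simp only [g, h1]
      rw [if_neg (hsu x), if_neg (hsv x)]
  · rcases hcase x with ⟨h1, h2⟩ | ⟨h1, h2⟩ | h1
    · rw [hx, hinv] at h2; exact huv (h1.symm.trans h2)
    · rw [hx, hinv] at h2; exact huv (h2.symm.trans h1)
    · rw [hx] at h1; exact qf _ h1
  · have hlt : ∀ z w, bIdx l m z < bIdx l m w →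
        bIdx l (m + 2) (skipS i z) < bIdx l (m + 2) (skipS i w) := by
      intro z w h
      rw [bIdx_skipS, bIdx_skipS]
      split_ifs <;> omega
    rintro ⟨h1, h2, h3⟩
    replace h1 := hlt _ _ h1
    replace h2 := hlt _ _ h2
    replace h3 := hlt _ _ h3
    have bu : bIdx l (m + 2) u = l + (m - i) + 1 := bIdx_castSucc i
    have bv : bIdx l (m + 2) v = l + (m - i) := bIdx_succ i
    have ne : ∀ z, bIdx l (m + 2) (skipS i z) ≠ l + (m - i) ∧
        bIdx l (m + 2) (skipS i z) ≠ l + (m - i) + 1 := fun z =>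
      ⟨fun h => hsv z (bIdx_injective _ _ (h.trans bv.symm)),
        fun h => hsu z (bIdx_injective _ _ (h.trans bu.symm))⟩
    have nx := ne x
    have ny := ne y
    have nx' := ne (f x)
    have ny' := ne (f y)
    have chord : ∀ z w : Fin l ⊕ Fin m, q.pair (skipS i z) = skipS i (f z) → ∀ a b, 
        (a = u ∧ b = v ∨ a = v ∧ b = u) → q.pair (skipS i w) = a → q.pair b = skipS i (f w) →
        bIdx l (m + 2) (skipS i z) < bIdx l (m + 2) (skipS i w) →
        bIdx l (m + 2) (skipS i w) < bIdx l (m + 2) (skipS i (f z)) →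
        bIdx l (m + 2) (skipS i z) < bIdx l (m + 2) (skipS i (f w)) ∧
        bIdx l (m + 2) (skipS i (f w)) < bIdx l (m + 2) (skipS i (f z)) := by
      intro z w hz a b hab ha hb k1 k2
      rw [← hz] at k2
      have k3 := q.between k1 k2
      rw [ha, hz] at k3
      have e1 := ne z
      have e2 := ne (f z)
      have k4 : bIdx l (m + 2) (skipS i z) < bIdx l (m + 2) b ∧
          bIdx l (m + 2) b < bIdx l (m + 2) (q.pair (skipS i z)) := by
        rw [hz]
        rcases hab with ⟨rfl, rfl⟩ | ⟨rfl, rfl⟩ <;> omega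
      have k5 := q.between k4.1 k4.2
      rwa [hb, hz] at k5
    have joined : ∀ a b, (a = u ∧ b = v ∨ a = v ∧ b = u) → q.pair (skipS i x) = a →
        q.pair b = skipS i (f x) → False := by
      intro a b hab ha hb
      rw [hinv] at ha hb
      rcases hcase y with ⟨k1, k2⟩ | ⟨k1, k2⟩ | k1
      · rw [hinv] at k1
        rcases hab with ⟨rfl, rfl⟩ | ⟨rfl, rfl⟩
        · rw [← ha, ← k1] at h1; omega
        · rw [hinv] at hb; rw [← hb, ← k1] at h2; omega
      · rw [hinv] at k1
        rcases hab with ⟨rfl, rfl⟩ | ⟨rfl, rfl⟩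
        · rw [hinv] at hb; rw [← hb, ← k1] at h2; omega
        · rw [← ha, ← k1] at h1; omega
      · -- the chord at `y` separates `x` from `f x`
        have e1 : bIdx l (m + 2) (skipS i (f x)) < bIdx l (m + 2) (q.pair (skipS i y)) := by
          rw [k1]; exact h3
        have e2 := q.between h2 e1
        rw [hb, k1] at e2
        have e3 : bIdx l (m + 2) (skipS i y) < bIdx l (m + 2) a ∧
            bIdx l (m + 2) a < bIdx l (m + 2) (q.pair (skipS i y)) := by
          rw [k1]
          rcases hab with ⟨rfl, rfl⟩ | ⟨rfl, rfl⟩ <;> omega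
        have e4 := q.between e3.1 e3.2
        rw [ha] at e4
        omega
    rcases hcase x with ⟨k1, k2⟩ | ⟨k1, k2⟩ | k1
    · exact joined u v (Or.inl ⟨rfl, rfl⟩) k1 k2
    · exact joined v u (Or.inr ⟨rfl, rfl⟩) k1 k2
    · rcases hcase y with ⟨e1, e2⟩ | ⟨e1, e2⟩ | e1
      · have := chord x y k1 u v (Or.inl ⟨rfl, rfl⟩) e1 e2 h1 h2; omega
      · have := chord x y k1 v u (Or.inr ⟨rfl, rfl⟩) e1 e2 h1 h2; omega
      · have := q.noncrossing (skipS i x) (skipS i y)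
        rw [k1, e1] at this
        exact this ⟨h1, h2, h3⟩

/-! ### Colourings with two inserted points -/

/-- Extension of `r` by the values `a`, `b` at the points `i`, `i + 1`. -/
noncomputable def ins {α : Type} {m : ℕ} (i : Fin (m + 1)) (r : Fin m → α) (a b : α) :
    Fin (m + 2) → α := fun x =>
  if x = i.castSucc then a else if x = i.succ then b else
    if h : ∃ j, x = skip i j then r h.choose else a

section Ins

variable {α : Type} {m : ℕ} (i : Fin (m + 1)) (r : Fin m → α) (a b : α)

theorem ins_castSucc : ins i r a b i.castSucc = a := if_pos rfl

theorem ins_succ : ins i r a b i.succ = b := by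
  have h : i.succ ≠ i.castSucc := fun h => by simpa using congrArg Fin.val h
  simp only [ins, if_neg h, if_true]

theorem ins_skip (j : Fin m) : ins i r a b (skip i j) = r j := by
  have h : ∃ k, skip i j = skip i k := ⟨j, rfl⟩
  simp only [ins, if_neg (skip_ne_castSucc i j), if_neg (skip_ne_succ i j), dif_pos h]
  rw [← skip_injective i h.choose_spec]

theorem ins_comp_skip : ins i r a b ∘ skip i = r := funext (ins_skip i r a b)

theorem ins_eta (t : Fin (m + 2) → α) : ins i (t ∘ skip i) (t i.castSucc) (t i.succ) = t := by
  funext x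
  rcases skip_cases i x with rfl | rfl | ⟨j, rfl⟩
  · rw [ins_castSucc]
  · rw [ins_succ]
  · rw [ins_skip]; rfl

theorem sum_ins [Fintype α] {M : Type} [AddCommMonoid M] (F : (Fin (m + 2) → α) → M) :
    ∑ t, F t = ∑ r : Fin m → α, ∑ a, ∑ b, F (ins i r a b) := by
  let e : (Fin (m + 2) → α) ≃ (Fin m → α) × α × α :=
    { toFun := fun t => (t ∘ skip i, t i.castSucc, t i.succ)
      invFun := fun x => ins i x.1 x.2.1 x.2.2
      left_inv := ins_eta i
      right_inv := fun x => by simp only [ins_comp_skip, ins_castSucc, ins_succ] }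
  rw [← e.symm.sum_comp, Fintype.sum_prod_type]
  simp only [Fintype.sum_prod_type]
  rfl

end Ins

theorem respects_ins {l m : ℕ} (q : Diagram l (m + 2)) (i : Fin (m + 1)) {c : Diagram l m}
    (hc : ∀ x, skipS i (c.pair x) =
      if q.pair (skipS i x) = Sum.inr i.castSucc then q.pair (Sum.inr i.succ) else
      if q.pair (skipS i x) = Sum.inr i.succ then q.pair (Sum.inr i.castSucc) else
      q.pair (skipS i x)) (s : Fin l → Bool) (u : Fin m → Bool) (a : Bool) :
    Respects q s (ins i u a a) ↔ Respects c s u ∧ ∀ x,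
      (q.pair (skipS i x) = Sum.inr i.castSucc ∨ q.pair (skipS i x) = Sum.inr i.succ) →
        Sum.elim s u x = a := by
  have e1 : ∀ x, Sum.elim s (ins i u a a) (skipS i x) = Sum.elim s u x := fun x => by
    rw [elim_skipS, ins_comp_skip]
  have e2 : Sum.elim s (ins i u a a) (Sum.inr i.castSucc) = a := ins_castSucc i u a a
  have e3 : Sum.elim s (ins i u a a) (Sum.inr i.succ) = a := ins_succ i u a a
  constructor
  · intro h
    refine ⟨fun x => ?_, fun x hx => ?_⟩
    · rw [← e1, ← e1, hc]
      split_ifs with h1 h2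
      · rw [h, e3, ← h, h1, e2]
      · rw [h, e2, ← h, h2, e3]
      · exact h _
    · rw [← e1, ← h]
      rcases hx with hx | hx <;> rw [hx]
      · exact e2
      · exact e3
  · rintro ⟨h1, h2⟩ y
    have key : ∀ y, (y = Sum.inr i.castSucc ∨ y = Sum.inr i.succ) →
        Sum.elim s (ins i u a a) (q.pair y) = a := by
      intro y hy
      rcases skipS_cases i (q.pair y) with h | h | ⟨j, h⟩
      · rw [h, e2]
      · rw [h, e3]
      · rw [h, e1]
        refine h2 j ?_
        rwa [← h, q.involutive]
    rcases skipS_cases i y with rfl | rfl | ⟨j, rfl⟩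
    · rw [key _ (Or.inl rfl), e2]
    · rw [key _ (Or.inr rfl), e3]
    · have h3 := hc j
      split_ifs at h3 with h4 h5
      · rw [h4, e2, e1, h2 j (Or.inl h4)]
      · rw [h5, e3, e1, h2 j (Or.inr h5)]
      · rw [← h3, e1, e1]; exact h1 j

/-! ### Reflection of diagrams -/

theorem bIdx_swap {m n : ℕ} (x : Fin m ⊕ Fin n) : bIdx n m x.swap + bIdx m n x + 1 = m + n := by
  rcases x with x | x <;> have hx := x.isLt <;> simp only [Sum.swap_inl, Sum.swap_inr, bIdx] <;> omega

/-- Reflection of a diagram in a horizontal line. -/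
def flip {m n : ℕ} (p : Diagram m n) : Diagram n m where
  pair x := (p.pair x.swap).swap
  involutive x := by simp [p.involutive x.swap]
  fixedPointFree x h := p.fixedPointFree x.swap (by simpa using congrArg Sum.swap h)
  noncrossing x y := by
    have h1 := p.noncrossing (p.pair y.swap) (p.pair x.swap)
    rw [p.involutive, p.involutive] at h1
    have a1 := bIdx_swap x
    have a2 := bIdx_swap y
    have a3 := bIdx_swap (p.pair x.swap)
    have a4 := bIdx_swap (p.pair y.swap)
    omega

theorem flip_flip {m n : ℕ} (p : Diagram m n) : flip (flip p) = p :=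
  Diagram.ext_pair fun x => by simp [flip]

theorem respects_flip {m n : ℕ} (p : Diagram m n) (s : Fin m → Bool) (t : Fin n → Bool) :
    Respects (flip p) t s ↔ Respects p s t := by
  have h : ∀ x : Fin m ⊕ Fin n, Sum.elim t s x.swap = Sum.elim s t x := by
    rintro (x | x) <;> rfl
  constructor
  · intro hr x
    have := hr x.swap
    simpa [flip, h] using this
  · intro hr x
    have h1 := hr x.swap
    rw [← h, ← h] at h1
    simpa [flip] using h1

theorem colorCount_flip {m n : ℕ} (p : Diagram m n) (s : Fin m → Bool) (t : Fin n → Bool) :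
    colorCount (flip p) t s = colorCount p s t := by
  simp only [colorCount, respects_flip]

theorem IsComp.flip {l m n : ℕ} {p : Diagram m n} {q : Diagram l m} {k : ℕ} {c : Diagram l n}
    (h : IsComp p q k c) : IsComp (flip q) (flip p) k (flip c) := by
  intro s u
  simp only [colorCount_flip]
  rw [← h]
  exact Finset.sum_congr rfl fun t _ => mul_comm _ _

/-! ### Identity diagrams and elementary cups and caps -/

theorem respects_idD {m : ℕ} (s t : Fin m → Bool) : Respects (idD m) s t ↔ s = t := by
  constructor
  · intro h
    funext x
    exact (h (Sum.inl x)).symm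
  · rintro rfl (x | x) <;> rfl

theorem flip_idD (m : ℕ) : flip (idD m) = idD m :=
  Diagram.ext_respects fun s t h => by
    rw [respects_flip, respects_idD] at h
    rw [respects_idD, h]

/-- The diagram with `m` through strands and an arc joining the bottom points `i`, `i + 1`. -/
noncomputable def capE {m : ℕ} (i : Fin (m + 1)) : Diagram m (m + 2) := insertBot (idD m) i

/-- The diagram with `m` through strands and an arc joining the top points `i`, `i + 1`. -/
noncomputable def cupE {m : ℕ} (i : Fin (m + 1)) : Diagram (m + 2) m := flip (capE i)

theorem respects_capE {m : ℕ} (i : Fin (m + 1)) (s : Fin m → Bool) (t : Fin (m + 2) → Bool) :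
    Respects (capE i) s t ↔ t i.castSucc = t i.succ ∧ t ∘ skip i = s := by
  rw [capE, respects_insertBot, respects_idD, eq_comm (a := s)]

theorem respects_cupE {m : ℕ} (i : Fin (m + 1)) (s : Fin (m + 2) → Bool) (t : Fin m → Bool) :
    Respects (cupE i) s t ↔ s i.castSucc = s i.succ ∧ s ∘ skip i = t := by
  rw [cupE, respects_flip, respects_capE]

theorem flip_cupE {m : ℕ} (i : Fin (m + 1)) : flip (cupE i) = capE i := flip_flip _

theorem isComp_idD_left {m n : ℕ} (q : Diagram m n) : IsComp (idD n) q 0 q := by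
  intro s u
  rw [Finset.sum_eq_single u]
  · simp [colorCount, respects_idD]
  · intro t _ ht
    simp [colorCount, respects_idD, ht]
  · simp

theorem isComp_idD_right {m n : ℕ} (q : Diagram m n) : IsComp q (idD m) 0 q := by
  have := (isComp_idD_left (flip q)).flip
  rwa [flip_flip, flip_idD] at this

theorem isComp_capE {l m : ℕ} (q : Diagram l m) (i : Fin (m + 1)) :
    IsComp (capE i) q 0 (insertBot q i) := by
  intro s u
  rw [Finset.sum_eq_single (u ∘ skip i)]
  · simp only [colorCount, respects_capE, respects_insertBot]
    by_cases h : u i.castSucc = u i.succ <;> simp [h]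
  · intro t _ ht
    simp [colorCount, respects_capE, ht.symm]
  · simp

theorem exists_isComp_cupE {l m : ℕ} (q : Diagram l (m + 2)) (i : Fin (m + 1)) :
    ∃ k c, IsComp (cupE i) q k c ∧
      (k = if q.pair (Sum.inr i.castSucc) = Sum.inr i.succ then 1 else 0) ∧
      (∀ x, skipS i (c.pair x) =
        if q.pair (skipS i x) = Sum.inr i.castSucc then q.pair (Sum.inr i.succ) else
        if q.pair (skipS i x) = Sum.inr i.succ then q.pair (Sum.inr i.castSucc) else
        q.pair (skipS i x)) := by
  obtain ⟨c, hc⟩ := exists_contract q i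
  have hsum : ∀ s u, ∑ t, colorCount q s t * colorCount (cupE i) t u =
      ∑ a, colorCount q s (ins i u a a) := by
    intro s u
    rw [sum_ins i, Finset.sum_eq_single u]
    · refine Finset.sum_congr rfl fun a _ => ?_
      rw [Finset.sum_eq_single a]
      · simp [colorCount, respects_cupE, ins_castSucc, ins_succ, ins_comp_skip]
      · intro b _ hb
        simp [colorCount, respects_cupE, ins_castSucc, ins_succ, hb.symm]
      · simp
    · intro r _ hr
      simp [colorCount, respects_cupE, ins_comp_skip, hr]
    · simp
  by_cases hj : q.pair (Sum.inr i.castSucc) = Sum.inr i.succ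
  · refine ⟨1, c, fun s u => ?_, (if_pos hj).symm, hc⟩
    have hj' : q.pair (Sum.inr i.succ) = Sum.inr i.castSucc := by rw [← hj, q.involutive]
    have hn : ∀ x, ¬ (q.pair (skipS i x) = Sum.inr i.castSucc ∨
        q.pair (skipS i x) = Sum.inr i.succ) := by
      rintro x (h | h)
      · rw [← hj'] at h
        exact skipS_ne_succ i x (q.involutive.injective h)
      · rw [← hj] at h
        exact skipS_ne_castSucc i x (q.involutive.injective h)
    rw [hsum]
    simp only [colorCount, respects_ins q i hc, hn, false_implies, implies_true, and_true,
      Finset.sum_const, Finset.card_univ, Fintype.card_bool, smul_eq_mul, pow_one]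
  · refine ⟨0, c, fun s u => ?_, (if_neg hj).symm, hc⟩
    obtain ⟨α, hα⟩ : ∃ α, q.pair (Sum.inr i.castSucc) = skipS i α := by
      rcases skipS_cases i (q.pair (Sum.inr i.castSucc)) with h | h | h
      · exact absurd h (q.fixedPointFree _)
      · exact absurd h hj
      · exact h
    have hα' : q.pair (skipS i α) = Sum.inr i.castSucc := by rw [← hα, q.involutive]
    have hβ : q.pair (Sum.inr i.succ) = skipS i (c.pair α) := by rw [hc, if_pos hα']
    have key : ∀ a, Respects q s (ins i u a a) ↔ Respects c s u ∧ a = Sum.elim s u α := by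
      intro a
      rw [respects_ins q i hc]
      refine and_congr_right fun hr => ⟨fun h => (h α (Or.inl hα')).symm, ?_⟩
      rintro rfl x (h | h)
      · rw [← hα'] at h
        rw [skipS_injective i (q.involutive.injective h)]
      · have h : skipS i x = skipS i (c.pair α) := by rw [← hβ, ← h, q.involutive]
        rw [skipS_injective i h, hr]
    rw [hsum]
    simp only [colorCount, key]
    by_cases hr : Respects c s u <;> simp [hr]

/-! ### Existence of compositions -/

theorem exists_eq_insertBot {l m : ℕ} (q : Diagram l (m + 2)) (i : Fin (m + 1))
    (h : q.pair (Sum.inr i.castSucc) = Sum.inr i.succ) : ∃ q', q = insertBot q' i := by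
  obtain ⟨c, hc⟩ := exists_contract q i
  have h' : q.pair (Sum.inr i.succ) = Sum.inr i.castSucc := by rw [← h, q.involutive]
  refine ⟨c, Diagram.ext_pair fun x => ?_⟩
  rcases skipS_cases i x with rfl | rfl | ⟨x, rfl⟩
  · rw [insertBot_castSucc, h]
  · rw [insertBot_succ, h']
  · rw [insertBot_skipS, hc, if_neg, if_neg]
    · rw [← h]
      exact fun e => skipS_ne_castSucc i x (q.involutive.injective e)
    · rw [← h']
      exact fun e => skipS_ne_succ i x (q.involutive.injective e)

/-- No arc of `p` joins two neighbouring top points. -/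
def NoAdjTop {m n : ℕ} (p : Diagram m n) : Prop :=
  ∀ x y : Fin m, (y : ℕ) = x + 1 → p.pair (Sum.inl x) ≠ Sum.inl y

theorem exists_bottom_adj {m n : ℕ} (p : Diagram m n) (h : ¬ NoAdjTop (flip p)) :
    ∃ (n' : ℕ) (e : n = n' + 2) (i : Fin (n' + 1)) (p' : Diagram m n'),
      IsComp (capE i) p' 0 (e ▸ p) := by
  simp only [NoAdjTop, not_forall, not_not] at h
  obtain ⟨x, y, hxy, h⟩ := h
  have hy := y.isLt
  obtain ⟨n, rfl⟩ : ∃ n', n = n' + 2 := ⟨n - 2, by omega⟩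
  obtain ⟨p', hp⟩ := exists_eq_insertBot p ⟨x, by omega⟩ (by
    have h := congrArg Sum.swap h
    simp only [flip, Sum.swap_swap, Sum.swap_inl] at h
    rw [show (Sum.inr (Fin.castSucc ⟨x, by omega⟩) : Fin m ⊕ Fin (n + 2)) = Sum.inr x from rfl, h]
    congr 1
    exact Fin.ext hxy)
  refine ⟨n, rfl, ⟨x, by omega⟩, p', ?_⟩
  rw [hp]
  exact isComp_capE _ _

theorem exists_top_adj {m n : ℕ} (p : Diagram m n) (h : ¬ NoAdjTop p) :
    ∃ (m' : ℕ) (e : m = m' + 2) (i : Fin (m' + 1)) (p' : Diagram m' n),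
      IsComp p' (cupE i) 0 (e ▸ p) := by
  obtain ⟨m', rfl, i, p', hp⟩ := exists_bottom_adj (flip p) (by rwa [flip_flip])
  refine ⟨m', rfl, i, flip p', ?_⟩
  have := hp.flip
  rwa [flip_flip] at this

theorem NoAdjTop.exists_inr {m n : ℕ} {p : Diagram m n} (h : NoAdjTop p) (x : Fin m) :
    ∃ y, p.pair (Sum.inl x) = Sum.inr y := by
  have key : ∀ (k : ℕ) (x y : Fin m), (y : ℕ) - x = k → (x : ℕ) < y →
      p.pair (Sum.inl x) ≠ Sum.inl y := by
    intro k
    induction k using Nat.strong_induction_on with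
    | _ k ih =>
      intro x y hk hxy he
      by_cases h1 : (y : ℕ) = x + 1
      · exact h x y h1 he
      have hy := y.isLt
      let z : Fin m := ⟨x + 1, by omega⟩
      have h2 := p.between (x := Sum.inl x) (y := Sum.inl z) (by simp [bIdx, z])
        (by rw [he]; simp only [bIdx, z]; omega)
      rw [he] at h2
      rcases hz : p.pair (Sum.inl z) with w | w
      · rw [hz] at h2
        simp only [bIdx] at h2
        have h3 : (w : ℕ) ≠ x + 1 := fun e => p.fixedPointFree (Sum.inl z) (by
          rw [hz]; congr 1; exact Fin.ext e)
        exact ih (w - z) (by simp only [z]; omega) z w rfl (by simp only [z]; omega) hz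
      · rw [hz] at h2
        simp only [bIdx] at h2
        omega
  rcases hx : p.pair (Sum.inl x) with y | y
  · exfalso
    rcases lt_trichotomy (x : ℕ) y with hlt | heq | hlt
    · exact key _ x y rfl hlt hx
    · exact p.fixedPointFree (Sum.inl x) (by rw [hx, Fin.ext heq])
    · exact key _ y x rfl hlt (by rw [← hx, p.involutive])
  · exact ⟨y, rfl⟩

theorem NoAdjTop.exists_strictMono {m n : ℕ} {p : Diagram m n} (h : NoAdjTop p) :
    ∃ g : Fin m → Fin n, StrictMono g ∧ ∀ x, p.pair (Sum.inl x) = Sum.inr (g x) := by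
  choose g hg using h.exists_inr
  refine ⟨g, fun x y hxy => ?_, hg⟩
  have h1 := p.between (x := Sum.inl x) (y := Sum.inl y) hxy (by
    rw [hg]; simp only [bIdx]; have := y.isLt; omega)
  rw [hg, hg] at h1
  simp only [bIdx] at h1
  have h2 := (g x).isLt
  have h3 := (g y).isLt
  exact Fin.lt_def.2 (by omega)

theorem NoAdjTop.le {m n : ℕ} {p : Diagram m n} (h : NoAdjTop p) : m ≤ n := by
  obtain ⟨g, hg, -⟩ := h.exists_strictMono
  simpa using Fintype.card_le_of_injective g hg.injective

theorem NoAdjTop.eq_idD {n : ℕ} {p : Diagram n n} (h : NoAdjTop p) : p = idD n := by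
  obtain ⟨g, hg, hp⟩ := h.exists_strictMono
  have hs : Function.Surjective g := Finite.injective_iff_surjective.1 hg.injective
  have hid : g = id := by
    have h1 := Subsingleton.elim (hg.orderIsoOfSurjective g hs) (OrderIso.refl (Fin n))
    funext x
    exact congrArg (fun e : Fin n ≃o Fin n => e x) h1
  subst hid
  refine Diagram.ext_pair ?_
  rintro (x | x)
  · exact hp x
  · rw [← show p.pair (Sum.inl x) = Sum.inr x from hp x, p.involutive, hp]
    rfl

theorem IsComp.assoc {l m n r : ℕ} {a : Diagram l m} {b : Diagram m n} {c : Diagram n r}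
    {ba : Diagram l n} {cb : Diagram m r} {e : Diagram l r} {k j k' : ℕ}
    (h1 : IsComp b a k ba) (h2 : IsComp c b j cb) (h3 : IsComp c ba k' e) (s : Fin l → Bool)
    (u : Fin r → Bool) :
    2 ^ j * ∑ t, colorCount a s t * colorCount cb t u = 2 ^ (k + k') * colorCount e s u := by
  rw [Finset.mul_sum]
  calc ∑ t, 2 ^ j * (colorCount a s t * colorCount cb t u)
      = ∑ t, ∑ v, colorCount a s t * colorCount b t v * colorCount c v u := by
        refine Finset.sum_congr rfl fun t _ => ?_
        rw [mul_left_comm, ← h2, Finset.mul_sum]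
        simp only [mul_assoc]
    _ = ∑ v, (∑ t, colorCount a s t * colorCount b t v) * colorCount c v u := by
        rw [Finset.sum_comm]
        simp only [Finset.sum_mul]
    _ = 2 ^ (k + k') * colorCount e s u := by
        simp only [h1 _ _, mul_assoc]
        rw [← Finset.mul_sum, h3, pow_add, mul_assoc]

theorem IsComp.assoc_zero {l m n r : ℕ} {a : Diagram l m} {b : Diagram m n} {c : Diagram n r}
    {ba : Diagram l n} {cb : Diagram m r} {e : Diagram l r} {k k' : ℕ}
    (h1 : IsComp b a k ba) (h2 : IsComp c b 0 cb) (h3 : IsComp c ba k' e) :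
    IsComp cb a (k + k') e := fun s u => by
  have := h1.assoc h2 h3 s u
  rwa [pow_zero, one_mul] at this

theorem exists_isComp {l m n : ℕ} (p : Diagram m n) (q : Diagram l m) :
    ∃ k c, IsComp p q k c := by
  induction hN : m + n using Nat.strong_induction_on generalizing m n with
  | _ N ih =>
    by_cases hb : NoAdjTop (TL.flip p)
    · by_cases ht : NoAdjTop p
      · obtain rfl : m = n := le_antisymm ht.le hb.le
        rw [ht.eq_idD]
        exact ⟨0, q, isComp_idD_left q⟩
      · obtain ⟨m', rfl, i, p', hp⟩ := exists_top_adj p ht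
        obtain ⟨k, c, hc, -⟩ := exists_isComp_cupE q i
        obtain ⟨k', e, he⟩ := ih (m' + n) (by omega) p' c rfl
        exact ⟨k + k', e, hc.assoc_zero hp he⟩
    · obtain ⟨n', rfl, i, p', hp⟩ := exists_bottom_adj p hb
      obtain ⟨k, c, hc⟩ := ih (m + n') (by omega) p' q rfl
      exact ⟨k + 0, _, hc.assoc_zero hp (isComp_capE c i)⟩

/-- The diagram obtained by stacking `q` on top of `p`. -/
noncomputable def cmpD {l m n : ℕ} (p : Diagram m n) (q : Diagram l m) : Diagram l n :=
  (exists_isComp p q).choose_spec.choose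

theorem isComp_cmpD {l m n : ℕ} (p : Diagram m n) (q : Diagram l m) :
    IsComp p q (numLoops q p) (cmpD p q) := by
  have h : IsComp p q _ (cmpD p q) := (exists_isComp p q).choose_spec.choose_spec
  rwa [← h.numLoops_eq] at h

theorem IsComp.unique {l m n : ℕ} {p : Diagram m n} {q : Diagram l m} {k k' : ℕ}
    {c c' : Diagram l n} (h : IsComp p q k c) (h' : IsComp p q k' c') : k = k' ∧ c = c' :=
  ⟨h.numLoops_eq.symm.trans h'.numLoops_eq, h'.eq_of_conn h.conn⟩

theorem two_pow_mul_colorCount_inj {m n : ℕ} {c c' : Diagram m n} {k k' : ℕ}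
    (h : ∀ s t, 2 ^ k * colorCount c s t = 2 ^ k' * colorCount c' s t) : k = k' ∧ c = c' := by
  refine ⟨?_, Diagram.ext_respects fun s t hr => ?_⟩
  · have h1 := h (fun _ => false) (fun _ => false)
    rw [colorCount, if_pos (respects_false c), colorCount, if_pos (respects_false c'), mul_one,
      mul_one] at h1
    exact Nat.pow_right_injective le_rfl h1
  · have h1 := h s t
    by_contra hn
    rw [colorCount, if_pos hr, colorCount, if_neg hn] at h1
    simp at h1

theorem IsComp.assoc_eq {l m n r : ℕ} {a : Diagram l m} {b : Diagram m n} {c : Diagram n r}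
    {ba : Diagram l n} {cb : Diagram m r} {e e' : Diagram l r} {k j k' j' : ℕ}
    (h1 : IsComp b a k ba) (h2 : IsComp c b j cb) (h3 : IsComp c ba k' e)
    (h4 : IsComp cb a j' e') : j + j' = k + k' ∧ e' = e :=
  two_pow_mul_colorCount_inj fun s u => by
    rw [← h1.assoc h2 h3 s u, h4, pow_add, mul_assoc]

/-! ### Bilinearity -/

theorem hom_induction {m n : ℕ} {P : Hom K m n → Prop} (hs : ∀ p, P (single p)) (h0 : P 0)
    (ha : ∀ x y, P x → P y → P (x + y)) (hm : ∀ (c : K) x, P x → P (c • x)) (x : Hom K m n) :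
    P x := by
  have h : x = ∑ p, x p • single p := by
    funext c
    simp [Finset.sum_apply, single]
  rw [h]
  exact Finset.sum_induction _ P ha h0 fun p _ => hm _ _ (hs p)

section Comp

variable (d : K) {l m n : ℕ}

theorem comp_add (b : Hom K m n) (a a' : Hom K l m) :
    comp d b (a + a') = comp d b a + comp d b a' := by
  funext c
  simp only [comp, Pi.add_apply, mul_add, add_mul, Finset.sum_add_distrib]

theorem add_comp (b b' : Hom K m n) (a : Hom K l m) :
    comp d (b + b') a = comp d b a + comp d b' a := by
  funext c
  simp only [comp, Pi.add_apply, add_mul, Finset.sum_add_distrib]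

theorem comp_smul (k : K) (b : Hom K m n) (a : Hom K l m) :
    comp d b (k • a) = k • comp d b a := by
  funext c
  simp only [comp, Pi.smul_apply, smul_eq_mul, Finset.mul_sum]
  exact Finset.sum_congr rfl fun p _ => Finset.sum_congr rfl fun q _ => by ring

theorem smul_comp (k : K) (b : Hom K m n) (a : Hom K l m) :
    comp d (k • b) a = k • comp d b a := by
  funext c
  simp only [comp, Pi.smul_apply, smul_eq_mul, Finset.mul_sum]
  exact Finset.sum_congr rfl fun p _ => Finset.sum_congr rfl fun q _ => by ring

theorem comp_zero (b : Hom K m n) : comp d b (0 : Hom K l m) = 0 := by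
  simpa using comp_smul d 0 b 0

theorem zero_comp (a : Hom K l m) : comp d (0 : Hom K m n) a = 0 := by
  simpa using smul_comp d 0 0 a

theorem comp_sub (b : Hom K m n) (a a' : Hom K l m) :
    comp d b (a - a') = comp d b a - comp d b a' := by
  rw [eq_sub_iff_add_eq, ← comp_add, sub_add_cancel]

theorem sub_comp (b b' : Hom K m n) (a : Hom K l m) :
    comp d (b - b') a = comp d b a - comp d b' a := by
  rw [eq_sub_iff_add_eq, ← add_comp, sub_add_cancel]

theorem comp_single (b : Diagram m n) (a : Diagram l m) :
    comp d (single b) (single a) = d ^ numLoops a b • single (cmpD b a) := by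
  rw [← (isComp_cmpD b a).compD_eq]
  funext c
  simp [comp, single, ite_mul]

theorem IsComp.comp_eq {b : Diagram m n} {a : Diagram l m} {k : ℕ} {c : Diagram l n}
    (h : IsComp b a k c) : comp d (single b) (single a) = d ^ k • single c := by
  rw [comp_single, h.numLoops_eq, (h.unique (isComp_cmpD b a)).2]

theorem comp_assoc {r : ℕ} (c : Hom K n r) (b : Hom K m n) (a : Hom K l m) :
    comp d (comp d c b) a = comp d c (comp d b a) := by
  induction c using hom_induction with
  | hs c =>
    induction b using hom_induction with
    | hs b =>
      induction a using hom_induction with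
      | hs a =>
        obtain ⟨h1, h2⟩ := (isComp_cmpD b a).assoc_eq (isComp_cmpD c b)
          (isComp_cmpD c (cmpD b a)) (isComp_cmpD (cmpD c b) a)
        simp only [comp_single, smul_comp, comp_smul, smul_smul, ← pow_add, h1, h2]
      | h0 => simp only [comp_zero]
      | ha x y hx hy => simp only [comp_add, hx, hy]
      | hm k x hx => simp only [comp_smul, hx]
    | h0 => simp only [comp_zero, zero_comp]
    | ha x y hx hy => simp only [comp_add, add_comp, hx, hy]
    | hm k x hx => simp only [comp_smul, smul_comp, hx]
  | h0 => simp only [zero_comp]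
  | ha x y hx hy => simp only [add_comp, hx, hy]
  | hm k x hx => simp only [smul_comp, hx]

theorem id_comp (a : Hom K l m) : comp d (idHom K m) a = a := by
  induction a using hom_induction with
  | hs a => exact ((isComp_idD_left a).comp_eq d).trans (by rw [pow_zero, one_smul])
  | h0 => simp only [comp_zero]
  | ha x y hx hy => simp only [comp_add, hx, hy]
  | hm k x hx => simp only [comp_smul, hx]

theorem comp_id (a : Hom K l m) : comp d a (idHom K l) = a := by
  induction a using hom_induction with
  | hs a => exact ((isComp_idD_right a).comp_eq d).trans (by rw [pow_zero, one_smul])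
  | h0 => simp only [zero_comp]
  | ha x y hx hy => simp only [add_comp, hx, hy]
  | hm k x hx => simp only [smul_comp, hx]

end Comp

section Tensor

variable {m n m' n' : ℕ}

theorem tensor_add (x : Hom K m n) (y y' : Hom K m' n') :
    tensor x (y + y') = tensor x y + tensor x y' := by
  funext c
  simp only [tensor, Pi.add_apply, mul_add, add_mul, Finset.sum_add_distrib]

theorem add_tensor (x x' : Hom K m n) (y : Hom K m' n') :
    tensor (x + x') y = tensor x y + tensor x' y := by
  funext c
  simp only [tensor, Pi.add_apply, add_mul, Finset.sum_add_distrib]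

theorem tensor_smul (k : K) (x : Hom K m n) (y : Hom K m' n') :
    tensor x (k • y) = k • tensor x y := by
  funext c
  simp only [tensor, Pi.smul_apply, smul_eq_mul, Finset.mul_sum]
  exact Finset.sum_congr rfl fun p _ => Finset.sum_congr rfl fun q _ => by ring

theorem smul_tensor (k : K) (x : Hom K m n) (y : Hom K m' n') :
    tensor (k • x) y = k • tensor x y := by
  funext c
  simp only [tensor, Pi.smul_apply, smul_eq_mul, Finset.mul_sum]
  exact Finset.sum_congr rfl fun p _ => Finset.sum_congr rfl fun q _ => by ring

theorem tensor_zero (x : Hom K m n) : tensor x (0 : Hom K m' n') = 0 := by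
  simpa using tensor_smul 0 x (0 : Hom K m' n')

theorem zero_tensor (y : Hom K m' n') : tensor (0 : Hom K m n) y = 0 := by
  simpa using smul_tensor 0 (0 : Hom K m n) y

theorem bIdx_tEquiv_symm_inl (x : Fin m ⊕ Fin n) :
    bIdx (m + m') (n + n') ((tEquiv m n m' n').symm (Sum.inl x)) =
      if bIdx m n x < m then bIdx m n x else bIdx m n x + (m' + n') := by
  by_cases h : bIdx m n x < m
  · rw [if_pos h]
    rcases x with x | x <;> have hx := x.isLt
    · simp [tEquiv, bIdx, Equiv.sumSumSumComm]
    · simp only [bIdx] at h; omega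
  · rw [if_neg h]
    rcases x with x | x <;> have hx := x.isLt
    · simp only [bIdx] at h; omega
    · simp [tEquiv, bIdx, Equiv.sumSumSumComm]; omega

theorem bIdx_tEquiv_symm_inr (x : Fin m' ⊕ Fin n') :
    bIdx (m + m') (n + n') ((tEquiv m n m' n').symm (Sum.inr x)) = m + bIdx m' n' x := by
  rcases x with x | x <;> have hx := x.isLt
  · simp [tEquiv, bIdx, Equiv.sumSumSumComm]
  · simp [tEquiv, bIdx, Equiv.sumSumSumComm]; omega

theorem bIdx_lt (x : Fin m ⊕ Fin n) : bIdx m n x < m + n := by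
  rcases x with x | x <;> have hx := x.isLt <;> simp only [bIdx] <;> omega

/-- Juxtaposition of diagrams. -/
def tenD (p : Diagram m n) (q : Diagram m' n') : Diagram (m + m') (n + n') where
  pair := tensorPair p q
  involutive x := by
    obtain ⟨x, rfl⟩ := (tEquiv m n m' n').symm.surjective x
    rcases x with x | x
    · simp [tensorPair, p.involutive x]
    · simp [tensorPair, q.involutive x]
  fixedPointFree x := by
    obtain ⟨x, rfl⟩ := (tEquiv m n m' n').symm.surjective x
    rcases x with x | x
    · simp [tensorPair, p.fixedPointFree x]
    · simp [tensorPair, q.fixedPointFree x]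
  noncrossing x y := by
    obtain ⟨x, rfl⟩ := (tEquiv m n m' n').symm.surjective x
    obtain ⟨y, rfl⟩ := (tEquiv m n m' n').symm.surjective y
    rcases x with x | x <;> rcases y with y | y <;>
      simp only [tensorPair, Equiv.apply_symm_apply, Sum.map_inl, Sum.map_inr,
        bIdx_tEquiv_symm_inl, bIdx_tEquiv_symm_inr]
    · have := p.noncrossing x y
      split_ifs <;> omega
    · have h1 := bIdx_lt y
      have h2 := bIdx_lt (q.pair y)
      split_ifs <;> omega
    · have h1 := bIdx_lt x
      have h2 := bIdx_lt (q.pair x)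
      split_ifs <;> omega
    · have := q.noncrossing x y
      omega

theorem tensor_single (p : Diagram m n) (q : Diagram m' n') :
    tensor (single p) (single q) = (single (tenD p q) : Hom K _ _) := by
  funext c
  have h : c.pair = tensorPair p q ↔ c = tenD p q :=
    ⟨fun h => Diagram.ext_pair fun x => by rw [h]; rfl, fun h => by rw [h]; rfl⟩
  rw [tensor, Finset.sum_eq_single p, Finset.sum_eq_single q]
  · simp [single, tensorD, h]
  · intro q' _ hq
    simp [single, hq]
  · simp
  · intro p' _ hp
    simp [single, hp]
  · simp

theorem exists_append {α : Type} (s : Fin (m + m') → α) :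
    ∃ (u : Fin m → α) (v : Fin m' → α), s = Fin.append u v :=
  ⟨_, _, ((Fin.appendEquiv m m').apply_symm_apply s).symm⟩

theorem sum_append {α M : Type} [Fintype α] [AddCommMonoid M] (F : (Fin (m + m') → α) → M) :
    ∑ s, F s = ∑ u, ∑ v, F (Fin.append u v) := by
  rw [← (Fin.appendEquiv m m').sum_comp, Fintype.sum_prod_type]
  rfl

theorem elim_tEquiv_symm (s : Fin m → Bool) (s' : Fin m' → Bool) (t : Fin n → Bool)
    (t' : Fin n' → Bool) (x : (Fin m ⊕ Fin n) ⊕ (Fin m' ⊕ Fin n')) :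
    Sum.elim (Fin.append s s') (Fin.append t t') ((tEquiv m n m' n').symm x) =
      Sum.elim (Sum.elim s t) (Sum.elim s' t') x := by
  rcases x with (x | x) | (x | x) <;> simp [tEquiv, Equiv.sumSumSumComm]

theorem respects_tenD (p : Diagram m n) (q : Diagram m' n') (s : Fin m → Bool)
    (s' : Fin m' → Bool) (t : Fin n → Bool) (t' : Fin n' → Bool) :
    Respects (tenD p q) (Fin.append s s') (Fin.append t t') ↔ Respects p s t ∧ Respects q s' t' := by
  have h : ∀ x, (tenD p q).pair ((tEquiv m n m' n').symm x) =
      (tEquiv m n m' n').symm (Sum.map p.pair q.pair x) := fun x => by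
    simp [tenD, tensorPair]
  rw [Respects, ← (tEquiv m n m' n').symm.forall_congr_right]
  simp only [h, elim_tEquiv_symm, Sum.forall, Sum.map_inl, Sum.map_inr, Sum.elim_inl, Sum.elim_inr,
    Respects]

theorem colorCount_tenD (p : Diagram m n) (q : Diagram m' n') (s : Fin m → Bool)
    (s' : Fin m' → Bool) (t : Fin n → Bool) (t' : Fin n' → Bool) :
    colorCount (tenD p q) (Fin.append s s') (Fin.append t t') =
      colorCount p s t * colorCount q s' t' := by
  simp only [colorCount, respects_tenD, ite_and, mul_ite, mul_one, mul_zero]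
  split_ifs <;> rfl

theorem IsComp.tenD {l l' : ℕ} {b : Diagram m n} {a : Diagram l m} {c : Diagram l n}
    {b' : Diagram m' n'} {a' : Diagram l' m'} {c' : Diagram l' n'} {k k' : ℕ}
    (h : IsComp b a k c) (h' : IsComp b' a' k' c') :
    IsComp (tenD b b') (tenD a a') (k + k') (tenD c c') := by
  intro s u
  obtain ⟨s, s', rfl⟩ := exists_append s
  obtain ⟨u, u', rfl⟩ := exists_append u
  rw [sum_append]
  simp only [colorCount_tenD]
  rw [pow_add, mul_mul_mul_comm, ← h, ← h', Finset.sum_mul_sum]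
  exact Finset.sum_congr rfl fun t _ => Finset.sum_congr rfl fun t' _ => mul_mul_mul_comm _ _ _ _

theorem comp_tensor (d : K) {l l' : ℕ} (b : Hom K m n) (a : Hom K l m) (b' : Hom K m' n')
    (a' : Hom K l' m') :
    comp d (tensor b b') (tensor a a') = tensor (comp d b a) (comp d b' a') := by
  induction b using hom_induction with
  | hs b =>
    induction a using hom_induction with
    | hs a =>
      induction b' using hom_induction with
      | hs b' =>
        induction a' using hom_induction with
        | hs a' =>
          rw [tensor_single, tensor_single, ((isComp_cmpD b a).tenD (isComp_cmpD b' a')).comp_eq,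
            comp_single, comp_single, smul_tensor, tensor_smul, tensor_single, smul_smul, pow_add]
        | h0 => simp only [comp_zero, tensor_zero]
        | ha x y hx hy => simp only [comp_add, tensor_add, hx, hy]
        | hm k x hx => simp only [comp_smul, tensor_smul, hx]
      | h0 => simp only [zero_comp, tensor_zero]
      | ha x y hx hy => simp only [add_comp, tensor_add, hx, hy]
      | hm k x hx => simp only [smul_comp, tensor_smul, hx]
    | h0 => simp only [comp_zero, zero_tensor]
    | ha x y hx hy => simp only [comp_add, add_tensor, hx, hy]
    | hm k x hx => simp only [comp_smul, smul_tensor, hx]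
  | h0 => simp only [zero_comp, zero_tensor]
  | ha x y hx hy => simp only [add_comp, add_tensor, hx, hy]
  | hm k x hx => simp only [smul_comp, smul_tensor, hx]

theorem tenD_idD (m n : ℕ) : tenD (idD m) (idD n) = idD (m + n) :=
  Diagram.ext_respects fun s t => by
    obtain ⟨s, s', rfl⟩ := exists_append s
    obtain ⟨t, t', rfl⟩ := exists_append t
    simp only [respects_tenD, respects_idD]
    rintro ⟨rfl, rfl⟩
    rfl

theorem tensor_idHom (m n : ℕ) : tensor (idHom K m) (idHom K n) = idHom K (m + n) :=
  (tensor_single _ _).trans (by rw [tenD_idD]; rfl)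

theorem tensor_eq_comp (d : K) (x : Hom K m n) (y : Hom K m' n') :
    tensor x y = comp d (tensor (idHom K n) y) (tensor x (idHom K m')) := by
  rw [comp_tensor, id_comp, comp_id]

end Tensor

/-! ### The Markov trace and partial traces -/

section Trace

variable (d : K)

theorem Tr_add {n : ℕ} (x y : Hom K n n) : Tr d (x + y) = Tr d x + Tr d y := by
  simp only [Tr, Pi.add_apply, add_mul, Finset.sum_add_distrib]

theorem Tr_smul {n : ℕ} (k : K) (x : Hom K n n) : Tr d (k • x) = k * Tr d x := by
  simp only [Tr, Pi.smul_apply, smul_eq_mul, Finset.mul_sum, mul_assoc]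

theorem Tr_zero {n : ℕ} : Tr d (0 : Hom K n n) = 0 := by
  simp [Tr]

theorem Tr_single {n : ℕ} (p : Diagram n n) : Tr d (single p) = d ^ trLoops p := by
  simp [Tr, single]

theorem Tr_comp_single {m n N : ℕ} (b : Diagram n m) (a : Diagram m n)
    (h : ∑ s, ∑ t, colorCount a s t * colorCount b t s = 2 ^ N) :
    Tr d (comp d (single b) (single a)) = d ^ N := by
  rw [comp_single, Tr_smul, Tr_single, ← pow_add]
  congr 1
  apply Nat.pow_right_injective le_rfl
  simp only
  rw [← h, pow_add, ← sum_colorCount_diag, Finset.mul_sum]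
  exact Finset.sum_congr rfl fun s _ => (isComp_cmpD b a s s).symm

theorem exists_sum_colorCount {m n : ℕ} (b : Diagram n m) (a : Diagram m n) :
    ∃ N, ∑ s, ∑ t, colorCount a s t * colorCount b t s = 2 ^ N := by
  refine ⟨numLoops a b + trLoops (cmpD b a), ?_⟩
  rw [pow_add, ← sum_colorCount_diag, Finset.mul_sum]
  exact Finset.sum_congr rfl fun s _ => isComp_cmpD b a s s

theorem Tr_comp_comm {m n : ℕ} (b : Hom K n m) (a : Hom K m n) :
    Tr d (comp d b a) = Tr d (comp d a b) := by
  induction b using hom_induction with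
  | hs b =>
    induction a using hom_induction with
    | hs a =>
      obtain ⟨N, hN⟩ := exists_sum_colorCount b a
      rw [Tr_comp_single d b a hN, Tr_comp_single d a b (N := N)]
      rw [← hN, Finset.sum_comm]
      simp only [mul_comm]
    | h0 => simp only [comp_zero, zero_comp, Tr_zero]
    | ha x y hx hy => simp only [comp_add, add_comp, Tr_add, hx, hy]
    | hm k x hx => simp only [comp_smul, smul_comp, Tr_smul, hx]
  | h0 => simp only [comp_zero, zero_comp, Tr_zero]
  | ha x y hx hy => simp only [comp_add, add_comp, Tr_add, hx, hy]
  | hm k x hx => simp only [comp_smul, smul_comp, Tr_smul, hx]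

end Trace

/-- Closing up the points `i, i + 1` on top against `j, j + 1` at the bottom. -/
theorem exists_cupE_capE {m n : ℕ} (X : Diagram (m + 2) (n + 2)) (i : Fin (m + 1))
    (j : Fin (n + 1)) : ∃ k c, (∀ s u, ∑ a, ∑ a', colorCount X (ins i s a a) (ins j u a' a') =
      2 ^ k * colorCount c s u) ∧
      ∀ {K : Type} [Field K] (d : K),
        comp d (single (cupE j)) (comp d (single X) (single (capE i))) = d ^ k • single c := by
  refine ⟨numLoops (capE i) X + numLoops (cmpD X (capE i)) (cupE j),
    cmpD (cupE j) (cmpD X (capE i)), fun s u => ?_, fun d => ?_⟩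
  · rw [pow_add, mul_assoc, ← isComp_cmpD, Finset.mul_sum]
    simp only [← mul_assoc, ← isComp_cmpD X (capE i) s _]
    have h1 : ∀ t, ∑ v, colorCount (capE i) s v * colorCount X v t =
        ∑ a, colorCount X (ins i s a a) t := by
      intro t
      rw [sum_ins i, Finset.sum_eq_single s]
      · refine Finset.sum_congr rfl fun a _ => ?_
        rw [Finset.sum_eq_single a]
        · simp [colorCount, respects_capE, ins_castSucc, ins_succ, ins_comp_skip]
        · intro b _ hb
          simp [colorCount, respects_capE, ins_castSucc, ins_succ, hb.symm]
        · simp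
      · intro r _ hr
        simp [colorCount, respects_capE, ins_comp_skip, hr]
      · simp
    simp only [h1]
    conv_lhs => rw [Finset.sum_comm]
    rw [sum_ins j, Finset.sum_eq_single u]
    · refine Finset.sum_congr rfl fun a' _ => ?_
      symm
      rw [Finset.sum_eq_single a']
      · simp [colorCount, respects_cupE, ins_castSucc, ins_succ, ins_comp_skip]
      · intro b _ hb
        simp [colorCount, respects_cupE, ins_castSucc, ins_succ, hb.symm]
      · simp
    · intro r _ hr
      simp [colorCount, respects_cupE, ins_comp_skip, hr]
    · simp
  · rw [comp_single, comp_smul, comp_single, smul_smul, pow_add]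

theorem sum_fin_one {M : Type} [AddCommMonoid M] (F : (Fin 1 → Bool) → M) :
    ∑ v, F v = ∑ a, F fun _ => a :=
  Fintype.sum_equiv (Equiv.funUnique (Fin 1) Bool) _ _ fun v => by
    congr 1
    funext x
    rw [Subsingleton.elim x default]
    rfl

/-- `a ⊗ 1`. -/
noncomputable def St {m n : ℕ} (x : Hom K m n) : Hom K (m + 1) (n + 1) := tensor x (idHom K 1)

/-- `p ⊗ 1`. -/
def SD {m n : ℕ} (p : Diagram m n) : Diagram (m + 1) (n + 1) := tenD p (idD 1)

theorem St_single {m n : ℕ} (p : Diagram m n) : St (single p : Hom K m n) = single (SD p) :=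
  tensor_single _ _

theorem colorCount_SD {m n : ℕ} (p : Diagram m n) (s : Fin m → Bool) (t : Fin n → Bool)
    (a b : Bool) : colorCount (SD p) (Fin.append s fun _ => a) (Fin.append t fun _ => b) =
      if a = b then colorCount p s t else 0 := by
  rw [SD, colorCount_tenD]
  by_cases h : a = b
  · simp [colorCount, respects_idD, h]
  · have : (fun _ : Fin 1 => a) ≠ fun _ => b := fun e => h (congrFun e 0)
    simp [colorCount, respects_idD, h, this]

theorem ins_last {m : ℕ} (s : Fin m → Bool) (a b : Bool) :
    ins (Fin.last m) s a b = Fin.append (Fin.append s fun _ : Fin 1 => a) fun _ : Fin 1 => b := by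
  funext x
  rcases skip_cases (Fin.last m) x with rfl | rfl | ⟨j, rfl⟩
  · rw [ins_castSucc]
    exact ((Fin.append_left (Fin.append s fun _ : Fin 1 => a) (fun _ : Fin 1 => b)
      (Fin.last m)).trans (Fin.append_right s (fun _ : Fin 1 => a) (0 : Fin 1))).symm
  · rw [ins_succ]
    exact (Fin.append_right (Fin.append s fun _ : Fin 1 => a) (fun _ : Fin 1 => b)
      (0 : Fin 1)).symm
  · rw [ins_skip, show skip (Fin.last m) j = Fin.castAdd 1 (Fin.castAdd 1 j) from
      Fin.ext (by simp [skip_val]), Fin.append_left, Fin.append_left]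

theorem St_add {m n : ℕ} (x y : Hom K m n) : St (x + y) = St x + St y := add_tensor _ _ _

theorem St_smul {m n : ℕ} (k : K) (x : Hom K m n) : St (k • x) = k • St x := smul_tensor _ _ _

theorem St_zero {m n : ℕ} : St (0 : Hom K m n) = 0 := zero_tensor _

theorem St_sub {m n : ℕ} (x y : Hom K m n) : St (x - y) = St x - St y := by
  rw [eq_sub_iff_add_eq, ← St_add, sub_add_cancel]

theorem St_idHom (n : ℕ) : St (idHom K n) = idHom K (n + 1) := tensor_idHom n 1

theorem comp_St (d : K) {l m n : ℕ} (b : Hom K m n) (a : Hom K l m) :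
    comp d (St b) (St a) = St (comp d b a) := by
  rw [St, St, comp_tensor, id_comp, St]

/-- The cup joining the last two top points. -/
noncomputable def cupL (K : Type) [Field K] (m : ℕ) : Hom K (m + 2) m := single (cupE (Fin.last m))

/-- The cap joining the last two bottom points. -/
noncomputable def capL (K : Type) [Field K] (m : ℕ) : Hom K m (m + 2) := single (capE (Fin.last m))

/-- The right partial trace over one strand. -/
noncomputable def pTr (d : K) {m n : ℕ} (b : Hom K (m + 1) (n + 1)) : Hom K m n :=
  comp d (cupL K n) (comp d (St b) (capL K m))

theorem pTr_add (d : K) {m n : ℕ} (b b' : Hom K (m + 1) (n + 1)) :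
    pTr d (b + b') = pTr d b + pTr d b' := by
  simp only [pTr, St_add, add_comp, comp_add]

theorem pTr_smul (d k : K) {m n : ℕ} (b : Hom K (m + 1) (n + 1)) :
    pTr d (k • b) = k • pTr d b := by
  simp only [pTr, St_smul, smul_comp, comp_smul]

theorem pTr_zero (d : K) {m n : ℕ} : pTr d (0 : Hom K (m + 1) (n + 1)) = 0 := by
  simp only [pTr, St_zero, zero_comp, comp_zero]

theorem pTr_single {m n : ℕ} (b : Diagram (m + 1) (n + 1)) : ∃ k c,
    (∀ s u, ∑ a, colorCount b (Fin.append s fun _ => a) (Fin.append u fun _ => a) =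
      2 ^ k * colorCount c s u) ∧
    ∀ {K : Type} [Field K] (d : K), pTr d (single b) = d ^ k • single c := by
  obtain ⟨k, c, h, h'⟩ := exists_cupE_capE (SD b) (Fin.last m) (Fin.last n)
  refine ⟨k, c, fun s u => ?_, fun d => ?_⟩
  · rw [← h]
    simp only [ins_last, colorCount_SD, Finset.sum_ite_eq, Finset.mem_univ, if_true]
  · rw [← h', ← St_single]
    rfl

theorem Tr_comp_St (d : K) {m n : ℕ} (b : Hom K (n + 1) (m + 1)) (x : Hom K m n) :
    Tr d (comp d b (St x)) = Tr d (comp d (pTr d b) x) := by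
  induction b using hom_induction with
  | hs b =>
    induction x using hom_induction with
    | hs a =>
      obtain ⟨k, c, h, h'⟩ := pTr_single b
      obtain ⟨N, hN⟩ := exists_sum_colorCount c a
      rw [h', smul_comp, Tr_smul, Tr_comp_single d c a hN, ← pow_add, St_single]
      apply Tr_comp_single
      rw [pow_add, ← hN, sum_append, Finset.mul_sum]
      refine Finset.sum_congr rfl fun s _ => ?_
      simp only [sum_append, sum_fin_one, colorCount_SD, Finset.mul_sum]
      rw [Finset.sum_comm]
      refine Finset.sum_congr rfl fun t _ => ?_
      rw [mul_left_comm, ← h, Finset.mul_sum]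
      simp [ite_mul]
    | h0 => simp only [comp_zero, St_zero, Tr_zero]
    | ha x y hx hy => simp only [comp_add, St_add, Tr_add, hx, hy]
    | hm k x hx => simp only [comp_smul, St_smul, Tr_smul, hx]
  | h0 => simp only [pTr_zero, zero_comp, Tr_zero]
  | ha x y hx hy => simp only [pTr_add, add_comp, Tr_add, hx, hy]
  | hm k x hx => simp only [pTr_smul, smul_comp, Tr_smul, hx]

theorem Tr_pTr (d : K) {n : ℕ} (b : Hom K (n + 1) (n + 1)) : Tr d (pTr d b) = Tr d b := by
  have := Tr_comp_St d b (idHom K n)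
  rwa [St_idHom, comp_id, comp_id, eq_comm] at this

/-- Transport of a diagram along equalities of the numbers of points. -/
def castD {m n m' n' : ℕ} (hm : m = m') (hn : n = n') (p : Diagram m n) : Diagram m' n' :=
  hm ▸ hn ▸ p

theorem colorCount_castD {m n m' n' : ℕ} (hm : m = m') (hn : n = n') (p : Diagram m n)
    (s : Fin m' → Bool) (t : Fin n' → Bool) :
    colorCount (castD hm hn p) s t = colorCount p (s ∘ Fin.cast hm) (t ∘ Fin.cast hn) := by
  subst hm hn
  rfl

theorem exists_leftTrace_one {m n : ℕ} (b : Diagram (m + 1) (n + 1)) : ∃ k c,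
    ∀ s u, ∑ a, colorCount b (Fin.cons a s : Fin (m + 1) → Bool) (Fin.cons a u : Fin (n + 1) → Bool) =
      2 ^ k * colorCount c s u := by
  obtain ⟨k, c, h, -⟩ := exists_cupE_capE
    (castD (show 1 + (m + 1) = m + 2 by omega) (show 1 + (n + 1) = n + 2 by omega)
      (tenD (idD 1) b)) 0 0
  have key : ∀ {m : ℕ} (e : 1 + (m + 1) = m + 2) (s : Fin m → Bool) (a a' : Bool),
      ins 0 s a a' ∘ Fin.cast e = Fin.append (fun _ : Fin 1 => a) (Fin.cons a' s) := by
    intro m e s a a'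
    funext x
    refine Fin.addCases (fun x => ?_) (fun x => ?_) x
    · rw [Fin.append_left, Subsingleton.elim x 0]
      exact ins_castSucc 0 s a a'
    · rw [Fin.append_right]
      refine Fin.cases ?_ (fun x => ?_) x
      · exact ins_succ 0 s a a'
      · rw [Fin.cons_succ, ← ins_skip 0 s a a' x]
        refine congrArg (ins 0 s a a') (Fin.ext ?_)
        simp [skip_val]
  have h2 : ∀ a b : Bool, (fun _ : Fin 1 => a) = (fun _ => b) ↔ a = b := fun a b =>
    ⟨fun e => congrFun e 0, fun e => by rw [e]⟩
  refine ⟨k, c, fun s u => ?_⟩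
  rw [← h]
  simp only [colorCount_castD, key, colorCount_tenD, fun a b : Bool =>
    show colorCount (idD 1) (fun _ => a) (fun _ => b) = if a = b then 1 else 0 by
      simp only [colorCount, respects_idD, h2]]
  simp

theorem exists_leftTrace {m n k : ℕ} (b : Diagram (k + m) (k + n)) : ∃ r c,
    ∀ s u, ∑ v, colorCount b (Fin.append v s) (Fin.append v u) = 2 ^ r * colorCount c s u := by
  induction k with
  | zero =>
    refine ⟨0, castD (by omega) (by omega) b, fun s u => ?_⟩
    rw [Fintype.sum_unique, colorCount_castD, pow_zero, one_mul]
    rw [Fin.append_left_nil _ _ rfl, Fin.append_left_nil _ _ rfl]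
  | succ k ih =>
    obtain ⟨r, c, h⟩ := exists_leftTrace_one
      (castD (show k + 1 + m = k + m + 1 by omega) (show k + 1 + n = k + n + 1 by omega) b)
    obtain ⟨r', c', h'⟩ := ih c
    refine ⟨r + r', c', fun s u => ?_⟩
    rw [pow_add, mul_assoc, ← h', Finset.mul_sum]
    simp only [← h, colorCount_castD]
    rw [← (Fin.consEquiv fun _ : Fin (k + 1) => Bool).sum_comp, Fintype.sum_prod_type,
      Finset.sum_comm]
    refine Finset.sum_congr rfl fun v _ => Finset.sum_congr rfl fun a _ => ?_
    simp [Fin.consEquiv, Fin.append_cons]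

theorem exists_Tr_comp_tensor (d : K) {m n k : ℕ} (b : Hom K (k + n) (k + m)) :
    ∃ y : Hom K n m, ∀ x : Hom K m n,
      Tr d (comp d b (tensor (idHom K k) x)) = Tr d (comp d y x) := by
  induction b using hom_induction with
  | hs b =>
    obtain ⟨r, c, h⟩ := exists_leftTrace b
    refine ⟨d ^ r • single c, fun x => ?_⟩
    induction x using hom_induction with
    | hs a =>
      obtain ⟨N, hN⟩ := exists_sum_colorCount c a
      rw [smul_comp, Tr_smul, Tr_comp_single d c a hN, ← pow_add,
        show tensor (idHom K k) (single a) = single (tenD (idD k) a) from tensor_single _ _]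
      apply Tr_comp_single
      rw [pow_add, ← hN, sum_append, Finset.sum_comm, Finset.mul_sum]
      refine Finset.sum_congr rfl fun s _ => ?_
      simp only [sum_append, colorCount_tenD, Finset.mul_sum]
      calc _ = ∑ v, ∑ t, colorCount a s t * colorCount b (Fin.append v t) (Fin.append v s) := by
            refine Finset.sum_congr rfl fun v _ => ?_
            rw [Finset.sum_eq_single v]
            · simp [colorCount, respects_idD]
            · intro w _ hw
              simp [colorCount, respects_idD, hw.symm]
            · simp
        _ = _ := by
            rw [Finset.sum_comm]
            refine Finset.sum_congr rfl fun t _ => ?_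
            rw [← Finset.mul_sum, h, mul_left_comm]
    | h0 => simp only [comp_zero, tensor_zero, Tr_zero]
    | ha x y hx hy => simp only [comp_add, tensor_add, Tr_add, hx, hy]
    | hm k x hx => simp only [comp_smul, tensor_smul, Tr_smul, hx]
  | h0 => exact ⟨0, fun x => by simp only [zero_comp, Tr_zero]⟩
  | ha x y hx hy =>
    obtain ⟨x', hx⟩ := hx
    obtain ⟨y', hy⟩ := hy
    exact ⟨x' + y', fun z => by simp only [add_comp, Tr_add, hx, hy]⟩
  | hm c x hx =>
    obtain ⟨x', hx⟩ := hx
    exact ⟨c • x', fun z => by simp only [smul_comp, Tr_smul, hx]⟩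

theorem tensor_idHom_succ {m n : ℕ} (x : Hom K m n) (k : ℕ) :
    tensor x (idHom K (k + 1)) = St (tensor x (idHom K k)) := by
  induction x using hom_induction with
  | hs p =>
    rw [show tensor (single p) (idHom K k) = single (tenD p (idD k)) from tensor_single _ _,
      St_single, show tensor (single p) (idHom K (k + 1)) = single (tenD p (idD (k + 1))) from
      tensor_single _ _]
    congr 1
    refine Diagram.ext_respects fun s t => ?_
    have key : ∀ {m : ℕ} (s : Fin (m + (k + 1)) → Bool), ∃ (s₁ : Fin m → Bool)
        (s₂ : Fin k → Bool) (s₃ : Fin 1 → Bool),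
        s = Fin.append s₁ (Fin.append s₂ s₃) ∧ s = Fin.append (Fin.append s₁ s₂) s₃ := by
      intro m s
      obtain ⟨s₁, s', rfl⟩ := exists_append s
      obtain ⟨s₂, s₃, rfl⟩ := exists_append s'
      refine ⟨s₁, s₂, s₃, rfl, ?_⟩
      rw [Fin.append_assoc]
      rfl
    obtain ⟨s₁, s₂, s₃, h1, h2⟩ := key s
    obtain ⟨t₁, t₂, t₃, h3, h4⟩ := key t
    intro h
    rw [h1, h3, respects_tenD, ← tenD_idD, respects_tenD] at h
    rw [h2, h4, SD, respects_tenD, respects_tenD]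
    exact ⟨⟨h.1, h.2.1⟩, h.2.2⟩
  | h0 => simp only [zero_tensor, St_zero]
  | ha x y hx hy => simp only [add_tensor, St_add, hx, hy]
  | hm c x hx => simp only [smul_tensor, St_smul, hx]

theorem tensor_idHom_zero {m n : ℕ} (x : Hom K m n) : tensor x (idHom K 0) = x := by
  induction x using hom_induction with
  | hs p =>
    rw [show tensor (single p) (idHom K 0) = single (tenD p (idD 0)) from tensor_single _ _]
    congr 1
    refine Diagram.ext_respects fun s t h => ?_
    have key : ∀ {m : ℕ} (s : Fin m → Bool), s = Fin.append s (Fin.elim0 : Fin 0 → Bool) := by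
      intro m s
      rw [Fin.append_elim0]
      rfl
    rw [key s, key t, respects_tenD] at h
    exact h.1
  | h0 => simp only [zero_tensor]
  | ha x y hx hy => simp only [add_tensor, hx, hy]
  | hm c x hx => simp only [smul_tensor, hx]

/-! ### Negligible morphisms -/

theorem negl_St (d : K) {m n : ℕ} {x : Hom K m n} (hx : x ∈ Negl d m n) :
    St x ∈ Negl d (m + 1) (n + 1) := fun b => by
  rw [Tr_comp_St]
  exact hx _

theorem isIdeal_negl (d : K) : IsIdeal d (Negl d) := by
  have hcl : ∀ {l m n : ℕ} (b : Hom K m n) (a : Hom K l m), a ∈ Negl d l m →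
      comp d b a ∈ Negl d l n := fun b a ha c => by
    rw [← comp_assoc]
    exact ha _
  have hcr : ∀ {l m n : ℕ} (b : Hom K m n) (a : Hom K l m), b ∈ Negl d m n →
      comp d b a ∈ Negl d l n := fun b a hb c => by
    rw [Tr_comp_comm, comp_assoc, Tr_comp_comm]
    exact hb _
  refine ⟨fun m n b => ?_, fun m n x hx y hy b => ?_, fun m n c x hx b => ?_, hcl, hcr, ?_, ?_⟩
  · rw [comp_zero, Tr_zero]
  · rw [comp_add, Tr_add, hx, hy, add_zero]
  · rw [comp_smul, Tr_smul, hx, mul_zero]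
  · intro m n m' n' x y hx
    rw [tensor_eq_comp d]
    refine hcl _ _ ?_
    clear y
    induction m' with
    | zero => rwa [tensor_idHom_zero]
    | succ k ih =>
      rw [tensor_idHom_succ]
      exact negl_St d ih
  · intro m n m' n' x y hy
    rw [tensor_eq_comp d]
    refine hcr _ _ fun b => ?_
    obtain ⟨z, hz⟩ := exists_Tr_comp_tensor d b
    rw [hz]
    exact hy _

theorem IsIdeal.St_mem {d : K} {J : ∀ m n : ℕ, Set (Hom K m n)} (hJ : IsIdeal d J) {m n : ℕ}
    {x : Hom K m n} (hx : x ∈ J m n) : St x ∈ J (m + 1) (n + 1) := hJ.tensor_mem_left _ _ hx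

theorem hom_zero_eq (x : Hom K 0 0) : x = x (idD 0) • idHom K 0 := by
  have h : ∀ c : Diagram 0 0, c = idD 0 := fun c => Diagram.ext_pair fun x => x.elim
    (fun i => i.elim0) fun i => i.elim0
  funext c
  rw [h c]
  simp [idHom]

theorem IsIdeal.eq_univ {d : K} {J : ∀ m n : ℕ, Set (Hom K m n)} (hJ : IsIdeal d J) {m : ℕ}
    {x : Hom K m m} (hx : x ∈ J m m) (hT : Tr d x ≠ 0) (k l : ℕ) : J k l = Set.univ := by
  induction m with
  | zero =>
    have h0 : idHom K 0 ∈ J 0 0 := by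
      have hne : x (idD 0) ≠ 0 := fun h => hT (by rw [hom_zero_eq x, h, zero_smul, Tr_zero])
      have h1 := hJ.smul_mem _ _ (x (idD 0))⁻¹ _ hx
      rw [hom_zero_eq x] at h1
      simpa [smul_smul, idHom, hne] using h1
    have hk : idHom K k ∈ J k k := by
      induction k with
      | zero => exact h0
      | succ k ih => rw [← St_idHom]; exact hJ.St_mem ih
    refine Set.eq_univ_of_forall fun y => ?_
    rw [← comp_id d y]
    exact hJ.comp_mem_left _ _ hk
  | succ m ih =>
    refine ih (x := pTr d x) ?_ (by rwa [Tr_pTr])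
    exact hJ.comp_mem_left _ _ (hJ.comp_mem_right _ _ (hJ.St_mem hx))

theorem IsIdeal.subset_negl {d : K} {J : ∀ m n : ℕ, Set (Hom K m n)} (hJ : IsIdeal d J)
    (hp : IdealProper J) (m n : ℕ) : J m n ⊆ Negl d m n := fun x hx b => by
  by_contra h
  obtain ⟨k, l, hkl⟩ := hp
  exact hkl (hJ.eq_univ (hJ.comp_mem_left b x hx) h k l)

theorem trLoops_idD_zero : trLoops (idD 0) = 0 := by
  have h := sum_colorCount_diag (idD 0)
  simp [colorCount, respects_idD] at h
  exact Nat.pow_right_injective le_rfl (h.symm.trans (pow_zero 2).symm)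

theorem negl_proper (d : K) : IdealProper (Negl d) := by
  refine ⟨0, 0, fun h => ?_⟩
  have h1 : idHom K 0 ∈ Negl d 0 0 := h ▸ Set.mem_univ _
  have h2 := h1 (idHom K 0)
  rw [comp_id, show idHom K 0 = single (idD 0) from rfl, Tr_single, trLoops_idD_zero] at h2
  simp at h2

/-! ### Relations between cups and caps -/

theorem isComp_of_unique {l m n : ℕ} {p : Diagram m n} {q : Diagram l m} {c : Diagram l n}
    (f : (Fin l → Bool) → (Fin n → Bool) → (Fin m → Bool))
    (h1 : ∀ s t u, Respects q s t → Respects p t u → Respects c s u ∧ t = f s u)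
    (h2 : ∀ s u, Respects c s u → Respects q s (f s u) ∧ Respects p (f s u) u) :
    IsComp p q 0 c := by
  intro s u
  by_cases hc : Respects c s u
  · rw [Finset.sum_eq_single (f s u)]
    · simp [colorCount, hc, h2 s u hc]
    · intro t _ ht
      by_cases hq : Respects q s t
      · by_cases hp : Respects p t u
        · exact absurd (h1 s t u hq hp).2 ht
        · simp [colorCount, hp]
      · simp [colorCount, hq]
    · simp
  · rw [Finset.sum_eq_zero]
    · simp [colorCount, hc]
    · intro t _
      by_cases hq : Respects q s t
      · by_cases hp : Respects p t u
        · exact absurd (h1 s t u hq hp).1 hc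
        · simp [colorCount, hp]
      · simp [colorCount, hq]

/-- Extension of a colouring by one point on the right. -/
def app1 {m : ℕ} (s : Fin m → Bool) (a : Bool) : Fin (m + 1) → Bool := Fin.snoc s a

theorem exists_app1 {m : ℕ} (s : Fin (m + 1) → Bool) : ∃ r a, s = app1 r a :=
  ⟨Fin.init s, s (Fin.last m), (Fin.snoc_init_self s).symm⟩

theorem app1_inj {m : ℕ} {s t : Fin m → Bool} {a b : Bool} :
    app1 s a = app1 t b ↔ s = t ∧ a = b := Fin.snoc_inj

theorem app1_eq_append {m : ℕ} (s : Fin m → Bool) (a : Bool) :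
    app1 s a = Fin.append s (fun _ : Fin 1 => a) :=
  (Fin.append_right_eq_snoc s (fun _ : Fin 1 => a)).symm

theorem respects_SD {m n : ℕ} (p : Diagram m n) (s : Fin m → Bool) (t : Fin n → Bool)
    (a b : Bool) : Respects (SD p) (app1 s a) (app1 t b) ↔ Respects p s t ∧ a = b := by
  have h : (fun _ : Fin 1 => a) = (fun _ => b) ↔ a = b :=
    ⟨fun e => congrFun e 0, fun e => by rw [e]⟩
  rw [SD, app1_eq_append, app1_eq_append, respects_tenD, respects_idD, h]

theorem ins_last_app1 {m : ℕ} (s : Fin m → Bool) (a b : Bool) :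
    ins (Fin.last m) s a b = app1 (app1 s a) b := by
  rw [ins_last, app1_eq_append, app1_eq_append]

theorem respects_capL {m : ℕ} (s t : Fin m → Bool) (a b : Bool) :
    Respects (capE (Fin.last m)) s (app1 (app1 t a) b) ↔ a = b ∧ t = s := by
  rw [respects_capE, ← ins_last_app1, ins_castSucc, ins_succ, ins_comp_skip]

theorem respects_cupL {m : ℕ} (s t : Fin m → Bool) (a b : Bool) :
    Respects (cupE (Fin.last m)) (app1 (app1 t a) b) s ↔ a = b ∧ t = s := by
  rw [cupE, respects_flip, respects_capL]

theorem flip_SD {m n : ℕ} (p : Diagram m n) : flip (SD p) = SD (flip p) :=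
  Diagram.ext_respects fun s t => by
    obtain ⟨s, a, rfl⟩ := exists_app1 s
    obtain ⟨t, b, rfl⟩ := exists_app1 t
    rw [respects_flip, respects_SD, respects_SD, respects_flip, eq_comm (a := a)]
    exact id

theorem isComp_cup_cap (m : ℕ) : IsComp (cupE (Fin.last m)) (capE (Fin.last m)) 1 (idD m) := by
  intro s u
  rw [sum_ins (Fin.last m)]
  simp only [ins_last_app1, colorCount, respects_capL, respects_cupL, respects_idD]
  rw [Finset.sum_eq_single s]
  · by_cases h : s = u <;> simp [h]
  · intro r _ hr
    simp [hr]
  · simp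

theorem isComp_SD_cup_cap (m : ℕ) :
    IsComp (SD (cupE (Fin.last m))) (capE (Fin.last (m + 1))) 0 (idD (m + 1)) := by
  refine isComp_of_unique (fun s u => app1 (app1 s (s (Fin.last m))) (s (Fin.last m))) ?_ ?_
  · intro s t u h1 h2
    obtain ⟨s, a, rfl⟩ := exists_app1 s
    obtain ⟨u, b, rfl⟩ := exists_app1 u
    obtain ⟨t, t1, rfl⟩ := exists_app1 t
    obtain ⟨t, t2, rfl⟩ := exists_app1 t
    obtain ⟨t, t3, rfl⟩ := exists_app1 t
    rw [respects_capL, app1_inj] at h1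
    rw [respects_SD, respects_cupL] at h2
    obtain ⟨rfl, rfl, rfl⟩ := h1
    obtain ⟨⟨rfl, rfl⟩, rfl⟩ := h2
    rw [respects_idD]
    simp [app1]
  · intro s u h
    rw [respects_idD] at h
    subst h
    obtain ⟨s, a, rfl⟩ := exists_app1 s
    simp only [respects_capL, respects_SD, respects_cupL, show app1 s a (Fin.last m) = a from
      Fin.snoc_last _ _, and_self]

theorem isComp_cup_SD_cap (m : ℕ) :
    IsComp (cupE (Fin.last (m + 1))) (SD (capE (Fin.last m))) 0 (idD (m + 1)) := by
  have := (isComp_SD_cup_cap m).flip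
  rwa [flip_SD, flip_cupE, flip_idD] at this

theorem isComp_SD_SD_cap {m n : ℕ} (p : Diagram m n) :
    IsComp (SD (SD p)) (capE (Fin.last m)) 0 (insertBot p (Fin.last n)) := by
  refine isComp_of_unique (fun s u => app1 (app1 s (u (Fin.last (n + 1)))) (u (Fin.last (n + 1))))
    ?_ ?_
  · intro s t u h1 h2
    obtain ⟨u, b, rfl⟩ := exists_app1 u
    obtain ⟨u, c, rfl⟩ := exists_app1 u
    obtain ⟨t, t1, rfl⟩ := exists_app1 t
    obtain ⟨t, t2, rfl⟩ := exists_app1 t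
    rw [respects_capL] at h1
    rw [respects_SD, respects_SD] at h2
    obtain ⟨rfl, rfl⟩ := h1
    obtain ⟨⟨h, rfl⟩, rfl⟩ := h2
    rw [respects_insertBot, ← ins_last_app1, ins_castSucc, ins_succ, ins_comp_skip]
    exact ⟨⟨rfl, h⟩, by simp [ins_last_app1, app1]⟩
  · intro s u h
    obtain ⟨u, b, rfl⟩ := exists_app1 u
    obtain ⟨u, c, rfl⟩ := exists_app1 u
    rw [respects_insertBot, ← ins_last_app1, ins_castSucc, ins_succ, ins_comp_skip] at h
    obtain ⟨rfl, h⟩ := h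
    simp only [respects_capL, respects_SD, show ∀ s a, app1 s a (Fin.last (n + 1)) = a from
      fun _ _ => Fin.snoc_last _ _, and_self, h]

theorem SD_cupE {m : ℕ} (i : Fin (m + 1)) : SD (cupE i) = cupE i.castSucc :=
  Diagram.ext_respects fun s t => by
    obtain ⟨s, a, rfl⟩ := exists_app1 s
    obtain ⟨t, b, rfl⟩ := exists_app1 t
    rw [respects_SD, respects_cupE, respects_cupE]
    rintro ⟨⟨h1, rfl⟩, rfl⟩
    have e : ∀ j, app1 s a (Fin.castSucc j) = s j := fun j => Fin.snoc_castSucc (α := fun _ => Bool) _ _ _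
    refine ⟨(e _).trans (h1.trans (e _).symm), funext fun j => ?_⟩
    refine Fin.lastCases ?_ (fun j => ?_) j
    · rw [Function.comp_apply, show skip i.castSucc (Fin.last m) = Fin.last (m + 2) from
        Fin.ext (by have := i.isLt; simp [skip_val]; omega)]
      exact (Fin.snoc_last (α := fun _ => Bool) _ _).trans (Fin.snoc_last (α := fun _ => Bool) _ _).symm
    · rw [Function.comp_apply, show skip i.castSucc j.castSucc = (skip i j).castSucc from
        Fin.ext (by simp [skip_val]), e]
      exact (Fin.snoc_castSucc (α := fun _ => Bool) a (s ∘ skip i) j).symm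

theorem SD_capE {m : ℕ} (i : Fin (m + 1)) : SD (capE i) = capE i.castSucc := by
  rw [← flip_cupE, ← flip_SD, SD_cupE, flip_cupE]

section Relations

variable (d : K)

/-- The cup joining the top points `i`, `i + 1`. -/
noncomputable def cupAt (K : Type) [Field K] {m : ℕ} (i : Fin (m + 1)) : Hom K (m + 2) m :=
  single (cupE i)

/-- The cap joining the bottom points `i`, `i + 1`. -/
noncomputable def capAt (K : Type) [Field K] {m : ℕ} (i : Fin (m + 1)) : Hom K m (m + 2) :=
  single (capE i)

theorem St_cupAt {m : ℕ} (i : Fin (m + 1)) : St (cupAt K i) = cupAt K i.castSucc := by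
  rw [cupAt, St_single, SD_cupE, cupAt]

theorem St_capAt {m : ℕ} (i : Fin (m + 1)) : St (capAt K i) = capAt K i.castSucc := by
  rw [capAt, St_single, SD_capE, capAt]

theorem cup_cap (m : ℕ) : comp d (cupL K m) (capL K m) = d • idHom K m :=
  ((isComp_cup_cap m).comp_eq d).trans (by rw [pow_one]; rfl)

theorem St_cup_cap (m : ℕ) : comp d (St (cupL K m)) (capL K (m + 1)) = idHom K (m + 1) := by
  rw [cupL, St_single]
  exact ((isComp_SD_cup_cap m).comp_eq d).trans (by rw [pow_zero, one_smul]; rfl)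

theorem cup_St_cap (m : ℕ) : comp d (cupL K (m + 1)) (St (capL K m)) = idHom K (m + 1) := by
  rw [capL, St_single]
  exact ((isComp_cup_SD_cap m).comp_eq d).trans (by rw [pow_zero, one_smul]; rfl)

theorem St_St_cap {m n : ℕ} (a : Hom K m n) :
    comp d (St (St a)) (capL K m) = comp d (capL K n) a := by
  induction a using hom_induction with
  | hs p =>
    rw [St_single, St_single, capL, capL, (isComp_SD_SD_cap p).comp_eq, (isComp_capE p _).comp_eq]
  | h0 => simp only [St_zero, zero_comp, comp_zero]
  | ha x y hx hy => simp only [St_add, add_comp, comp_add, hx, hy]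
  | hm k x hx => simp only [St_smul, smul_comp, comp_smul, hx]

theorem cup_St_St {m n : ℕ} (a : Hom K m n) :
    comp d (cupL K n) (St (St a)) = comp d a (cupL K m) := by
  induction a using hom_induction with
  | hs p =>
    have h1 := (isComp_SD_SD_cap (flip p)).flip
    have h2 := (isComp_capE (flip p) (Fin.last m)).flip
    rw [flip_SD, flip_SD, flip_flip] at h1
    rw [flip_flip] at h2
    rw [St_single, St_single, cupL, cupL]
    exact (h1.comp_eq d).trans (h2.comp_eq d).symm
  | h0 => simp only [St_zero, zero_comp, comp_zero]
  | ha x y hx hy => simp only [St_add, add_comp, comp_add, hx, hy]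
  | hm k x hx => simp only [St_smul, smul_comp, comp_smul, hx]

end Relations

/-! ### Jones–Wenzl projections -/

section Killed

variable (d : K)

/-- Every morphism to fewer strands annihilates `x` from the left. -/
def KilledBelow {l m : ℕ} (x : Hom K l m) : Prop :=
  ∀ n, n < m → ∀ y : Hom K m n, comp d y x = 0

/-- Every morphism from fewer strands annihilates `x` from the right. -/
def KilledAbove {m n : ℕ} (x : Hom K m n) : Prop :=
  ∀ l, l < m → ∀ y : Hom K l m, comp d x y = 0

variable {d}

theorem killedBelow_of_cupAt {l m : ℕ} {x : Hom K l (m + 2)}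
    (hx : ∀ i : Fin (m + 1), comp d (cupAt K i) x = 0) : KilledBelow d x := by
  intro n hn y
  induction y using hom_induction with
  | hs p =>
    obtain ⟨m', e, i, p', hc⟩ := exists_top_adj p fun h => absurd h.le (by omega)
    obtain rfl : m = m' := by omega
    have hc' : IsComp p' (cupE i) 0 p := hc
    have := hc'.comp_eq d
    rw [pow_zero, one_smul] at this
    rw [← this, comp_assoc, show (single (cupE i) : Hom K (m + 2) m) = cupAt K i from rfl, hx,
      comp_zero]
  | h0 => rw [zero_comp]
  | ha y z hy hz => rw [add_comp, hy, hz, add_zero]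
  | hm k y hy => rw [smul_comp, hy, smul_zero]

theorem killedAbove_of_capAt {m n : ℕ} {x : Hom K (m + 2) n}
    (hx : ∀ i : Fin (m + 1), comp d x (capAt K i) = 0) : KilledAbove d x := by
  intro l hl y
  induction y using hom_induction with
  | hs p =>
    obtain ⟨m', e, i, p', hc⟩ := exists_bottom_adj p fun h => absurd h.le (by omega)
    obtain rfl : m = m' := by omega
    have hc' : IsComp (capE i) p' 0 p := hc
    have := hc'.comp_eq d
    rw [pow_zero, one_smul] at this
    rw [← this, ← comp_assoc, show (single (capE i) : Hom K m (m + 2)) = capAt K i from rfl, hx,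
      zero_comp]
  | h0 => rw [comp_zero]
  | ha y z hy hz => rw [comp_add, hy, hz, add_zero]
  | hm k y hy => rw [comp_smul, hy, smul_zero]

theorem single_idD_apply {m : ℕ} (p : Diagram m m) :
    (single p : Hom K m m) (idD m) = if p = idD m then 1 else 0 := by
  simp only [single, eq_comm]

theorem KilledBelow.comp_eq {l m : ℕ} {x : Hom K l m} (hx : KilledBelow d x) (y : Hom K m m) :
    comp d y x = y (idD m) • x := by
  induction y using hom_induction with
  | hs p =>
    rw [single_idD_apply]
    split_ifs with h
    · rw [h, one_smul]; exact id_comp d x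
    · obtain ⟨m', rfl, i, p', hc⟩ := exists_top_adj p fun h' => h h'.eq_idD
      have hc' : IsComp p' (cupE i) 0 p := hc
      have := hc'.comp_eq d
      rw [pow_zero, one_smul] at this
      rw [zero_smul]
      change comp d (single p) x = 0
      rw [← this, comp_assoc, hx _ (by omega), comp_zero]
  | h0 => rw [zero_comp, Pi.zero_apply, zero_smul]
  | ha y z hy hz => rw [add_comp, hy, hz, Pi.add_apply, add_smul]
  | hm k y hy => rw [smul_comp, hy, Pi.smul_apply, smul_assoc]

variable (d)

theorem comp_apply_idD_eq_zero {m n : ℕ} (h : n < m) (a : Hom K n m) (b : Hom K m n) :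
    comp d a b (idD m) = 0 := by
  induction a using hom_induction with
  | hs p =>
    induction b using hom_induction with
    | hs q =>
      obtain ⟨k, c, hc⟩ := exists_isComp p q
      rw [hc.comp_eq, Pi.smul_apply, single_idD_apply, if_neg, smul_zero]
      rintro rfl
      have h1 : ∀ s, ∃ t, Respects q s t ∧ Respects p t s := fun s =>
        hc.exists_respects ((respects_idD s s).2 rfl)
      choose t ht using h1
      have hi : Function.Injective t := fun s s' e =>
        (respects_idD _ _).1 (hc.respects (ht s).1 (e ▸ (ht s').2))
      have := Fintype.card_le_of_injective t hi
      simp at this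
      have := (Nat.pow_le_pow_iff_right (by norm_num : 1 < 2)).1 this
      omega
    | h0 => rw [comp_zero, Pi.zero_apply]
    | ha y z hy hz => rw [comp_add, Pi.add_apply, hy, hz, add_zero]
    | hm k y hy => rw [comp_smul, Pi.smul_apply, hy, smul_zero]
  | h0 => rw [zero_comp, Pi.zero_apply]
  | ha y z hy hz => rw [add_comp, Pi.add_apply, hy, hz, add_zero]
  | hm k y hy => rw [smul_comp, Pi.smul_apply, hy, smul_zero]

theorem SD_injective {m n : ℕ} : Function.Injective (SD : Diagram m n → _) := fun p q h =>
  Diagram.ext_respects fun s t hs => by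
    have h1 := (respects_SD p s t true true).2 ⟨hs, rfl⟩
    rw [h] at h1
    exact ((respects_SD q s t true true).1 h1).1

theorem St_apply_idD {m : ℕ} (x : Hom K m m) : St x (idD (m + 1)) = x (idD m) := by
  induction x using hom_induction with
  | hs p =>
    rw [St_single, single_idD_apply, single_idD_apply]
    have : SD p = idD (m + 1) ↔ p = idD m := by
      rw [← tenD_idD m 1]
      exact SD_injective.eq_iff
    simp only [this]
  | h0 => rw [St_zero]; rfl
  | ha y z hy hz => rw [St_add, Pi.add_apply, hy, hz, Pi.add_apply]
  | hm k y hy => rw [St_smul, Pi.smul_apply, hy, Pi.smul_apply]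

end Killed

section JonesWenzl

variable (d : K)

/-- The Jones–Wenzl projections, by Wenzl's recursion. -/
noncomputable def jw : (n : ℕ) → Hom K n n
  | 0 => idHom K 0
  | 1 => idHom K 1
  | m + 2 => St (jw (m + 1)) - (qInt d (m + 1) / qInt d (m + 2)) •
      comp d (St (jw (m + 1))) (comp d (capL K m) (comp d (cupL K m) (St (jw (m + 1)))))

theorem jw_succ (m : ℕ) : jw d (m + 2) =
    St (jw d (m + 1)) - (qInt d (m + 1) / qInt d (m + 2)) • comp d (St (jw d (m + 1)))
      (comp d (capL K m) (comp d (cupL K m) (St (jw d (m + 1))))) := rfl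

theorem jw_apply_idD : ∀ m, jw d m (idD m) = 1
  | 0 => by simp [jw, idHom]
  | 1 => by simp [jw, idHom]
  | m + 2 => by
    rw [jw_succ, Pi.sub_apply, Pi.smul_apply, ← comp_assoc, comp_apply_idD_eq_zero d (by omega),
      St_apply_idD, jw_apply_idD (m + 1), smul_zero, sub_zero]

/-- The inductive package of identities for consecutive Jones–Wenzl projections. -/
structure WenzlPair (m : ℕ) (ν : K) (f : Hom K m m) (g : Hom K (m + 1) (m + 1)) : Prop where
  idem : comp d g g = g
  comp_St : comp d g (St f) = g
  St_comp : comp d (St f) g = g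
  trace : pTr d g = ν • f
  below : KilledBelow d g
  above : KilledAbove d g

variable {d}

theorem WenzlPair.step {m : ℕ} {μ ν : K} {f : Hom K m m} {g : Hom K (m + 1) (m + 1)}
    (w : WenzlPair d m ν f g) (h : μ * ν = 1) {x : Hom K (m + 2) (m + 2)}
    (hx : x = St g - μ • comp d (St g) (comp d (capL K m) (comp d (cupL K m) (St g)))) :
    WenzlPair d (m + 1) (d - μ) g x := by
  have gg : comp d (St g) (St g) = St g := by rw [TL.comp_St, w.idem]
  have gg' {k : ℕ} (y : Hom K k (m + 2)) : comp d (St g) (comp d (St g) y) = comp d (St g) y := by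
    rw [← comp_assoc, gg]
  have gf : comp d (St g) (St (St f)) = St g := by rw [TL.comp_St, w.comp_St]
  have fg : comp d (St (St f)) (St g) = St g := by rw [TL.comp_St, w.St_comp]
  have tr : comp d (cupL K m) (comp d (St g) (capL K m)) = ν • f := w.trace
  have xg : comp d x (St g) = x := by
    simp only [hx, sub_comp, smul_comp, comp_assoc, gg]
  have gx : comp d (St g) x = x := by
    simp only [hx, comp_sub, comp_smul, gg, gg']
  have cx : comp d (cupL K m) x = 0 := by
    rw [hx, comp_sub, comp_smul, ← comp_assoc d (St g), ← comp_assoc d (cupL K m), tr, smul_comp,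
      smul_smul, h, one_smul, ← comp_assoc, ← cup_St_St, comp_assoc, fg, sub_self]
  have xc : comp d x (capL K m) = 0 := by
    rw [hx, sub_comp, smul_comp, comp_assoc, comp_assoc, comp_assoc, tr, comp_smul,
      comp_smul, smul_smul, h, one_smul, ← St_St_cap, ← comp_assoc, gf, sub_self]
  refine ⟨?_, xg, gx, ?_, killedBelow_of_cupAt fun i => ?_, killedAbove_of_capAt fun i => ?_⟩
  · nth_rewrite 2 [hx]
    rw [comp_sub, comp_smul, ← comp_assoc d x, xg, ← comp_assoc d x, xc, zero_comp, smul_zero,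
      sub_zero]
  · have h1 : comp d (cupL K (m + 1)) (comp d (St (St g)) (capL K (m + 1))) = d • g := by
      rw [St_St_cap, ← comp_assoc, cup_cap, smul_comp, id_comp]
    have h2 : comp d (cupL K (m + 1)) (comp d (St (comp d (St g) (comp d (capL K m)
        (comp d (cupL K m) (St g))))) (capL K (m + 1))) = g := by
      simp only [← TL.comp_St, comp_assoc, St_St_cap]
      rw [← comp_assoc d (cupL K (m + 1)), cup_St_St, comp_assoc, ← comp_assoc d (cupL K (m + 1)),
        cup_St_cap, id_comp, ← comp_assoc d (St (cupL K m)), St_cup_cap, id_comp, w.idem]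
    rw [pTr, hx, St_sub, St_smul, sub_comp, smul_comp, comp_sub, comp_smul, h1, h2, sub_smul]
  · refine Fin.lastCases cx (fun i => ?_) i
    cases m with
    | zero => exact i.elim0
    | succ m =>
      rw [← St_cupAt, ← gx, ← comp_assoc, TL.comp_St, w.below _ (by omega), St_zero, zero_comp]
  · refine Fin.lastCases xc (fun i => ?_) i
    cases m with
    | zero => exact i.elim0
    | succ m =>
      rw [← St_capAt, ← xg, comp_assoc, TL.comp_St, w.above _ (by omega), St_zero, comp_zero]

theorem wenzlPair_jw {m : ℕ} (h : ∀ k, 0 < k → k ≤ m + 1 → qInt d k ≠ 0) :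
    WenzlPair d m (qInt d (m + 2) / qInt d (m + 1)) (jw d m) (jw d (m + 1)) := by
  induction m with
  | zero =>
    have e : qInt d (0 + 2) / qInt d (0 + 1) = d := by simp [qInt]
    rw [e]
    refine ⟨id_comp _ _, ?_, ?_, ?_, ?_, ?_⟩
    · exact (congrArg (comp d (idHom K 1)) (St_idHom (K := K) 0)).trans (comp_id d _)
    · exact (congrArg (fun z => comp d z (idHom K 1)) (St_idHom (K := K) 0)).trans (id_comp d _)
    · change comp d _ (comp d (St (idHom K 1)) _) = _
      rw [St_idHom, id_comp, cup_cap]; rfl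
    · intro n hn y
      have : y = 0 := by
        ext p
        obtain ⟨m', e, -⟩ := exists_top_adj p fun h => absurd h.le (by omega)
        omega
      rw [this, zero_comp]
    · intro n hn y
      have : y = 0 := by
        ext p
        obtain ⟨m', e, -⟩ := exists_bottom_adj p fun h => absurd h.le (by omega)
        omega
      rw [this, comp_zero]
  | succ m ih =>
    have h1 := h (m + 1) (by omega) (by omega)
    have h2 := h (m + 2) (by omega) (by omega)
    have e : qInt d (m + 3) / qInt d (m + 2) = d - qInt d (m + 1) / qInt d (m + 2) := by
      rw [show qInt d (m + 3) = d * qInt d (m + 2) - qInt d (m + 1) from rfl]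
      field_simp
    rw [e]
    exact (ih fun k hk hk' => h k hk (by omega)).step (by field_simp) (jw_succ d m)

theorem jw_killedBelow {m : ℕ} (h : ∀ k, 0 < k → k ≤ m → qInt d k ≠ 0) :
    KilledBelow d (jw d m) := by
  cases m with
  | zero => exact fun n hn => absurd hn (by omega)
  | succ m => exact (wenzlPair_jw h).below

theorem jw_killedAbove {m : ℕ} (h : ∀ k, 0 < k → k ≤ m → qInt d k ≠ 0) :
    KilledAbove d (jw d m) := by
  cases m with
  | zero => exact fun n hn => absurd hn (by omega)
  | succ m => exact (wenzlPair_jw h).above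

theorem Tr_jw {m : ℕ} (h : ∀ k, 0 < k → k ≤ m → qInt d k ≠ 0) :
    Tr d (jw d m) = qInt d (m + 1) := by
  induction m with
  | zero =>
    rw [show jw d 0 = single (idD 0) from rfl, Tr_single, trLoops_idD_zero]
    simp [qInt]
  | succ m ih =>
    have h1 := h (m + 1) (by omega) (by omega)
    rw [← Tr_pTr, (wenzlPair_jw h).trace, Tr_smul, ih fun k hk hk' => h k hk (by omega)]
    field_simp

end JonesWenzl

/-! ### Negligible morphisms and the first negligible Jones–Wenzl projection -/

section Decomposable

variable {d : K} {L : ℕ} {J : ∀ m n : ℕ, Set (Hom K m n)}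

theorem jw_mem_negl (h : ∀ k, 0 < k → k ≤ L → qInt d k ≠ 0) (h0 : qInt d (L + 1) = 0) :
    jw d L ∈ Negl d L L := fun b => by
  rw [(jw_killedBelow h).comp_eq, Tr_smul, Tr_jw h, h0, mul_zero]

theorem jw_ne_zero (d : K) (L : ℕ) : jw d L ≠ 0 := fun h => by
  have := jw_apply_idD d L
  simp [h] at this

/-- Sums of morphisms factoring through some `jw d j`, `j < L`, modulo `J`. -/
inductive Decomposable (d : K) (L : ℕ) (J : ∀ m n : ℕ, Set (Hom K m n)) :
    ∀ {m n : ℕ}, Hom K m n → Prop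
  | mem {m n : ℕ} (x : Hom K m n) : x ∈ J m n → Decomposable d L J x
  | add {m n : ℕ} (x y : Hom K m n) : Decomposable d L J x → Decomposable d L J y →
      Decomposable d L J (x + y)
  | factor {m n : ℕ} (j : ℕ) (a : Hom K j n) (b : Hom K m j) : j < L →
      Decomposable d L J (comp d a (comp d (jw d j) b))

theorem Decomposable.comp_left (hJ : IsIdeal d J) {l m n : ℕ} {x : Hom K l m}
    (hx : Decomposable d L J x) (y : Hom K m n) : Decomposable d L J (comp d y x) := by
  induction hx with
  | mem x hx => exact .mem _ (hJ.comp_mem_left y x hx)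
  | add x z _ _ h1 h2 => rw [comp_add]; exact .add _ _ h1 h2
  | factor j a b hj => rw [← comp_assoc]; exact .factor _ _ _ hj

theorem Decomposable.comp_right (hJ : IsIdeal d J) {l m n : ℕ} {x : Hom K m n}
    (hx : Decomposable d L J x) (y : Hom K l m) : Decomposable d L J (comp d x y) := by
  induction hx with
  | mem x hx => exact .mem _ (hJ.comp_mem_right x y hx)
  | add x z _ _ h1 h2 => rw [add_comp]; exact .add _ _ h1 h2
  | factor j a b hj => rw [comp_assoc, comp_assoc]; exact .factor _ _ _ hj

theorem decomposable_jw (hm : jw d L ∈ J L L) {j : ℕ} (hj : j ≤ L) :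
    Decomposable d L J (jw d j) := by
  rcases hj.eq_or_lt with rfl | hj
  · exact .mem _ hm
  · have := Decomposable.factor (d := d) (J := J) j (idHom K j) (idHom K j) hj
    rwa [id_comp, comp_id] at this

theorem decomposable_St_jw (h : ∀ k, 0 < k → k ≤ L → qInt d k ≠ 0)
    (hm : jw d L ∈ J L L) {j : ℕ} (hj : j < L) : Decomposable d L J (St (jw d j)) := by
  cases j with
  | zero =>
    rw [show St (jw d 0) = jw d 1 from St_idHom 0]
    exact decomposable_jw hm hj
  | succ m =>
    have w := wenzlPair_jw fun k hk hk' => h k hk (hk'.trans hj.le)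
    have e := sub_eq_iff_eq_add.1 (jw_succ d m).symm
    rw [e]
    refine .add _ _ (decomposable_jw hm hj) ?_
    have e2 : comp d (St (jw d (m + 1))) (comp d (capL K m) (jw d m)) =
        comp d (St (jw d (m + 1))) (capL K m) := by
      rw [← St_St_cap, ← comp_assoc, comp_St, w.comp_St]
    rw [← comp_assoc d _ (capL K m), ← e2, ← comp_assoc d _ (capL K m),
      comp_assoc d _ (jw d m), ← smul_comp]
    exact .factor _ _ _ (by omega)

theorem Decomposable.St (h : ∀ k, 0 < k → k ≤ L → qInt d k ≠ 0) (hJ : IsIdeal d J)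
    (hm : jw d L ∈ J L L) {m n : ℕ} {x : Hom K m n} (hx : Decomposable d L J x) :
    Decomposable d L J (St x) := by
  induction hx with
  | mem x hx => exact .mem _ (hJ.St_mem hx)
  | add x z _ _ h1 h2 => rw [St_add]; exact .add _ _ h1 h2
  | factor j a b hj =>
    rw [← comp_St d, ← comp_St d]
    exact ((decomposable_St_jw h hm hj).comp_right hJ _).comp_left hJ _

theorem decomposable_idHom (h : ∀ k, 0 < k → k ≤ L → qInt d k ≠ 0) (hJ : IsIdeal d J)
    (hm : jw d L ∈ J L L) (n : ℕ) : Decomposable d L J (idHom K n) := by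
  induction n with
  | zero => exact decomposable_jw hm (Nat.zero_le _)
  | succ n ih => rw [← St_idHom]; exact ih.St h hJ hm

theorem jw_comp_negl_comp_jw (h : ∀ k, 0 < k → k ≤ L → qInt d k ≠ 0) {i j : ℕ} (hi : i < L)
    (hj : j < L) {w : Hom K i j} (hw : w ∈ Negl d i j) :
    comp d (jw d j) (comp d w (jw d i)) = 0 := by
  rcases lt_trichotomy i j with hij | rfl | hij
  · rw [← comp_assoc, jw_killedAbove (fun k hk hk' => h k hk (hk'.trans hj.le)) _ hij, zero_comp]
  · have hi' : ∀ k, 0 < k → k ≤ i → qInt d k ≠ 0 := fun k hk hk' => h k hk (hk'.trans hi.le)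
    have h1 := hw (jw d i)
    rw [Tr_comp_comm, (jw_killedBelow hi').comp_eq, Tr_smul, Tr_jw hi'] at h1
    rw [(jw_killedBelow hi').comp_eq, (mul_eq_zero.1 h1).resolve_right
      (h _ (Nat.succ_pos i) hi), zero_smul, comp_zero]
  · rw [jw_killedBelow (fun k hk hk' => h k hk (hk'.trans hi.le)) _ hij, comp_zero]

theorem negl_subset (h : ∀ k, 0 < k → k ≤ L → qInt d k ≠ 0) (hJ : IsIdeal d J)
    (hm : jw d L ∈ J L L) (m n : ℕ) : Negl d m n ⊆ J m n := by
  have key : ∀ {n r : ℕ} {y : Hom K n r}, Decomposable d L J y → ∀ {k m : ℕ} {z : Hom K k m},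
      Decomposable d L J z → ∀ x ∈ Negl d m n, comp d y (comp d x z) ∈ J k r := by
    intro n r y hy
    induction hy with
    | mem y hy => exact fun _ x _ => hJ.comp_mem_right _ _ hy
    | add y y' _ _ h1 h2 =>
      intro k m z hz x hx
      rw [add_comp]
      exact hJ.add_mem _ _ _ (h1 hz x hx) _ (h2 hz x hx)
    | factor j a b hj =>
      intro k m z hz x hx
      induction hz with
      | mem z hz => exact hJ.comp_mem_left _ _ (hJ.comp_mem_left _ _ hz)
      | add z z' _ _ h1 h2 =>
        rw [comp_add, comp_add]
        exact hJ.add_mem _ _ _ h1 _ h2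
      | factor i a' b' hi =>
        have h1 := jw_comp_negl_comp_jw h hi hj ((isIdeal_negl d).comp_mem_left b _
          ((isIdeal_negl d).comp_mem_right x a' hx))
        have h2 : comp d (comp d a (comp d (jw d j) b)) (comp d x (comp d a' (comp d (jw d i) b'))) =
            comp d a (comp d (comp d (jw d j) (comp d (comp d b (comp d x a')) (jw d i))) b') := by
          simp only [comp_assoc]
        rw [h2, h1, zero_comp, comp_zero]
        exact hJ.zero_mem _ _
  intro x hx
  have := key (decomposable_idHom h hJ hm n) (decomposable_idHom h hJ hm m) x hx
  rwa [comp_id, id_comp] at this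

end Decomposable

/-! ### Quantum integers at roots of unity -/

theorem qInt_mul {τ : ℂ} (h : τ ≠ 0) (j : ℕ) :
    qInt (τ + τ⁻¹) j * (τ - τ⁻¹) = τ ^ j - τ⁻¹ ^ j := by
  induction j using Nat.twoStepInduction with
  | zero => simp [qInt]
  | one => simp [qInt]
  | more j h1 h2 =>
    rw [qInt, sub_mul, mul_assoc, h2, h1, pow_succ, pow_succ, pow_succ, pow_succ]
    have := mul_inv_cancel₀ h
    linear_combination (τ ^ j - τ⁻¹ ^ j) * this

theorem qInt_eq_zero_iff {τ : ℂ} (h : τ ≠ 0) (h2 : τ ^ 2 ≠ 1) (j : ℕ) :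
    qInt (τ + τ⁻¹) j = 0 ↔ (τ ^ 2) ^ j = 1 := by
  have h3 : τ - τ⁻¹ ≠ 0 := fun h4 => h2 (by
    have := mul_inv_cancel₀ h
    linear_combination τ * h4 + this)
  rw [← mul_left_inj' h3, zero_mul, qInt_mul h, ← mul_right_inj' (pow_ne_zero j h), mul_zero,
    mul_sub, ← mul_pow, ← mul_pow, mul_inv_cancel₀ h, one_pow, sub_eq_zero, sq]

/-! ### Spin coordinates of morphisms out of `0` -/

/-- The partner of the bottom point `j`. -/
def mate {N : ℕ} (p : Diagram 0 N) (j : Fin N) : Fin N :=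
  Sum.elim (fun i : Fin 0 => i.elim0) id (p.pair (Sum.inr j))

theorem pair_inr {N : ℕ} (p : Diagram 0 N) (j : Fin N) :
    p.pair (Sum.inr j) = Sum.inr (mate p j) := by
  rw [mate]
  rcases p.pair (Sum.inr j) with i | i
  · exact i.elim0
  · rfl

theorem mate_mate {N : ℕ} (p : Diagram 0 N) (j : Fin N) : mate p (mate p j) = j :=
  Sum.inr_injective (by rw [← pair_inr, ← pair_inr, p.involutive])

theorem mate_ne {N : ℕ} (p : Diagram 0 N) (j : Fin N) : mate p j ≠ j := fun h =>
  p.fixedPointFree (Sum.inr j) (by rw [pair_inr, h])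

theorem mate_between {N : ℕ} (p : Diagram 0 N) {j k : Fin N} (h1 : j < k) (h2 : k < mate p j) :
    j < mate p k ∧ mate p k < mate p j := by
  have hk := k.isLt
  have hm := (mate p j).isLt
  have hn := (mate p k).isLt
  have := p.between (x := Sum.inr (mate p j)) (y := Sum.inr k)
    (by simp only [bIdx]; omega) (by rw [pair_inr, mate_mate]; simp only [bIdx]; omega)
  rw [pair_inr, pair_inr, mate_mate] at this
  simp only [bIdx] at this
  omega

theorem mate_ext {N : ℕ} {p p' : Diagram 0 N} (h : ∀ j, mate p j = mate p' j) : p = p' := by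
  refine Diagram.ext_pair ?_
  rintro (j | j)
  · exact j.elim0
  · rw [pair_inr, pair_inr, h]

/-- The coefficients of the arc `∩` in spin coordinates. -/
def arcWt (τ : K) : Bool → Bool → K
  | true, false => 1
  | false, true => τ
  | _, _ => 0

/-- The coefficients of the arc `∪` in spin coordinates. -/
def coarcWt (τ : K) : Bool → Bool → K
  | true, false => τ⁻¹
  | false, true => 1
  | _, _ => 0

/-- The spin coordinates of a diagram out of `0`. -/
noncomputable def spin (τ : K) {N : ℕ} (p : Diagram 0 N) (s : Fin N → Bool) : K :=
  ∏ j, if j < mate p j then arcWt τ (s j) (s (mate p j)) else 1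

theorem skip_lt_skip {m : ℕ} (i : Fin (m + 1)) {x y : Fin m} : skip i x < skip i y ↔ x < y := by
  rw [Fin.lt_def, Fin.lt_def, skip_val, skip_val]
  split_ifs <;> omega

theorem skip_lt_succ {m : ℕ} (i : Fin (m + 1)) (x : Fin m) :
    skip i x < i.succ ↔ skip i x < i.castSucc := by
  simp only [Fin.lt_def, skip_val, Fin.val_succ, Fin.val_castSucc]
  split_ifs <;> omega

theorem lt_skip_iff {m : ℕ} (i : Fin (m + 1)) (x : Fin m) :
    i.castSucc < skip i x ↔ ¬ skip i x < i.castSucc := by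
  simp only [Fin.lt_def, skip_val, Fin.val_castSucc]
  split_ifs <;> omega

theorem succ_lt_skip_iff {m : ℕ} (i : Fin (m + 1)) (x : Fin m) :
    i.succ < skip i x ↔ ¬ skip i x < i.castSucc := by
  simp only [Fin.lt_def, skip_val, Fin.val_succ, Fin.val_castSucc]
  split_ifs <;> omega

theorem prod_skip {M : Type} [CommMonoid M] {m : ℕ} (i : Fin (m + 1)) (F : Fin (m + 2) → M) :
    ∏ x, F x = F i.castSucc * (F i.succ * ∏ j, F (skip i j)) := by
  rw [Fin.prod_univ_succAbove F i.castSucc, Fin.prod_univ_succAbove _ i, Fin.succAbove_castSucc_self]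
  congr 2
  refine Finset.prod_congr rfl fun j _ => congrArg F (Fin.ext ?_)
  rw [skip_val]
  simp only [Fin.succAbove, Fin.lt_def, Fin.val_castSucc]
  split_ifs <;> simp_all
  omega

theorem mate_insertBot_castSucc {m : ℕ} (q : Diagram 0 m) (i : Fin (m + 1)) :
    mate (insertBot q i) i.castSucc = i.succ :=
  Sum.inr_injective (by rw [← pair_inr, insertBot_castSucc])

theorem mate_insertBot_succ {m : ℕ} (q : Diagram 0 m) (i : Fin (m + 1)) :
    mate (insertBot q i) i.succ = i.castSucc :=
  Sum.inr_injective (by rw [← pair_inr, insertBot_succ])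

theorem mate_insertBot_skip {m : ℕ} (q : Diagram 0 m) (i : Fin (m + 1)) (j : Fin m) :
    mate (insertBot q i) (skip i j) = skip i (mate q j) :=
  Sum.inr_injective (by
    rw [← pair_inr]
    refine (insertBot_skipS q i (Sum.inr j)).trans ?_
    rw [pair_inr]
    rfl)

theorem spin_insertBot (τ : K) {m : ℕ} (q : Diagram 0 m) (i : Fin (m + 1)) (r : Fin m → Bool)
    (a b : Bool) : spin τ (insertBot q i) (ins i r a b) = arcWt τ a b * spin τ q r := by
  rw [spin, prod_skip i, mate_insertBot_castSucc, mate_insertBot_succ,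
    if_pos Fin.castSucc_lt_succ, if_neg Fin.castSucc_lt_succ.not_gt, one_mul, ins_castSucc, ins_succ]
  simp only [mate_insertBot_skip, skip_lt_skip, ins_skip]
  rfl

theorem spin_contract (τ : K) (hτ : τ ≠ 0) {m : ℕ} {q : Diagram 0 (m + 2)} {c : Diagram 0 m}
    {i : Fin (m + 1)} {u v : Fin m} (hu : mate q i.castSucc = skip i u)
    (hv : mate q i.succ = skip i v) (hc : mate c u = v)
    (hx : ∀ x, x ≠ u → x ≠ v → skip i (mate c x) = mate q (skip i x)) (r : Fin m → Bool) :
    ∑ a, ∑ b, coarcWt τ a b * spin τ q (ins i r a b) = spin τ c r := by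
  have hc' : mate c v = u := by rw [← hc, mate_mate]
  have hu' : mate q (skip i u) = i.castSucc := by rw [← hu, mate_mate]
  have hv' : mate q (skip i v) = i.succ := by rw [← hv, mate_mate]
  have huv : v ≠ u := hc ▸ mate_ne c u
  have hlt : i.castSucc < i.succ := Fin.castSucc_lt_succ
  have hsplit : ∀ F : Fin m → K, ∏ j, F j = F u * (F v * ∏ j ∈ (Finset.univ.erase u).erase v, F j) := by
    intro F
    rw [Finset.mul_prod_erase _ _ (Finset.mem_erase.2 ⟨huv, Finset.mem_univ _⟩),
      Finset.mul_prod_erase _ _ (Finset.mem_univ _)]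
  have hrest : ∀ a b, ∏ j ∈ (Finset.univ.erase u).erase v,
      (if skip i j < mate q (skip i j) then
        arcWt τ (ins i r a b (skip i j)) (ins i r a b (mate q (skip i j))) else 1) =
      ∏ j ∈ (Finset.univ.erase u).erase v,
        if j < mate c j then arcWt τ (r j) (r (mate c j)) else 1 := by
    intro a b
    refine Finset.prod_congr rfl fun j hj => ?_
    simp only [Finset.mem_erase] at hj
    simp only [← hx j hj.2.1 hj.1, skip_lt_skip, ins_skip]
  have horder : (skip i u < i.castSucc → skip i v < i.castSucc → v < u) ∧
      (¬ skip i u < i.castSucc → ¬ skip i v < i.castSucc ∧ v < u) := by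
    refine ⟨fun h1 h2 => ?_, fun h1 => ?_⟩
    · by_contra h
      have h3 := mate_between q (j := skip i u) (k := skip i v)
        ((skip_lt_skip i).2 (lt_of_le_of_ne (not_lt.1 h) huv.symm)) (by rwa [hu'])
      rw [hu', hv'] at h3
      exact absurd h3.2 hlt.not_gt
    · have h3 := mate_between q hlt (by rwa [hu, succ_lt_skip_iff])
      rw [hu, hv, skip_lt_skip, lt_skip_iff] at h3
      exact h3
  simp only [spin, prod_skip i, hsplit, hrest]
  simp only [hu, hv, hu', hv', hc, hc', ins_castSucc, ins_succ,
    ins_skip, skip_lt_succ, lt_skip_iff, succ_lt_skip_iff]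
  generalize ∏ j ∈ (Finset.univ.erase u).erase v,
        (if j < mate c j then arcWt τ (r j) (r (mate c j)) else 1) = R
  by_cases h1 : skip i u < i.castSucc
  · by_cases h2 : skip i v < i.castSucc
    · have h3 := horder.1 h1 h2
      simp only [h1, h2, h3, h3.not_gt, if_true, if_false, not_true]
      cases r u <;> cases r v <;> simp [arcWt, coarcWt]
      field_simp
    · have h3 : u < v := by
        rw [← skip_lt_skip i]
        exact h1.trans ((lt_skip_iff i v).2 h2)
      simp only [h1, h2, h3, h3.not_gt, if_true, if_false, not_true, not_false_iff]
      cases r u <;> cases r v <;> simp [arcWt, coarcWt]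
      field_simp
  · obtain ⟨h2, h3⟩ := horder.2 h1
    simp only [h1, h2, h3, h3.not_gt, if_true, if_false, not_false_iff]
    cases r u <;> cases r v <;> simp [arcWt, coarcWt]
    field_simp

theorem spin_cupE (τ : K) (hτ : τ ≠ 0) {m : ℕ} (q : Diagram 0 (m + 2)) (i : Fin (m + 1)) :
    ∃ k c, IsComp (cupE i) q k c ∧ ∀ r,
      ∑ a, ∑ b, coarcWt τ a b * spin τ q (ins i r a b) = (τ + τ⁻¹) ^ k * spin τ c r := by
  obtain ⟨k, c, hc, hk, h⟩ := exists_isComp_cupE q i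
  by_cases hj : q.pair (Sum.inr i.castSucc) = Sum.inr i.succ
  · obtain ⟨q', rfl⟩ := exists_eq_insertBot q i hj
    have e : c = q' := Diagram.ext_pair fun x => skipS_injective i (by
      rw [h x, insertBot_skipS, if_neg (skipS_ne_castSucc _ _), if_neg (skipS_ne_succ _ _)])
    refine ⟨k, c, hc, fun r => ?_⟩
    rw [hk, if_pos hj, e]
    simp [spin_insertBot, arcWt, coarcWt]
    ring
  · refine ⟨k, c, hc, fun r => ?_⟩
    rw [hk, if_neg hj, pow_zero, one_mul]
    have h' : ∀ x, skip i (mate c x) = if mate q (skip i x) = i.castSucc then mate q i.succ else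
        if mate q (skip i x) = i.succ then mate q i.castSucc else mate q (skip i x) := by
      intro x
      have := h (Sum.inr x)
      simp only [pair_inr, show ∀ y : Fin m, (skipS i (Sum.inr y) : Fin 0 ⊕ Fin (m + 2)) =
        Sum.inr (skip i y) from fun _ => rfl, Sum.inr.injEq] at this
      rw [← Sum.inr.injEq (α := Fin 0), this]
      split_ifs <;> rfl
    rw [pair_inr, Sum.inr.injEq] at hj
    obtain ⟨u, hu⟩ : ∃ u, mate q i.castSucc = skip i u := by
      rcases skip_cases i (mate q i.castSucc) with e | e | e
      · exact absurd e (mate_ne q _)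
      · exact absurd e hj
      · exact e
    have hu' : mate q (skip i u) = i.castSucc := by rw [← hu, mate_mate]
    have hv : mate q i.succ = skip i (mate c u) := by rw [h', if_pos hu']
    refine spin_contract τ hτ hu hv rfl (fun x hxu hxv => ?_) r
    rw [h', if_neg, if_neg]
    · intro e
      exact hxv (skip_injective i (by rw [← hv, ← e, mate_mate]))
    · intro e
      exact hxu (skip_injective i (by rw [← hu, ← e, mate_mate]))

/-- The spin coordinates of a morphism out of `0`. -/
noncomputable def spinVec (τ : K) {N : ℕ} (x : Hom K 0 N) (s : Fin N → Bool) : K :=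
  ∑ p, x p * spin τ p s

theorem spinVec_single (τ : K) {N : ℕ} (p : Diagram 0 N) (s : Fin N → Bool) :
    spinVec τ (single p) s = spin τ p s := by
  simp [spinVec, single]

theorem spinVec_add (τ : K) {N : ℕ} (x y : Hom K 0 N) (s : Fin N → Bool) :
    spinVec τ (x + y) s = spinVec τ x s + spinVec τ y s := by
  simp [spinVec, add_mul, Finset.sum_add_distrib]

theorem spinVec_smul (τ k : K) {N : ℕ} (x : Hom K 0 N) (s : Fin N → Bool) :
    spinVec τ (k • x) s = k * spinVec τ x s := by
  simp [spinVec, Finset.mul_sum, mul_assoc]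

theorem spinVec_zero (τ : K) {N : ℕ} (s : Fin N → Bool) : spinVec τ (0 : Hom K 0 N) s = 0 := by
  simp [spinVec]

theorem spinVec_cupAt (τ : K) (hτ : τ ≠ 0) {m : ℕ} (x : Hom K 0 (m + 2)) (i : Fin (m + 1))
    (r : Fin m → Bool) : ∑ a, ∑ b, coarcWt τ a b * spinVec τ x (ins i r a b) =
      spinVec τ (comp (τ + τ⁻¹) (cupAt K i) x) r := by
  induction x using hom_induction with
  | hs q =>
    obtain ⟨k, c, hc, h⟩ := spin_cupE τ hτ q i
    simp only [spinVec_single, h]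
    rw [cupAt, hc.comp_eq, spinVec_smul, spinVec_single]
  | h0 => simp [spinVec_zero, comp_zero]
  | ha x y hx hy =>
    rw [comp_add, spinVec_add, ← hx, ← hy]
    simp only [spinVec_add, mul_add, Finset.sum_add_distrib]
  | hm k x hx =>
    rw [comp_smul, spinVec_smul, ← hx]
    simp only [spinVec_smul, Finset.mul_sum, mul_left_comm]

/-! ### Triangularity of the spin coordinates -/

/-- The spin configuration which is `true` exactly at the left ends of arcs. -/
noncomputable def openers {N : ℕ} (p : Diagram 0 N) (j : Fin N) : Bool := decide (j < mate p j)

theorem openers_mate {N : ℕ} (p : Diagram 0 N) (j : Fin N) :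
    openers p (mate p j) = !openers p j := by
  rw [openers, openers, mate_mate]
  rcases lt_or_gt_of_ne (mate_ne p j) with h | h
  · simp [h, h.not_gt]
  · simp [h, h.not_gt]

theorem spin_openers (τ : K) {N : ℕ} (p : Diagram 0 N) : spin τ p (openers p) = 1 := by
  refine Finset.prod_eq_one fun j _ => ?_
  split_ifs with h
  · rw [openers_mate, openers, decide_eq_true h]; rfl
  · rfl

theorem ne_of_spin_ne_zero {τ : K} {N : ℕ} {p : Diagram 0 N} {s : Fin N → Bool}
    (h : spin τ p s ≠ 0) (j : Fin N) : s (mate p j) = !s j := by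
  have key : ∀ j, j < mate p j → s (mate p j) = !s j := by
    intro j hj
    have h1 := Finset.prod_ne_zero_iff.1 h j (Finset.mem_univ j)
    rw [if_pos hj] at h1
    revert h1
    cases s j <;> cases s (mate p j) <;> simp [arcWt]
  rcases lt_or_gt_of_ne (mate_ne p j) with hj | hj
  · have := key (mate p j) (by rwa [mate_mate])
    rw [mate_mate] at this
    rw [this, Bool.not_not]
  · exact key j hj

/-- The number of `false` entries of a spin configuration. -/
def falses {N : ℕ} (s : Fin N → Bool) : ℕ := ∑ j, if s j then 0 else 1

/-- The involution `mate p` as a permutation. -/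
def mateEquiv {N : ℕ} (p : Diagram 0 N) : Equiv.Perm (Fin N) :=
  Function.Involutive.toPerm (mate p) (mate_mate p)

theorem sum_mate {N : ℕ} (p : Diagram 0 N) (f : Fin N → ℕ) : ∑ j, f (mate p j) = ∑ j, f j :=
  Equiv.sum_comp (mateEquiv p) f

theorem falses_of_spin_ne_zero {τ : K} {N : ℕ} {p : Diagram 0 N} {s : Fin N → Bool}
    (h : spin τ p s ≠ 0) : 2 * falses s = N := by
  rw [two_mul]
  nth_rewrite 1 [falses]
  rw [← sum_mate p, falses, ← Finset.sum_add_distrib]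
  simp only [ne_of_spin_ne_zero h]
  rw [Finset.sum_congr rfl fun j _ => show _ = 1 by cases s j <;> rfl]
  simp

theorem mate_le_of_openers_eq {N : ℕ} {p p' : Diagram 0 N} (h : openers p = openers p') {j : Fin N}
    (hj : j < mate p j) (ih : ∀ o, j < o → o < mate p o → mate p o = mate p' o) :
    mate p' j ≤ mate p j := by
  have ho : ∀ o, o < mate p o ↔ o < mate p' o := fun o => by
    have := congrFun h o
    rwa [openers, openers, decide_eq_decide] at this
  by_contra! hlt
  obtain ⟨h1, -⟩ := mate_between p' hj hlt
  have h2 : mate p' (mate p j) < mate p j := by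
    refine lt_of_le_of_ne (not_lt.1 fun h2 => ?_) (mate_ne _ _)
    have h3 := (ho _).2 h2
    rw [mate_mate] at h3
    exact h3.not_gt hj
  have h3 := ih _ h1 ((ho _).2 (by rwa [mate_mate]))
  rw [mate_mate] at h3
  have h4 := congrArg (mate p) h3
  rw [mate_mate, mate_mate] at h4
  exact h1.ne h4.symm

theorem openers_injective {N : ℕ} : Function.Injective (openers : Diagram 0 N → _) := by
  intro p p' h
  have key : ∀ n : ℕ, ∀ j : Fin N, N - j = n → j < mate p j → mate p j = mate p' j := by
    intro n
    induction n using Nat.strong_induction_on with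
    | _ n ih =>
      intro j hn hj
      have ih' : ∀ o, j < o → o < mate p o → mate p o = mate p' o := fun o ho hm =>
        ih (N - o) (by have := Fin.lt_def.1 ho; omega) o rfl hm
      have hj' : j < mate p' j := by
        have := congrFun h j
        rw [openers, openers, decide_eq_decide] at this
        exact this.1 hj
      refine le_antisymm (mate_le_of_openers_eq h.symm hj' fun o ho hm => (ih' o ho ?_).symm)
        (mate_le_of_openers_eq h hj ih')
      have := congrFun h o
      rw [openers, openers, decide_eq_decide] at this
      exact this.2 hm
  refine mate_ext fun j => ?_
  rcases lt_or_gt_of_ne (mate_ne p j) with hj | hj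
  · have := key _ (mate p j) rfl (by rwa [mate_mate])
    rw [mate_mate] at this
    rw [this, mate_mate, ← this]
  · exact key _ j rfl hj

/-- The sum of the positions of the left ends of arcs. -/
noncomputable def height {N : ℕ} (p : Diagram 0 N) : ℕ := ∑ j, if openers p j then (j : ℕ) else 0

theorem eq_of_spin_openers_ne_zero {τ : K} {N : ℕ} {p p' : Diagram 0 N}
    (h : spin τ p' (openers p) ≠ 0) (hh : height p ≤ height p') : p' = p := by
  set f : Fin N → ℕ := fun j => if openers p j then (j : ℕ) else 0 with hf
  set g : Fin N → ℕ := fun j => if openers p' j then (j : ℕ) else 0 with hg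
  have hs := ne_of_spin_ne_zero h
  have hle : ∀ j ∈ Finset.univ, g j + g (mate p' j) ≤ f j + f (mate p' j) := by
    intro j _
    simp only [hf, hg, hs, openers_mate]
    rcases lt_or_gt_of_ne (mate_ne p' j) with hj | hj <;> have hj' := Fin.lt_def.1 hj
    · rw [show openers p' j = false from decide_eq_false hj.not_gt]
      cases openers p j <;> simp
      omega
    · rw [show openers p' j = true from decide_eq_true hj]
      cases openers p j <;> simp
      omega
  have hsum : ∑ j, (g j + g (mate p' j)) = ∑ j, (f j + f (mate p' j)) := by
    refine le_antisymm (Finset.sum_le_sum hle) ?_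
    rw [Finset.sum_add_distrib, Finset.sum_add_distrib, sum_mate, sum_mate]
    exact Nat.add_le_add hh hh
  have heq := (Finset.sum_eq_sum_iff_of_le hle).1 hsum
  have key : ∀ j, j < mate p' j → openers p j = true := by
    intro j hj
    have h1 := heq j (Finset.mem_univ j)
    have hj' := Fin.lt_def.1 hj
    simp only [hf, hg, hs, openers_mate, show openers p' j = true from decide_eq_true hj] at h1
    by_contra h2
    rw [Bool.not_eq_true] at h2
    simp [h2] at h1
    omega
  refine openers_injective (funext fun j => ?_)
  rcases lt_or_gt_of_ne (mate_ne p' j) with hj | hj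
  · have := key (mate p' j) (by rwa [mate_mate])
    rw [hs] at this
    rw [show openers p' j = false from decide_eq_false hj.not_gt]
    simpa using this.symm
  · rw [key j hj]
    exact decide_eq_true hj

theorem exists_spinVec_ne_zero (τ : K) {N : ℕ} {x : Hom K 0 N} (hx : x ≠ 0) :
    ∃ s, spinVec τ x s ≠ 0 := by
  obtain ⟨p₀, hp₀⟩ := Function.ne_iff.1 hx
  obtain ⟨p, hp, hmin⟩ := Finset.exists_min_image (Finset.univ.filter fun p => x p ≠ 0) height
    ⟨p₀, by simpa using hp₀⟩
  refine ⟨openers p, ?_⟩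
  rw [spinVec, Finset.sum_eq_single p, spin_openers, mul_one]
  · exact (Finset.mem_filter.1 hp).2
  · intro p' _ hne
    by_contra h
    have h1 := left_ne_zero_of_mul h
    exact hne (eq_of_spin_openers_ne_zero (right_ne_zero_of_mul h)
      (hmin p' (Finset.mem_filter.2 ⟨Finset.mem_univ _, h1⟩)))
  · exact fun h => absurd (Finset.mem_univ _) h

theorem falses_of_spinVec_ne_zero {τ : K} {N : ℕ} {x : Hom K 0 N} {s : Fin N → Bool}
    (h : spinVec τ x s ≠ 0) : 2 * falses s = N := by
  obtain ⟨p, -, hp⟩ := Finset.exists_ne_zero_of_sum_ne_zero h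
  exact falses_of_spin_ne_zero (right_ne_zero_of_mul hp)

/-- Every diagram on `2a + 2` points has an arc between adjacent points of index at least `a`. -/
theorem exists_adjacent_arc {a : ℕ} (p : Diagram 0 (2 * a + 2)) :
    ∃ i : Fin (2 * a + 1), a ≤ (i : ℕ) ∧ p.pair (Sum.inr i.castSucc) = Sum.inr i.succ := by
  set S := Finset.univ.filter fun j => j < mate p j with hS
  have hcard : a + 1 ≤ S.card := by
    have h1 := falses_of_spin_ne_zero (τ := (1 : ℚ)) (p := p) (s := openers p)
      (by rw [spin_openers]; exact one_ne_zero)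
    have h2 : S.card = ∑ j, if openers p j then 1 else 0 := by
      rw [hS, Finset.card_filter]
      exact Finset.sum_congr rfl fun j _ => by simp [openers]
    have h3 : (∑ j, if openers p j then 1 else 0) + falses (openers p) = 2 * a + 2 := by
      rw [falses, ← Finset.sum_add_distrib,
        Finset.sum_congr rfl fun j _ => show _ = 1 by cases openers p j <;> rfl]
      simp
    omega
  obtain ⟨j, hj, hja⟩ : ∃ j ∈ S, a ≤ (j : ℕ) := by
    by_contra! h
    have := Finset.card_le_card_of_injOn (t := Finset.range a) (s := S) (fun j => (j : ℕ))
      (fun j hj => by simpa using h j hj) (fun j _ k _ e => Fin.ext e)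
    rw [Finset.card_range] at this
    omega
  obtain ⟨i, hi, hmax⟩ := Finset.exists_max_image S id ⟨j, hj⟩
  have hi' : i < mate p i := (Finset.mem_filter.1 hi).2
  have hia : a ≤ (i : ℕ) := hja.trans (hmax j hj)
  have hlt : (i : ℕ) < 2 * a + 1 := by
    have := Fin.lt_def.1 hi'
    have := (mate p i).isLt
    omega
  refine ⟨⟨i, hlt⟩, hia, ?_⟩
  rw [pair_inr]
  congr 1
  change mate p i = _
  by_contra hne
  have h1 : (⟨i, hlt⟩ : Fin (2 * a + 1)).succ < mate p i := by
    refine lt_of_le_of_ne ?_ (Ne.symm hne)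
    exact Fin.le_def.2 (Fin.lt_def.1 hi')
  obtain ⟨h2, -⟩ := mate_between p (j := i) (Fin.lt_def.2 (Nat.lt_succ_self _)) h1
  have h3 : (⟨i, hlt⟩ : Fin (2 * a + 1)).succ < mate p (⟨i, hlt⟩ : Fin (2 * a + 1)).succ :=
    lt_of_le_of_ne (Fin.le_def.2 (Fin.lt_def.1 h2)) (mate_ne p _).symm
  have h4 := Fin.le_def.1 (hmax _ (Finset.mem_filter.2 ⟨Finset.mem_univ _, h3⟩))
  simp at h4

/-! ### Vectors annihilated by all cups -/

theorem falses_add_trues {N : ℕ} (s : Fin N → Bool) :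
    falses s + Fintype.card {j // s j = true} = N := by
  rw [Fintype.card_subtype, Finset.card_filter, falses, ← Finset.sum_add_distrib,
    Finset.sum_congr rfl fun j _ => show _ = 1 by cases s j <;> rfl]
  simp

theorem exists_perm_of_falses_eq {N : ℕ} {s t : Fin N → Bool} (h : falses s = falses t) :
    ∃ σ : Equiv.Perm (Fin N), t ∘ σ = s := by
  have hs := falses_add_trues s
  have ht := falses_add_trues t
  have h1 : Fintype.card {j // s j = true} = Fintype.card {j // t j = true} := by omega
  have h2 : Fintype.card {j // s j = false} = Fintype.card {j // t j = false} := by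
    have hs' := Fintype.card_subtype_compl fun j => s j = true
    have ht' := Fintype.card_subtype_compl fun j => t j = true
    simp only [Bool.not_eq_true] at hs' ht'
    rw [hs', ht', h1]
  have e : ∀ c, Nonempty ({j // s j = c} ≃ {j // t j = c}) := by
    rintro (_ | _)
    · exact ⟨Fintype.equivOfCardEq h2⟩
    · exact ⟨Fintype.equivOfCardEq h1⟩
  exact ⟨Equiv.ofFiberEquiv fun c => (e c).some, funext fun j => Equiv.ofFiberEquiv_map _ j⟩

theorem eq_comp_perm {M : Type} {n : ℕ} {Y : (Fin (n + 1) → Bool) → M}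
    (hY : ∀ (i : Fin n) s, Y (s ∘ Equiv.swap i.castSucc i.succ) = Y s)
    (σ : Equiv.Perm (Fin (n + 1))) : ∀ s, Y (s ∘ σ) = Y s := by
  have hσ : σ ∈ Submonoid.closure
      (Set.range fun i : Fin n => Equiv.swap i.castSucc i.succ) := by
    rw [Equiv.Perm.mclosure_swap_castSucc_succ]; trivial
  induction hσ using Submonoid.closure_induction with
  | mem σ h => obtain ⟨i, rfl⟩ := h; exact hY i
  | one => exact fun s => rfl
  | mul σ σ' _ _ h h' => exact fun s => (h' (s ∘ σ)).trans (h s)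

/-- The weight `∏ (-τ) ^ j` over the positions `j` of the `false` entries. -/
def falseWt (τ : K) {N : ℕ} (s : Fin N → Bool) : K := ∏ j, if s j then 1 else (-τ) ^ (j : ℕ)

theorem falseWt_ne_zero {τ : K} (hτ : τ ≠ 0) {N : ℕ} (s : Fin N → Bool) : falseWt τ s ≠ 0 :=
  Finset.prod_ne_zero_iff.2 fun j _ => by
    split_ifs
    · exact one_ne_zero
    · exact pow_ne_zero _ (neg_ne_zero.2 hτ)

theorem falseWt_ins (τ : K) {m : ℕ} (i : Fin (m + 1)) (r : Fin m → Bool) :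
    falseWt τ (ins i r true false) = -τ * falseWt τ (ins i r false true) := by
  simp only [falseWt, prod_skip i, ins_castSucc, ins_succ, ins_skip, Fin.val_succ,
    Fin.val_castSucc, if_true, one_mul, pow_succ, Bool.false_eq_true, if_false]
  ring

theorem ins_comp_swap {m : ℕ} (i : Fin (m + 1)) (s : Fin (m + 2) → Bool) :
    s ∘ Equiv.swap i.castSucc i.succ = ins i (s ∘ skip i) (s i.succ) (s i.castSucc) := by
  funext x
  rcases skip_cases i x with rfl | rfl | ⟨j, rfl⟩
  · rw [ins_castSucc, Function.comp_apply, Equiv.swap_apply_left]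
  · rw [ins_succ, Function.comp_apply, Equiv.swap_apply_right]
  · rw [ins_skip, Function.comp_apply,
      Equiv.swap_apply_of_ne_of_ne (skip_ne_castSucc i j) (skip_ne_succ i j)]
    rfl

theorem spinVec_ins {τ : K} (hτ : τ ≠ 0) {m : ℕ} {x : Hom K 0 (m + 2)} {i : Fin (m + 1)}
    (hx : comp (τ + τ⁻¹) (cupAt K i) x = 0) (r : Fin m → Bool) :
    spinVec τ x (ins i r true false) = -τ * spinVec τ x (ins i r false true) := by
  have := spinVec_cupAt τ hτ x i r
  rw [hx, spinVec_zero] at this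
  simp [coarcWt] at this
  field_simp at this
  linear_combination this

theorem spinVec_div_falseWt {τ : K} (hτ : τ ≠ 0) {m : ℕ} {x : Hom K 0 (m + 2)}
    (hx : ∀ i : Fin (m + 1), comp (τ + τ⁻¹) (cupAt K i) x = 0) {s t : Fin (m + 2) → Bool}
    (h : falses s = falses t) :
    spinVec τ x s / falseWt τ s = spinVec τ x t / falseWt τ t := by
  obtain ⟨σ, rfl⟩ := exists_perm_of_falses_eq h
  refine eq_comp_perm (Y := fun s => spinVec τ x s / falseWt τ s) (fun i u => ?_) σ t
  have key : ∀ r, spinVec τ x (ins i r true false) / falseWt τ (ins i r true false) =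
      spinVec τ x (ins i r false true) / falseWt τ (ins i r false true) := fun r => by
    rw [spinVec_ins hτ (hx i), falseWt_ins, mul_div_mul_left _ _ (neg_ne_zero.2 hτ)]
  rw [ins_comp_swap]
  conv_rhs => rw [← ins_eta i u]
  cases u i.castSucc <;> cases u i.succ
  · rfl
  · exact key _
  · exact (key _).symm
  · rfl

theorem sum_spin_eq_zero (τ : K) {a : ℕ} (p : Diagram 0 (2 * a + 2))
    {φ : Fin (2 * a + 2) → Bool → K}
    (hφ : ∀ j : Fin (2 * a + 2), a ≤ (j : ℕ) → φ j false = (-τ) ^ (j : ℕ))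
    (hφ' : ∀ j : Fin (2 * a + 2), a ≤ (j : ℕ) → φ j true = 1) : ∑ s, (∏ j, φ j (s j)) * spin τ p s = 0 := by
  obtain ⟨i, hi, hp⟩ := exists_adjacent_arc p
  obtain ⟨q, rfl⟩ := exists_eq_insertBot p i hp
  rw [sum_ins i]
  refine Finset.sum_eq_zero fun r _ => ?_
  have h1 : a ≤ (i.castSucc : ℕ) := hi
  have h2 : a ≤ (i.succ : ℕ) := by rw [Fin.val_succ]; omega
  simp only [prod_skip i, ins_castSucc, ins_succ, ins_skip, spin_insertBot]
  simp [arcWt, hφ _ h1, hφ _ h2, hφ' _ h1, hφ' _ h2]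
  ring

theorem sum_spinVec_eq_zero (τ : K) {a : ℕ} (x : Hom K 0 (2 * a + 2))
    {φ : Fin (2 * a + 2) → Bool → K}
    (hφ : ∀ j : Fin (2 * a + 2), a ≤ (j : ℕ) → φ j false = (-τ) ^ (j : ℕ))
    (hφ' : ∀ j : Fin (2 * a + 2), a ≤ (j : ℕ) → φ j true = 1) : ∑ s, (∏ j, φ j (s j)) * spinVec τ x s = 0 := by
  simp only [spinVec, Finset.mul_sum]
  rw [Finset.sum_comm]
  refine Finset.sum_eq_zero fun p _ => ?_
  have := sum_spin_eq_zero τ p hφ hφ'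
  rw [← mul_zero (x p), ← this, Finset.mul_sum]
  exact Finset.sum_congr rfl fun s _ => by ring

open Polynomial in
theorem coeff_prod_add {N : ℕ} (φ : Fin N → Bool → K) (n : ℕ) :
    (∏ j, (C (φ j true) + C (φ j false) * X)).coeff n =
      ∑ s : Fin N → Bool, if falses s = n then ∏ j, φ j (s j) else 0 := by
  have h : ∀ j, (C (φ j true) + C (φ j false) * X : K[X]) =
      ∑ b, C (φ j b) * X ^ (if b then 0 else 1) := fun j => by simp
  simp only [h, Fintype.prod_sum, Finset.prod_mul_distrib, Finset.prod_pow_eq_pow_sum]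
  rw [finsetSum_coeff]
  refine Finset.sum_congr rfl fun s _ => ?_
  rw [← map_prod, coeff_C_mul, coeff_X_pow, mul_ite, mul_one, mul_zero]
  simp only [falses, eq_comm]

open Polynomial in
theorem coeff_prod_eq_zero {τ : K} (hτ : τ ≠ 0) {a : ℕ} {x : Hom K 0 (2 * a + 2)} (hx0 : x ≠ 0)
    (hx : ∀ i : Fin (2 * a + 1), comp (τ + τ⁻¹) (cupAt K i) x = 0)
    {φ : Fin (2 * a + 2) → Bool → K}
    (hφ : ∀ j : Fin (2 * a + 2), a ≤ (j : ℕ) → φ j false = (τ ^ 2) ^ (j : ℕ))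
    (hφ' : ∀ j : Fin (2 * a + 2), a ≤ (j : ℕ) → φ j true = 1) :
    (∏ j, (C (φ j true) + C (φ j false) * X)).coeff (a + 1) = 0 := by
  obtain ⟨s₀, hs₀⟩ := exists_spinVec_ne_zero τ hx0
  have hτ' : -τ ≠ 0 := neg_ne_zero.2 hτ
  set w : Fin (2 * a + 2) → Bool → K := fun j b => if b then 1 else (-τ) ^ (j : ℕ) with hw
  have hw0 : ∀ j b, w j b ≠ 0 := fun j b => by
    cases b
    · exact pow_ne_zero _ hτ'
    · exact one_ne_zero
  have h := sum_spinVec_eq_zero τ x (φ := fun j b => φ j b / w j b)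
    (fun j hj => by
      simp only [hφ j hj, hw, Bool.false_eq_true, if_false]
      rw [div_eq_iff (pow_ne_zero _ hτ'), ← mul_pow, neg_mul_neg, sq])
    (fun j hj => by simp [hφ' j hj, hw])
  have h₀ : falses s₀ = a + 1 := by
    have := falses_of_spinVec_ne_zero hs₀
    omega
  have hc : spinVec τ x s₀ / falseWt τ s₀ ≠ 0 := div_ne_zero hs₀ (falseWt_ne_zero hτ _)
  have hterm : ∀ s, (∏ j, φ j (s j) / w j (s j)) * spinVec τ x s =
      (if falses s = a + 1 then ∏ j, φ j (s j) else 0) * (spinVec τ x s₀ / falseWt τ s₀) := by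
    intro s
    split_ifs with hs
    · rw [← spinVec_div_falseWt hτ hx (hs.trans h₀.symm), Finset.prod_div_distrib,
        show ∏ j, w j (s j) = falseWt τ s from rfl]
      ring
    · rw [zero_mul, mul_eq_zero]
      right
      by_contra hne
      have := falses_of_spinVec_ne_zero hne
      omega
  simp only [hterm] at h
  rw [← Finset.sum_mul, mul_eq_zero, or_iff_left hc] at h
  rw [coeff_prod_add, h]

open Polynomial in
theorem coeff_prod_range_eq_zero {τ : K} (hτ : τ ≠ 0) {a : ℕ} {x : Hom K 0 (2 * a + 2)}
    (hx0 : x ≠ 0) (hx : ∀ i : Fin (2 * a + 1), comp (τ + τ⁻¹) (cupAt K i) x = 0) {b : ℕ}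
    (hb0 : 0 < b) (hb : b ≤ a + 1) :
    (∏ j ∈ Finset.range (a + 2), (1 + C ((τ ^ 2) ^ (a + j)) * X)).coeff b = 0 := by
  obtain ⟨e, he⟩ := Nat.exists_eq_add_of_lt hb0
  obtain ⟨c, hc⟩ := Nat.exists_eq_add_of_le hb
  have h := coeff_prod_eq_zero hτ hx0 hx (φ := fun j t => if a ≤ (j : ℕ) then
      if t then 1 else (τ ^ 2) ^ (j : ℕ) else if ((j : ℕ) < c ↔ t = true) then 0 else 1)
    (fun j hj => by simp [hj]) (fun j hj => by simp [hj])
  rw [Fin.prod_univ_eq_prod_range (fun j => C (if a ≤ j then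
      if true = true then (1 : K) else (τ ^ 2) ^ j else if (j < c ↔ true = true) then 0 else 1) +
      C (if a ≤ j then if false = true then (1 : K) else (τ ^ 2) ^ j else
        if (j < c ↔ false = true) then 0 else 1) * X),
    show 2 * a + 2 = c + e + (a + 2) by omega, Finset.prod_range_add, Finset.prod_range_add,
    Finset.prod_congr rfl fun j hj => show _ = (X : K[X]) by
      have := Finset.mem_range.1 hj
      simp [this, show ¬ a ≤ j by omega],
    Finset.prod_congr (s₁ := Finset.range e) rfl fun j hj => show _ = (1 : K[X]) by
      have := Finset.mem_range.1 hj
      simp [show ¬ a ≤ c + j by omega],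
    Finset.prod_congr (s₁ := Finset.range (a + 2)) rfl fun j hj =>
      show _ = (1 + C ((τ ^ 2) ^ (a + j)) * X : K[X]) by
        simp [show c + e = a by omega]] at h
  rwa [Finset.prod_const, Finset.card_range, Finset.prod_const_one, mul_one, hc,
    coeff_X_pow_mul] at h

open Polynomial in
theorem orderOf_eq_of_coeff_eq_zero [CharZero K] {q : K} (hq : q ≠ 0) {a : ℕ}
    (h : ∀ b, 0 < b → b ≤ a + 1 →
      (∏ j ∈ Finset.range (a + 2), (1 + C (q ^ (a + j)) * X)).coeff b = 0) :
    orderOf q = a + 2 := by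
  set P : K[X] := ∏ j ∈ Finset.range (a + 2), (1 + C (q ^ (a + j)) * X) with hP
  have hdeg : P.natDegree ≤ a + 2 := by
    refine (natDegree_prod_le _ _).trans ((Finset.sum_le_card_nsmul _ _ 1 fun j _ => ?_).trans ?_)
    · rw [add_comm, ← C_1]
      exact natDegree_linear_le
    · simp
  have hPe : P = 1 + C (P.coeff (a + 2)) * X ^ (a + 2) := by
    ext n
    rw [coeff_add, coeff_C_mul, coeff_X_pow, coeff_one]
    rcases Nat.eq_zero_or_pos n with rfl | hn
    · rw [coeff_zero_eq_eval_zero, hP, eval_prod]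
      simp
    rcases lt_trichotomy n (a + 2) with h1 | rfl | h1
    · rw [h n hn (by omega)]
      simp [h1.ne, hn.ne']
    · simp
    · rw [coeff_eq_zero_of_natDegree_lt (hdeg.trans_lt h1)]
      simp [h1.ne', hn.ne']
  generalize P.coeff (a + 2) = e at hPe
  have hroot : ∀ j < a + 2, 1 + e * (-(q ^ (a + j))⁻¹) ^ (a + 2) = 0 := by
    intro j hj
    have h1 : P.eval (-(q ^ (a + j))⁻¹) = 0 := by
      rw [hP, eval_prod]
      refine Finset.prod_eq_zero (Finset.mem_range.2 hj) ?_
      simp [mul_inv_cancel₀ (pow_ne_zero (a + j) hq)]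
    rw [hPe] at h1
    simpa using h1
  have h0 := hroot 0 (by omega)
  have h1 := hroot 1 (by omega)
  have he : e ≠ 0 := by rintro rfl; simp at h0
  have hpow : q ^ (a + 2) = 1 := by
    have h2 : (-(q ^ (a + 0))⁻¹) ^ (a + 2) = (-(q ^ (a + 1))⁻¹) ^ (a + 2) := by
      apply mul_left_cancel₀ he
      linear_combination h0 - h1
    rw [neg_pow, neg_pow (q ^ (a + 1))⁻¹] at h2
    have h3 := mul_left_cancel₀ (pow_ne_zero _ (neg_ne_zero.2 one_ne_zero)) h2
    rw [inv_pow, inv_pow, inv_inj, add_zero, pow_succ q a, mul_pow] at h3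
    exact (mul_eq_left₀ (pow_ne_zero _ (pow_ne_zero _ hq))).1 h3.symm
  have hdvd := orderOf_dvd_of_pow_eq_one hpow
  have hpos : 0 < orderOf q := orderOf_pos_iff.2 (isOfFinOrder_iff_pow_eq_one.2 ⟨_, by omega, hpow⟩)
  refine le_antisymm (Nat.le_of_dvd (by omega) hdvd) (not_lt.1 fun hlt => ?_)
  have hsplit : P = (1 + C (q ^ a) * X) * ((1 + C (q ^ a) * X) *
      ∏ j ∈ ((Finset.range (a + 2)).erase 0).erase (orderOf q), (1 + C (q ^ (a + j)) * X)) := by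
    rw [hP, ← Finset.mul_prod_erase _ _ (Finset.mem_range.2 (show 0 < a + 2 by omega)),
      ← Finset.mul_prod_erase _ _ (Finset.mem_erase.2 ⟨hpos.ne', Finset.mem_range.2 hlt⟩),
      pow_add q a (orderOf q), pow_orderOf_eq_one, mul_one, add_zero]
  have hz : 1 + q ^ a * (-(q ^ a)⁻¹) = 0 := by
    simp [mul_inv_cancel₀ (pow_ne_zero a hq)]
  have hd : (derivative P).eval (-(q ^ a)⁻¹) = 0 := by
    rw [hsplit]
    simp only [derivative_mul, eval_add, eval_mul, eval_one, eval_C, eval_X, hz]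
    ring
  rw [hPe] at hd
  simp [he, hq] at hd
  norm_cast at hd

theorem orderOf_of_killed [CharZero K] {τ : K} (hτ : τ ≠ 0) {N : ℕ} (hN : 0 < N) {x : Hom K 0 N}
    (hx0 : x ≠ 0) (hx : KilledBelow (τ + τ⁻¹) x) : 2 * orderOf (τ ^ 2) = N + 2 := by
  obtain ⟨s, hs⟩ := exists_spinVec_ne_zero τ hx0
  have h := falses_of_spinVec_ne_zero hs
  obtain ⟨a, rfl⟩ : ∃ a, N = 2 * a + 2 := ⟨falses s - 1, by omega⟩
  rw [orderOf_eq_of_coeff_eq_zero (pow_ne_zero 2 hτ) fun b hb0 hb =>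
    coeff_prod_range_eq_zero hτ hx0 (fun i => hx _ (by omega) _) hb0 hb]
  omega

/-! ### Nonzero ideals -/

theorem KilledAbove.comp_eq {d : K} {m n : ℕ} {x : Hom K m n} (hx : KilledAbove d x)
    (y : Hom K m m) : comp d x y = y (idD m) • x := by
  induction y using hom_induction with
  | hs p =>
    rw [single_idD_apply]
    split_ifs with h
    · rw [h, one_smul]; exact comp_id d x
    · obtain ⟨m', rfl, i, p', hc⟩ := exists_bottom_adj p fun h' => h (by
        rw [← flip_flip p, h'.eq_idD, flip_idD])
      have hc' : IsComp (capE i) p' 0 p := hc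
      have := hc'.comp_eq d
      rw [pow_zero, one_smul] at this
      rw [zero_smul]
      change comp d x (single p) = 0
      rw [← this, ← comp_assoc, hx _ (by omega), zero_comp]
  | h0 => rw [comp_zero, Pi.zero_apply, zero_smul]
  | ha y z hy hz => rw [comp_add, hy, hz, Pi.add_apply, add_smul]
  | hm k y hy => rw [comp_smul, hy, Pi.smul_apply, smul_assoc]

/-- `J m n` contains a nonzero morphism. -/
def NonzeroAt (J : ∀ m n : ℕ, Set (Hom K m n)) (m n : ℕ) : Prop := ∃ x ∈ J m n, x ≠ 0

theorem IsIdeal.nonzeroAt_succ {d : K} {J : ∀ m n : ℕ, Set (Hom K m n)} (hJ : IsIdeal d J)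
    (m n : ℕ) : NonzeroAt J (m + 1) n ↔ NonzeroAt J m (n + 1) := by
  constructor
  · rintro ⟨x, hx, hx0⟩
    refine ⟨comp d (St x) (capL K m), hJ.comp_mem_right _ _ (hJ.St_mem hx), fun h => hx0 ?_⟩
    have h1 : comp d (cupL K n) (St (comp d (St x) (capL K m))) = x := by
      rw [← comp_St, ← comp_assoc, cup_St_St, comp_assoc, cup_St_cap, comp_id]
    rw [← h1, h, St_zero, comp_zero]
  · rintro ⟨y, hy, hy0⟩
    refine ⟨comp d (cupL K n) (St y), hJ.comp_mem_left _ _ (hJ.St_mem hy), fun h => hy0 ?_⟩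
    have h1 : comp d (St (comp d (cupL K n) (St y))) (capL K m) = y := by
      rw [← comp_St, comp_assoc, St_St_cap, ← comp_assoc, St_cup_cap, id_comp]
    rw [← h1, h, St_zero, zero_comp]

theorem IsIdeal.nonzeroAt_iff {d : K} {J : ∀ m n : ℕ, Set (Hom K m n)} (hJ : IsIdeal d J)
    (m n : ℕ) : NonzeroAt J m n ↔ NonzeroAt J 0 (m + n) := by
  induction m generalizing n with
  | zero => rw [Nat.zero_add]
  | succ m ih => rw [hJ.nonzeroAt_succ, ih, Nat.add_right_comm, Nat.add_assoc]

theorem IsIdeal.jw_mem [CharZero K] {τ : K} (hτ : τ ≠ 0) {L : ℕ} (hL : orderOf (τ ^ 2) = L + 1)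
    (h : ∀ k, 0 < k → k ≤ L → qInt (τ + τ⁻¹) k ≠ 0) {J : ∀ m n : ℕ, Set (Hom K m n)}
    (hJ : IsIdeal (τ + τ⁻¹) J) (hJ0 : IdealNonzero J) : jw (τ + τ⁻¹) L ∈ J L L := by
  have hex : ∃ N, NonzeroAt J 0 N := by
    obtain ⟨m, n, hmn⟩ := hJ0
    exact ⟨m + n, (hJ.nonzeroAt_iff m n).1 hmn⟩
  have hmin : ∀ m n, m + n < Nat.find hex → ∀ x ∈ J m n, x = 0 := fun m n hlt x hx => by
    by_contra hx0
    exact Nat.find_min hex hlt ((hJ.nonzeroAt_iff m n).1 ⟨x, hx, hx0⟩)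
  have hfind := Nat.find_spec hex
  generalize Nat.find hex = N at hmin hfind
  have killed : ∀ {m n : ℕ} {x : Hom K m n}, m + n = N → x ∈ J m n → KilledBelow (τ + τ⁻¹) x :=
    fun hmn hx k hk y => hmin _ k (by omega) _ (hJ.comp_mem_left y _ hx)
  rcases Nat.eq_zero_or_pos N with rfl | hN
  · obtain ⟨x, hx, hx0⟩ := hfind
    have hT : Tr (τ + τ⁻¹) x ≠ 0 := by
      rw [hom_zero_eq x, Tr_smul, show idHom K 0 = single (idD 0) from rfl, Tr_single,
        trLoops_idD_zero, pow_zero, mul_one]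
      intro h0
      rw [hom_zero_eq x, h0, zero_smul] at hx0
      exact hx0 rfl
    rw [hJ.eq_univ hx hT]
    trivial
  · have hNL : N = L + L := by
      obtain ⟨x, hx, hx0⟩ := hfind
      have := orderOf_of_killed hτ hN hx0 (killed (Nat.zero_add N) hx)
      omega
    rw [hNL, ← hJ.nonzeroAt_iff] at hfind
    obtain ⟨y, hy, hy0⟩ := hfind
    have h1 := (killed hNL.symm hy).comp_eq (jw (τ + τ⁻¹) L)
    rw [jw_apply_idD, one_smul, (jw_killedAbove h).comp_eq] at h1
    have hc : y (idD L) ≠ 0 := fun hc => hy0 (by rw [← h1, hc, zero_smul])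
    rw [← inv_smul_smul₀ hc (jw (τ + τ⁻¹) L), h1]
    exact hJ.smul_mem L L _ y hy

/-- Let `τ ∈ ℂ` be a proper root of unity.  Then the negligible
morphisms form a nonzero proper ideal of `TL(τ)`, and every nonzero proper
ideal of `TL(τ)` equals `Negl`; that is, `Negl` is the unique nonzero proper
ideal of `TL(τ)`. -/
theorem stmt3 (τ : ℂ) (hroot : ∃ k : ℕ, 0 < k ∧ τ ^ k = 1) (h2 : τ ^ 2 ≠ 1) :
    (IsIdeal (τ + τ⁻¹) (Negl (τ + τ⁻¹)) ∧
      IdealNonzero (Negl (τ + τ⁻¹)) ∧ IdealProper (Negl (τ + τ⁻¹))) ∧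
    (∀ J : ∀ m n : ℕ, Set (Hom ℂ m n), IsIdeal (τ + τ⁻¹) J →
      IdealNonzero J → IdealProper J → ∀ m n : ℕ, J m n = Negl (τ + τ⁻¹) m n) := by
  obtain ⟨k, hk0, hk⟩ := hroot
  have hτ : τ ≠ 0 := by
    rintro rfl
    rw [zero_pow hk0.ne'] at hk
    exact zero_ne_one hk
  have hpos : 0 < orderOf (τ ^ 2) := orderOf_pos_iff.2 (isOfFinOrder_iff_pow_eq_one.2
    ⟨k, hk0, by rw [← pow_mul, mul_comm, pow_mul, hk, one_pow]⟩)
  obtain ⟨L, hL⟩ : ∃ L, orderOf (τ ^ 2) = L + 1 := ⟨orderOf (τ ^ 2) - 1, by omega⟩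
  have hq : ∀ j, 0 < j → j ≤ L → qInt (τ + τ⁻¹) j ≠ 0 := fun j hj0 hj h => by
    rw [qInt_eq_zero_iff hτ h2, ← orderOf_dvd_iff_pow_eq_one] at h
    have := Nat.le_of_dvd hj0 h
    omega
  have hq0 : qInt (τ + τ⁻¹) (L + 1) = 0 := by
    rw [qInt_eq_zero_iff hτ h2, ← hL, pow_orderOf_eq_one]
  refine ⟨⟨isIdeal_negl _, ⟨L, L, _, jw_mem_negl hq hq0, jw_ne_zero _ L⟩, negl_proper _⟩,
    fun J hJ hJ0 hJp m n => Set.Subset.antisymm (hJ.subset_negl hJp m n) ?_⟩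
  exact negl_subset hq hJ (hJ.jw_mem hτ hL hq hJ0) m n

end TL
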